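/- arXiv:2504.16248 — 3 statements merged into one kernel-verified Lean document; each statement's English description precedes it below -/
import Mathlib

section
/- Let Γ be an even unimodular positive definite lattice of rank 24 containing a sublattice isometric to P(−1) that is NOT primitive. Then the sublattice of Γ generated by its roots (the vectors v ∈ Γ with ⟨v,v⟩ = 2) is isometric to the orthogonal direct sum of four copies of the E₆ root lattice. Moreover, such a configuration exists: there is an even unimodular positive definite lattice of rank 24 containing a non-primitive sublattice isometric to P(−1). -/
noncomputable section

abbrev F3 : Type := ZMod 3 × ZMod 3
abbrev IP : Type := F3 × Fin 2
abbrev VP : Type := IP → ℚ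

/-- The basis vectors `E_t^(k)` (with `k : Fin 2` corresponding to `k+1 ∈ {1,2}`). -/
def Ev (t : F3) (k : Fin 2) : VP := Pi.single (t, k) 1

/-- Gram coefficients of the bilinear form on `V`. -/
def GP : IP → IP → ℚ := fun i j =>
  if i.1 = j.1 then (if i.2 = j.2 then -2 else 1) else 0

/-- The symmetric bilinear form on `V`. -/
def BP (x y : VP) : ℚ := ∑ i : IP, ∑ j : IP, x i * GP i j * y j

lemma BP_add_left (a b x : VP) : BP (a + b) x = BP a x + BP b x := by
  simp only [BP, Pi.add_apply, add_mul, Finset.sum_add_distrib]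

lemma BP_zsmul_left (c : ℤ) (a x : VP) : BP (c • a) x = c * BP a x := by
  simp only [BP, Pi.smul_apply, zsmul_eq_mul, Finset.mul_sum, mul_assoc]

lemma BP_zero_left (x : VP) : BP 0 x = 0 := by
  simp [BP]

/-- `E_t := E_t^(1) + 2·E_t^(2)`. -/
def EV (t : F3) : VP := Ev t 0 + 2 • Ev t 1

/-- The affine line in `𝔽₃²` through `p` with direction `d`. -/
def lineF (p d : F3) : Finset F3 := Finset.image (fun s : ZMod 3 => p + s • d) Finset.univ

def IsLine (L : Finset F3) : Prop := ∃ p d : F3, d ≠ 0 ∧ L = lineF p d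

def AreParallel (L L' : Finset F3) : Prop :=
  ∃ p p' d : F3, d ≠ 0 ∧ L = lineF p d ∧ L' = lineF p' d

/-- `e(L) := (1/3)·∑_{t∈L} E_t`. -/
def eL (L : Finset F3) : VP := (3 : ℚ)⁻¹ • ∑ t ∈ L, EV t

/-- Generators of the root lattice `R` of type `A₂⁹`. -/
def Rgen : Set VP := {x | ∃ t k, x = Ev t k}

/-- The root lattice `R`. -/
def Rlat : Submodule ℤ VP := Submodule.span ℤ Rgen

/-- The lattice `P`. -/
def Plat : Submodule ℤ VP :=
  Submodule.span ℤ (Rgen ∪ {x | ∃ L L', AreParallel L L' ∧ x = eL L - eL L'})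

/-- The dual lattice `Λ* = {v | ⟨v,λ⟩ ∈ ℤ for all λ ∈ Λ}`. -/
def dualP (Λ : Submodule ℤ VP) : Submodule ℤ VP where
  carrier := {v | ∀ x ∈ Λ, ∃ n : ℤ, BP v x = n}
  zero_mem' := fun x _ => ⟨0, by simp [BP_zero_left]⟩
  add_mem' := by
    intro a b ha hb x hx
    obtain ⟨n, hn⟩ := ha x hx
    obtain ⟨m, hm⟩ := hb x hx
    exact ⟨n + m, by rw [BP_add_left, hn, hm]; push_cast; ring⟩
  smul_mem' := by
    intro c v hv x hx
    obtain ⟨n, hn⟩ := hv x hx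
    exact ⟨c * n, by rw [BP_zsmul_left, hn]; push_cast; ring⟩

def L12 : Finset F3 := lineF (0, 0) (0, 1)
def L34 : Finset F3 := lineF (0, 0) (1, 0)
def L00 : Finset F3 := lineF (0, 0) (1, 1)

def p1 : VP := eL L34 + eL L00
def p2 : VP := eL L12 + eL L34
def p3 : VP := eL L12 + eL L00

def pv : Fin 3 → VP := ![p1, p2, p3]

section
open Matrix in
theorem HR_min {n : ℕ} (S : Matrix (Fin (n+1)) (Fin (n+1)) ℚ)
    (hpos : ∀ v : Fin (n+1) → ℚ, v ≠ 0 → 0 < v ⬝ᵥ S *ᵥ v)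
    (hint : ∃ N : ℕ, 0 < N ∧ ∀ i j, ∃ z : ℤ, (N : ℚ) * S i j = z) :
    ∃ U : Matrix (Fin (n+1)) (Fin (n+1)) ℤ, IsUnit U.det ∧
      ∀ X : Matrix (Fin (n+1)) (Fin (n+1)) ℤ, IsUnit X.det →
        (fun i => (U i 0 : ℚ)) ⬝ᵥ S *ᵥ (fun i => (U i 0 : ℚ)) ≤
        (fun i => (X i 0 : ℚ)) ⬝ᵥ S *ᵥ (fun i => (X i 0 : ℚ)) := by
  obtain ⟨N, hN, hz⟩ := hint
  choose z hz using hz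
  have key : ∀ X : Matrix (Fin (n+1)) (Fin (n+1)) ℤ, IsUnit X.det →
      ∃ k : ℕ, (k : ℚ) = N * ((fun i => (X i 0 : ℚ)) ⬝ᵥ S *ᵥ (fun i => (X i 0 : ℚ))) := by
    intro X hX
    have hne : (fun i => (X i 0 : ℚ)) ≠ 0 := by
      intro h
      have : X.det = 0 := by
        apply Matrix.det_eq_zero_of_column_eq_zero 0
        intro i
        have := congrFun h i
        simpa using this
      rw [this] at hX
      simp at hX
    have hp := hpos _ hne
    have : ((∑ i, ∑ j, X i 0 * z i j * X j 0 : ℤ) : ℚ) =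
        N * ((fun i => (X i 0 : ℚ)) ⬝ᵥ S *ᵥ (fun i => (X i 0 : ℚ))) := by
      push_cast
      simp only [dotProduct, mulVec, Finset.mul_sum, ← hz]
      refine Finset.sum_congr rfl fun i _ => Finset.sum_congr rfl fun j _ => ?_
      ring
    have h0 : 0 ≤ ∑ i, ∑ j, X i 0 * z i j * X j 0 := by
      have : (0:ℚ) ≤ ((∑ i, ∑ j, X i 0 * z i j * X j 0 : ℤ) : ℚ) := by
        rw [this]; positivity
      exact_mod_cast this
    refine ⟨(∑ i, ∑ j, X i 0 * z i j * X j 0).toNat, ?_⟩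
    rw [← this]
    have h2 := Int.toNat_of_nonneg h0
    exact_mod_cast h2
  classical
  let P : ℕ → Prop := fun k => ∃ X : Matrix (Fin (n+1)) (Fin (n+1)) ℤ, IsUnit X.det ∧
    (k : ℚ) = N * ((fun i => (X i 0 : ℚ)) ⬝ᵥ S *ᵥ (fun i => (X i 0 : ℚ)))
  have hP : ∃ k, P k := by
    obtain ⟨k, hk⟩ := key 1 (by simp)
    exact ⟨k, 1, by simp, hk⟩
  obtain ⟨U, hU, hUk⟩ := Nat.find_spec hP
  refine ⟨U, hU, fun X hX => ?_⟩
  obtain ⟨k, hk⟩ := key X hX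
  have h1 : Nat.find hP ≤ k := Nat.find_min' hP ⟨X, hX, hk⟩
  have h2 : ((Nat.find hP : ℕ) : ℚ) ≤ k := by exact_mod_cast h1
  rw [hUk, hk] at h2
  have : (0:ℚ) < N := by exact_mod_cast hN
  exact le_of_mul_le_mul_left h2 this

theorem round_lem (q : ℚ) : ∃ z : ℤ, (z + q)^2 ≤ 1/4 := by
  refine ⟨- round q, ?_⟩
  have h := abs_sub_round q
  have h' : |q - round q| ≤ |(1/2 : ℚ)| := by rwa [abs_of_pos (by norm_num : (0:ℚ) < 1/2)]
  have := sq_le_sq.mpr h'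
  push_cast
  nlinarith

open Matrix in
theorem HR (n : ℕ) : ∀ (S : Matrix (Fin n) (Fin n) ℚ), (∀ i j, S i j = S j i) →
    (∀ v : Fin n → ℚ, v ≠ 0 → 0 < v ⬝ᵥ S *ᵥ v) →
    (∃ N : ℕ, 0 < N ∧ ∀ i j, ∃ z : ℤ, (N : ℚ) * S i j = z) →
    ∃ (U : Matrix (Fin n) (Fin n) ℤ) (T : Matrix (Fin n) (Fin n) ℚ) (c : Fin n → ℚ),
      IsUnit U.det ∧ (∀ k, T k k = 1) ∧ (∀ k i, i < k → T k i = 0) ∧ (∀ k, 0 < c k) ∧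
      (∀ k l : Fin n, k.val + 1 = l.val → 3/4 * c k ≤ c l) ∧
      ∀ i j, ∑ a, ∑ b, (U a i : ℚ) * S a b * U b j = ∑ k, T k i * c k * T k j := by
  induction n with
  | zero =>
    intro S _ _ _
    exact ⟨1, 1, 0, by simp, by simp, by intro k; exact k.elim0, by intro k; exact k.elim0, by intro k; exact k.elim0, by intro k; exact k.elim0⟩
  | succ n ih =>
    intro S hsym hpos hint
    obtain ⟨U0, hU0, hmin⟩ := HR_min S hpos hint
    obtain ⟨N, hN, hz⟩ := hint
    choose z hz using hz
    set U0q : Matrix (Fin (n+1)) (Fin (n+1)) ℚ := U0.map (Int.cast) with hU0q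
    have hU0q' : IsUnit U0q.det := by
      have : U0q.det = ((U0.det : ℤ) : ℚ) := by
        rw [hU0q]; exact (Int.cast_det U0).symm
      rw [this]; exact hU0.map (Int.castRingHom ℚ)
    set S0 : Matrix (Fin (n+1)) (Fin (n+1)) ℚ := U0qᵀ * S * U0q with hS0
    have hquad : ∀ w : Fin (n+1) → ℚ, (U0q *ᵥ w) ⬝ᵥ S *ᵥ (U0q *ᵥ w) = w ⬝ᵥ S0 *ᵥ w := by
      intro w
      rw [hS0, ← mulVec_mulVec, ← mulVec_mulVec, dotProduct_mulVec w U0qᵀ, vecMul_transpose]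
    have hpos0 : ∀ v : Fin (n+1) → ℚ, v ≠ 0 → 0 < v ⬝ᵥ S0 *ᵥ v := by
      intro v hv
      rw [← hquad]
      apply hpos
      intro h
      apply hv
      exact Matrix.eq_zero_of_mulVec_eq_zero (hU0q'.ne_zero) h
    have hsym0 : ∀ i j, S0 i j = S0 j i := by
      have : S0ᵀ = S0 := by
        have hS : Sᵀ = S := by ext i j; exact hsym j i
        rw [hS0, transpose_mul, transpose_mul, hS, transpose_transpose, Matrix.mul_assoc]
      intro i j
      conv_lhs => rw [← this]
      rfl
    have hint0 : ∀ i j, ∃ y : ℤ, (N : ℚ) * S0 i j = y := by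
      intro i j
      refine ⟨∑ b, (∑ a, U0 a i * z a b) * U0 b j, ?_⟩
      rw [hS0]
      push_cast
      simp only [Matrix.mul_apply, transpose_apply, Finset.mul_sum, Finset.sum_mul, ← hz, hU0q, Matrix.map_apply]
      refine Finset.sum_congr rfl fun i _ => Finset.sum_congr rfl fun j _ => ?_
      ring
    choose y hy using hint0
    set m := S0 0 0 with hm
    have hm0 : 0 < m := by
      have := hpos0 (Pi.single 0 1) (by simp)
      simpa using this
    set r : Fin n → ℚ := fun j => S0 0 j.succ with hr
    set S' : Matrix (Fin n) (Fin n) ℚ := fun i j => S0 i.succ j.succ - r i * r j / m with hS'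
    have hq' : ∀ (x : ℚ) (v : Fin n → ℚ), (Fin.cons x v : Fin (n+1) → ℚ) ⬝ᵥ S0 *ᵥ (Fin.cons x v : Fin (n+1) → ℚ)
        = m * (x + (∑ i, r i * v i) / m)^2 + v ⬝ᵥ S' *ᵥ v := by
      intro x v
      have e1 : v ⬝ᵥ S' *ᵥ v = ∑ i, ∑ j, v i * S0 i.succ j.succ * v j - (∑ i, r i * v i)^2 / m := by
        rw [pow_two, Finset.sum_mul_sum]
        simp only [dotProduct, mulVec, Finset.mul_sum, Finset.sum_div, ← Finset.sum_sub_distrib, hS']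
        refine Finset.sum_congr rfl fun i _ => Finset.sum_congr rfl fun j _ => ?_
        ring
      rw [e1]
      have e2 : (Fin.cons x v : Fin (n+1) → ℚ) ⬝ᵥ S0 *ᵥ (Fin.cons x v : Fin (n+1) → ℚ)
        = x * m * x + 2 * x * (∑ i, r i * v i) + ∑ i, ∑ j, v i * S0 i.succ j.succ * v j := by
        simp only [dotProduct, mulVec, Fin.sum_univ_succ, Fin.cons_zero, Fin.cons_succ, mul_add, Finset.sum_add_distrib]
        have : ∀ i : Fin n, S0 i.succ 0 = r i := fun i => hsym0 _ _
        simp only [this, Finset.mul_sum]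
        have h3 : ∀ i : Fin n, S0 0 i.succ = r i := fun i => rfl
        simp only [h3]
        have : ∑ i, 2 * x * (r i * v i) = ∑ i, x * (r i * v i) + ∑ i, v i * (r i * x) := by
          rw [← Finset.sum_add_distrib]
          exact Finset.sum_congr rfl fun i _ => by ring
        rw [this]
        simp only [mul_assoc]
        ring
      rw [e2]
      field_simp
      ring
    have hsym' : ∀ i j, S' i j = S' j i := by
      intro i j; simp only [hS']; rw [hsym0 i.succ]; ring
    have hpos' : ∀ v : Fin n → ℚ, v ≠ 0 → 0 < v ⬝ᵥ S' *ᵥ v := by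
      intro v hv
      have h := hpos0 (Fin.cons (-(∑ i, r i * v i) / m) v) (by
        intro h; apply hv; ext i
        have := congrFun h i.succ
        simpa using this)
      rw [hq'] at h
      have : -(∑ i, r i * v i) / m + (∑ i, r i * v i) / m = 0 := by ring
      rw [this] at h
      simpa using h
    have hint' : ∃ N : ℕ, 0 < N ∧ ∀ i j, ∃ z : ℤ, (N : ℚ) * S' i j = z := by
      have hy0 : 0 < y 0 0 := by
        have : (0:ℚ) < y 0 0 := by rw [← hy]; positivity
        exact_mod_cast this
      refine ⟨N * (y 0 0).toNat, Nat.mul_pos hN (by omega), fun i j => ⟨y 0 0 * y i.succ j.succ - y 0 i.succ * y 0 j.succ, ?_⟩⟩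
      have h1 : (((y 0 0).toNat : ℕ) : ℚ) = y 0 0 := by
        have := Int.toNat_of_nonneg hy0.le
        exact_mod_cast this
      push_cast
      rw [h1]
      simp only [← hy, hS', hr]
      rw [← hm]
      field_simp
    obtain ⟨U', T', c', hU', hT1, hT2, hc, hcc, hE⟩ := ih S' hsym' hpos' hint'
    set U1 : Matrix (Fin (n+1)) (Fin (n+1)) ℤ :=
      Fin.cons (Fin.cons 1 0) (fun i => Fin.cons 0 (U' i)) with hU1
    have hdet1 : U1.det = U'.det := by
      rw [Matrix.det_succ_column_zero, Fin.sum_univ_succ]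
      simp [hU1, Matrix.submatrix]
      congr 1
    set T : Matrix (Fin (n+1)) (Fin (n+1)) ℚ :=
      Fin.cons (Fin.cons 1 (fun j => (∑ i, r i * U' i j) / m)) (fun i => Fin.cons 0 (T' i)) with hT
    refine ⟨U0 * U1, T, Fin.cons m c', ?_, ?_, ?_, ?_, ?_, ?_⟩
    · rw [det_mul, hdet1]; exact hU0.mul hU'
    · intro k; refine Fin.cases ?_ (fun k => ?_) k <;> simp [hT, hT1]
    · intro k i; refine Fin.cases ?_ (fun k => ?_) k <;> refine Fin.cases ?_ (fun i => ?_) i <;> simp [hT]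
      exact hT2 k i
    · intro k; refine Fin.cases ?_ (fun k => ?_) k <;> simp [hm0, hc]
    · intro k l
      refine Fin.cases ?_ (fun k => ?_) k <;> refine Fin.cases ?_ (fun l => ?_) l
      · simp
      · intro hl
        have hl0 : l.val = 0 := by simpa using hl
        simp only [Fin.cons_zero, Fin.cons_succ]
        set u : Fin n → ℚ := fun i => U' i l with hu
        obtain ⟨zz, hzz⟩ := round_lem ((∑ i, r i * u i) / m)
        have hcl : u ⬝ᵥ S' *ᵥ u = c' l := by
          have := hE l l
          have e : u ⬝ᵥ S' *ᵥ u = ∑ a, ∑ b, (U' a l : ℚ) * S' a b * U' b l := by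
            simp only [dotProduct, mulVec, Finset.mul_sum, hu, mul_assoc]
          rw [e, this, Finset.sum_eq_single l]
          · simp [hT1]
          · intro b _ hb
            rw [hT2 b l]; simp
            rw [Fin.lt_def, hl0]
            have : b.val ≠ l.val := fun h => hb (Fin.ext h)
            omega
          · simp
        have hX := hmin (U0 * Matrix.of (fun i j => if j = 0 then (Fin.cons zz (fun i => U' i l) : Fin (n+1) → ℤ) i else
            if j = l.succ then U1 i 0 else U1 i j)) (by
          rw [det_mul]
          refine hU0.mul ?_
          have e : (Matrix.of (fun i j => if j = 0 then (Fin.cons zz (fun i => U' i l) : Fin (n+1) → ℤ) i else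
            if j = l.succ then U1 i 0 else U1 i j)) =
            U1 * (Matrix.transvection 0 l.succ zz) * (Equiv.swap (0 : Fin (n+1)) l.succ).permMatrix ℤ := by
            have hne : (0 : Fin (n+1)) ≠ l.succ := (Fin.succ_ne_zero l).symm
            ext i j
            rw [Equiv.Perm.permMatrix, PEquiv.mul_toMatrix_toPEquiv, submatrix_apply]
            simp only [Matrix.of_apply, id, Equiv.symm_swap]
            by_cases hj : j = 0
            · subst hj
              simp only [if_true, Equiv.swap_apply_left]
              rw [Matrix.mul_transvection_apply_same]
              refine Fin.cases ?_ (fun i => ?_) i <;> simp [hU1]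
            · by_cases hj2 : j = l.succ
              · subst hj2
                simp only [hj, if_false, if_true, Equiv.swap_apply_right]
                rw [Matrix.mul_transvection_apply_of_ne]
                exact hne
              · simp only [hj, hj2, if_false]
                rw [Equiv.swap_apply_of_ne_of_ne hj hj2, Matrix.mul_transvection_apply_of_ne]
                exact hj2
          rw [e, det_mul, det_mul, hdet1, Matrix.det_transvection_of_ne _ _ (Fin.succ_ne_zero l).symm, Matrix.det_permutation]
          simp only [mul_one]
          refine hU'.mul ?_
          exact (Equiv.Perm.sign _).isUnit.map (Int.castRingHom ℤ) )
        have ea : (fun i => (U0 i 0 : ℚ)) = U0q *ᵥ (Pi.single 0 1) := by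
          ext i; simp [hU0q]
        have eb : (fun i => (((U0 * Matrix.of (fun i j => if j = 0 then (Fin.cons zz (fun i => U' i l) : Fin (n+1) → ℤ) i else
            if j = l.succ then U1 i 0 else U1 i j)) i 0 : ℤ) : ℚ)) = U0q *ᵥ (Fin.cons (zz:ℚ) u : Fin (n+1) → ℚ) := by
          ext i
          simp [Matrix.mul_apply, mulVec, dotProduct, Fin.sum_univ_succ, hU0q, hu]
        rw [ea, eb, hquad, hquad, hq', hcl] at hX
        have : (Pi.single 0 1 : Fin (n+1) → ℚ) ⬝ᵥ S0 *ᵥ Pi.single 0 1 = m := by simp [hm]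
        rw [this] at hX
        nlinarith
      · simp
      · intro h
        simp only [Fin.cons_succ]
        exact hcc k l (by simpa using h)
    · have h1 : ∀ i j, ∑ a, ∑ b, (((U0 * U1) a i : ℤ) : ℚ) * S a b * (((U0 * U1) b j : ℤ):ℚ) =
          ∑ a, ∑ b, (U1 a i : ℚ) * S0 a b * (U1 b j : ℚ) := by
        have : ((U0 * U1).map (Int.cast : ℤ → ℚ))ᵀ * S * (U0 * U1).map (Int.cast : ℤ → ℚ) = (U1.map (Int.cast : ℤ → ℚ))ᵀ * S0 * U1.map (Int.cast : ℤ → ℚ) := by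
          have : (U0 * U1).map (Int.cast : ℤ → ℚ) = U0q * U1.map (Int.cast : ℤ → ℚ) := by
            ext i j; simp [Matrix.mul_apply, hU0q]
          rw [this, hS0, transpose_mul]
          simp only [Matrix.mul_assoc]
        intro i j
        have h := congrFun (congrFun this i) j
        simp only [Matrix.mul_apply, Finset.sum_mul, transpose_apply, Matrix.map_apply] at h
        rw [Finset.sum_comm]
        simp only [Matrix.mul_apply]
        rw [h, Finset.sum_comm]
      intro i j
      rw [h1]
      have hz0 : ∀ i : Fin n, S0 i.succ 0 = r i := fun i => hsym0 _ _
      have hz1 : ∀ i : Fin n, S0 0 i.succ = r i := fun i => rfl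
      refine Fin.cases ?_ (fun i => ?_) i <;> refine Fin.cases ?_ (fun j => ?_) j
      · simp [Fin.sum_univ_succ, hU1, hT, hm]
      · simp [Fin.sum_univ_succ, hU1, hT, hz1]
        field_simp
      · simp [Fin.sum_univ_succ, hU1, hT, hz0]
        field_simp
        exact Finset.sum_congr rfl fun i _ => by ring
      · simp only [Fin.sum_univ_succ, hU1, hT, hz0, hz1, Fin.cons_zero, Fin.cons_succ]
        rw [← hE i j]
        simp only [hS', mul_sub, sub_mul, Finset.sum_sub_distrib]
        have : ∑ a, ∑ b, (U' a i : ℚ) * (r a * r b / m) * (U' b j : ℚ) = (∑ i_1, r i_1 * (U' i_1 i : ℚ)) / m * m * ((∑ i, r i * (U' i j : ℚ)) / m) := by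
          rw [div_mul_cancel₀ _ hm0.ne', mul_div_assoc', Finset.sum_mul_sum, Finset.sum_div]
          simp only [Finset.sum_div]
          refine Finset.sum_congr rfl fun i _ => Finset.sum_congr rfl fun j _ => ?_
          ring
        rw [this]
        simp
end

section
theorem bnd_c (c0 c1 c2 c3 c4 c5 : ℚ) (h0 : 0 < c0) (h1 : 0 < c1) (h2 : 0 < c2) (h3 : 0 < c3) (h4 : 0 < c4)
    (h01 : 3/4*c0 ≤ c1) (h12 : 3/4*c1 ≤ c2) (h23 : 3/4*c2 ≤ c3) (h34 : 3/4*c3 ≤ c4)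
    (h45 : 3/4*c4 ≤ c5) (hp : c0*c1*c2*c3*c4*c5 = 3) :
    c0 < 4 ∧ (c0 = 2 → c1 < 2 ∧ (c1 = 3/2 → c2 < 2 ∧ (c2 = 4/3 → c3 < 5/4 ∧ (c3 = 1 → c4 < 2 ∧
      (c4 = 1 → c5 = 3/4))))) := by
  have e5 : ∀ a : ℚ, 0 < a → a ≤ c4 → (3/4*a) ≤ c5 := fun a _ h => by linarith
  have e4 : ∀ a : ℚ, 0 < a → a ≤ c4 → a * (3/4*a) ≤ c4 * c5 := fun a ha h => by
    have := e5 a ha h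
    gcongr
  have e3 : ∀ a : ℚ, 0 < a → a ≤ c3 → a * ((3/4*a) * (3/4*(3/4*a))) ≤ c3 * (c4 * c5) := fun a ha h => by
    have := e4 (3/4*a) (by positivity) (by linarith)
    gcongr
  have e2 : ∀ a : ℚ, 0 < a → a ≤ c2 → a * ((3/4*a) * ((3/4*(3/4*a)) * (3/4*(3/4*(3/4*a))))) ≤ c2 * (c3 * (c4 * c5)) := fun a ha h => by
    have := e3 (3/4*a) (by positivity) (by linarith)
    gcongr
  have e1 : ∀ a : ℚ, 0 < a → a ≤ c1 → a * ((3/4*a) * ((3/4*(3/4*a)) * ((3/4*(3/4*(3/4*a))) * (3/4*(3/4*(3/4*(3/4*a))))))) ≤ c1 * (c2 * (c3 * (c4 * c5))) := fun a ha h => by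
    have := e2 (3/4*a) (by positivity) (by linarith)
    gcongr
  have e0 : ∀ a : ℚ, 0 < a → a ≤ c0 → a * ((3/4*a) * ((3/4*(3/4*a)) * ((3/4*(3/4*(3/4*a))) * ((3/4*(3/4*(3/4*(3/4*a)))) * (3/4*(3/4*(3/4*(3/4*(3/4*a))))))))) ≤ c0 * (c1 * (c2 * (c3 * (c4 * c5)))) := fun a ha h => by
    have := e1 (3/4*a) (by positivity) (by linarith)
    gcongr
  have hp' : c0 * (c1 * (c2 * (c3 * (c4 * c5)))) = 3 := by rw [← hp]; ring
  refine ⟨?_, fun q0 => ⟨?_, fun q1 => ⟨?_, fun q2 => ⟨?_, fun q3 => ⟨?_, fun q4 => ?_⟩⟩⟩⟩⟩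
  · by_contra! h
    have := e0 4 (by norm_num) h
    norm_num at this; linarith
  · subst q0
    by_contra! h
    have := e1 2 (by norm_num) h
    norm_num at this; linarith
  · subst q0 q1
    by_contra! h
    have := e2 2 (by norm_num) h
    norm_num at this; linarith
  · subst q0 q1 q2
    by_contra! h
    have := e3 (5/4) (by norm_num) h
    norm_num at this; linarith
  · subst q0 q1 q2 q3
    by_contra! h
    have := e4 2 (by norm_num) h
    norm_num at this; linarith
  · subst q0 q1 q2 q3 q4
    linarith

section chain
variable {V : Type} [AddCommGroup V]

/-- last stage: from `D₅` to `E₆` -/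
theorem stage6 (B : V →ₗ[ℤ] V →ₗ[ℤ] ℤ) (hsym : ∀ v w, B v w = B w v) (heven : ∀ v, ∃ n, B v v = 2*n)
    (k4 k5 : V →ₗ[ℤ] ℚ) (s1 s2 s3 s4 s5 b5 : V) (c5 : ℚ) (hc5 : c5 = 3/4)
    (h11 : B s1 s1 = 2) (h22 : B s2 s2 = 2) (h33 : B s3 s3 = 2) (h44 : B s4 s4 = 2) (h55 : B s5 s5 = 2)
    (h12 : B s1 s2 = -1) (h13 : B s1 s3 = 0) (h14 : B s1 s4 = 0) (h15 : B s1 s5 = 0)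
    (h23 : B s2 s3 = -1) (h24 : B s2 s4 = -1) (h25 : B s2 s5 = 0)
    (h34 : B s3 s4 = 0) (h35 : B s3 s5 = 0) (h45 : B s4 s5 = -1)
    (k4s : k4 s1 = 0 ∧ k4 s2 = 0 ∧ k4 s3 = 0 ∧ k4 s4 = 0 ∧ k4 s5 ^ 2 = 1)
    (k5s : k5 s1 = 0 ∧ k5 s2 = 0 ∧ k5 s3 = 0 ∧ k5 s4 = 0 ∧ k5 s5 = 0 ∧ k5 b5 ^ 2 = 1)
    (hB : ∀ v w, (B v w : ℚ) = (B s1 v * B s1 w + B s3 v * B s3 w + B s4 v * B s4 w + 2 * B s2 v * B s2 w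
      + (B s1 v * B s2 w + B s2 v * B s1 w) + (B s3 v * B s2 w + B s2 v * B s3 w) + (B s4 v * B s2 w + B s2 v * B s4 w)
      + (B s1 v * B s3 w + B s3 v * B s1 w)/2 + (B s1 v * B s4 w + B s4 v * B s1 w)/2 + (B s3 v * B s4 w + B s4 v * B s3 w)/2)
      + k4 v * k4 w + c5 * (k5 v * k5 w)) :
    ∃ e : Fin 6 → V, ∀ i j, B (e i) (e j) = CartanMatrix.E₆ i j := by
  have fin : ∀ s6, B s1 s6 = -1 → B s2 s6 = 0 → B s3 s6 = 0 → B s4 s6 = 0 → B s5 s6 = 0 → B s6 s6 = 2 →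
      ∃ e : Fin 6 → V, ∀ i j, B (e i) (e j) = CartanMatrix.E₆ i j := by
    intro s6 g1 g2 g3 g4 g5 g6
    refine ⟨![s5, s3, s4, s2, s1, s6], ?_⟩
    have h21 := (hsym s2 s1).trans h12
    have h31 := (hsym s3 s1).trans h13
    have h41 := (hsym s4 s1).trans h14
    have h51 := (hsym s5 s1).trans h15
    have h32 := (hsym s3 s2).trans h23
    have h42 := (hsym s4 s2).trans h24
    have h52 := (hsym s5 s2).trans h25
    have h43 := (hsym s4 s3).trans h34
    have h53 := (hsym s5 s3).trans h35
    have h54 := (hsym s5 s4).trans h45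
    have g1' := (hsym s6 s1).trans g1
    have g2' := (hsym s6 s2).trans g2
    have g3' := (hsym s6 s3).trans g3
    have g4' := (hsym s6 s4).trans g4
    have g5' := (hsym s6 s5).trans g5
    intro i j
    fin_cases i <;> fin_cases j <;> simp [CartanMatrix.E₆, *]
  -- formula for k4
  have hk4 : ∀ v, k4 s5 * k4 v = B s5 v + B s4 v + B s2 v + (B s1 v + B s3 v)/2 := by
    intro v
    have := hB s5 v
    rw [h15, h25, h35, h45, k5s.2.2.2.2.1] at this
    push_cast at this
    linarith
  obtain ⟨n1, n2, n3, n4, n5, hn⟩ : ∃ n1 n2 n3 n4 n5 : ℤ,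
      ((B s1 b5 + 2*n1 - n2 = 0 ∧ B s5 b5 + 2*n5 - n4 = 0) ∨
       (B s1 b5 + 2*n1 - n2 = 0 ∧ B s5 b5 + 2*n5 - n4 = 1) ∨
       (B s1 b5 + 2*n1 - n2 = 1 ∧ B s5 b5 + 2*n5 - n4 = 0) ∨
       (B s1 b5 + 2*n1 - n2 = -1 ∧ B s5 b5 + 2*n5 - n4 = 0)) ∧
      B s2 b5 + 2*n2 - n1 - n3 - n4 = 0 ∧ B s3 b5 + 2*n3 - n2 = 0 ∧ B s4 b5 + 2*n4 - n2 - n5 = 0 := by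
    generalize B s1 b5 = p1
    generalize B s2 b5 = p2
    generalize B s3 b5 = p3
    generalize B s4 b5 = p4
    generalize B s5 b5 = p5
    -- solve: M n = t - p
    have key : ∀ t1 t5 : ℤ, (2*p5 + 4*p4 + 6*p2 + 5*p1 + 3*p3 - 5*t1 - 2*t5) % 4 = 0 →
       ∃ n1 n2 n3 n4 n5 : ℤ, (p1 + 2*n1 - n2 = t1 ∧ p5 + 2*n5 - n4 = t5) ∧
        p2 + 2*n2 - n1 - n3 - n4 = 0 ∧ p3 + 2*n3 - n2 = 0 ∧ p4 + 2*n4 - n2 - n5 = 0 := by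
      intro t1 t5 h
      obtain ⟨n1, hn1⟩ : ∃ n1, -(2*p5 + 4*p4 + 6*p2 + 5*p1 + 3*p3 - 5*t1 - 2*t5) = 4 * n1 := ⟨-((2*p5 + 4*p4 + 6*p2 + 5*p1 + 3*p3 - 5*t1 - 2*t5)/4), by omega⟩
      obtain ⟨n3, hn3⟩ : ∃ n3, -(2*p5 + 4*p4 + 6*p2 + 3*p1 + 5*p3 - 3*t1 - 2*t5) = 4 * n3 := ⟨-((2*p5 + 4*p4 + 6*p2 + 3*p1 + 5*p3 - 3*t1 - 2*t5)/4), by omega⟩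
      refine ⟨n1, p1 + 2*n1 - t1, n3, p2 + 2*(p1 + 2*n1 - t1) - n1 - n3, p4 + 2*(p2 + 2*(p1 + 2*n1 - t1) - n1 - n3) - (p1 + 2*n1 - t1), ⟨?_, ?_⟩, ?_, ?_, ?_⟩ <;> omega
    have h4 : (2*p5 + 4*p4 + 6*p2 + 5*p1 + 3*p3) % 4 = 0 ∨ (2*p5 + 4*p4 + 6*p2 + 5*p1 + 3*p3) % 4 = 1 ∨
      (2*p5 + 4*p4 + 6*p2 + 5*p1 + 3*p3) % 4 = 2 ∨ (2*p5 + 4*p4 + 6*p2 + 5*p1 + 3*p3) % 4 = 3 := by omega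
    rcases h4 with h | h | h | h
    · obtain ⟨n1, n2, n3, n4, n5, hh, hh'⟩ := key 0 0 (by omega)
      exact ⟨n1, n2, n3, n4, n5, Or.inl hh, hh'⟩
    · obtain ⟨n1, n2, n3, n4, n5, hh, hh'⟩ := key 1 0 (by omega)
      exact ⟨n1, n2, n3, n4, n5, Or.inr (Or.inr (Or.inl hh)), hh'⟩
    · obtain ⟨n1, n2, n3, n4, n5, hh, hh'⟩ := key 0 1 (by omega)
      exact ⟨n1, n2, n3, n4, n5, Or.inr (Or.inl hh), hh'⟩
    · obtain ⟨n1, n2, n3, n4, n5, hh, hh'⟩ := key (-1) 0 (by omega)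
      exact ⟨n1, n2, n3, n4, n5, Or.inr (Or.inr (Or.inr hh)), hh'⟩
  set b := b5 + n1 • s1 + n2 • s2 + n3 • s3 + n4 • s4 + n5 • s5 with hb
  have P1 : B s1 b = B s1 b5 + 2*n1 - n2 := by
    simp only [hb, map_add, map_smul, h11, h12, h13, h14, h15, smul_eq_mul]; ring
  have P2 : B s2 b = B s2 b5 + 2*n2 - n1 - n3 - n4 := by
    simp only [hb, map_add, map_smul, h22, hsym s2 s1, h12, h23, h24, h25, smul_eq_mul]; ring
  have P3 : B s3 b = B s3 b5 + 2*n3 - n2 := by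
    simp only [hb, map_add, map_smul, h33, hsym s3 s1, hsym s3 s2, h13, h23, h34, h35, smul_eq_mul]; ring
  have P4 : B s4 b = B s4 b5 + 2*n4 - n2 - n5 := by
    simp only [hb, map_add, map_smul, h44, hsym s4 s1, hsym s4 s2, hsym s4 s3, h14, h24, h34, h45, smul_eq_mul]; ring
  have P5 : B s5 b = B s5 b5 + 2*n5 - n4 := by
    simp only [hb, map_add, map_smul, h55, hsym s5 s1, hsym s5 s2, hsym s5 s3, hsym s5 s4, h15, h25, h35, h45, smul_eq_mul]; ring
  have K5 : k5 b ^ 2 = 1 := by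
    simp only [hb, map_add, map_smul, k5s.1, k5s.2.1, k5s.2.2.1, k5s.2.2.2.1, k5s.2.2.2.2.1, smul_zero, add_zero, k5s.2.2.2.2.2]
  have hbb := hB b b
  have hk := hk4 b
  obtain ⟨N, hN⟩ := heven b
  obtain ⟨h15', g2, g3, g4⟩ := hn
  rw [← P2] at g2
  rw [← P3] at g3
  rw [← P4] at g4
  rw [← P1, ← P5] at h15'
  have hkk : k4 b * k4 b = (k4 s5 * k4 b)^2 := by rw [mul_pow, k4s.2.2.2.2]; ring
  have K5' : k5 b * k5 b = 1 := by rw [← K5]; ring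
  rw [hkk, hk, K5', hc5, g2, g3, g4, hN] at hbb
  rcases h15' with ⟨g1, g5⟩ | ⟨g1, g5⟩ | ⟨g1, g5⟩ | ⟨g1, g5⟩ <;> rw [g1, g5] at hbb <;> push_cast at hbb
  · exfalso
    have h : ((8 * N : ℤ) : ℚ) = 3 := by push_cast; linarith
    have h : 8 * N = 3 := by exact_mod_cast h
    omega
  · exfalso
    have h : ((8 * N : ℤ) : ℚ) = 7 := by push_cast; linarith
    have h : 8 * N = 7 := by exact_mod_cast h
    omega
  · apply fin (-b) <;> simp [g1, g2, g3, g4, g5]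
    rw [hN]
    have h : ((2 * N : ℤ) : ℚ) = 2 := by push_cast; linarith
    exact_mod_cast h
  · refine fin b g1 g2 g3 g4 g5 ?_
    rw [hN]
    have h : ((2 * N : ℤ) : ℚ) = 2 := by push_cast; linarith
    exact_mod_cast h

theorem stage5 (B : V →ₗ[ℤ] V →ₗ[ℤ] ℤ) (hsym : ∀ v w, B v w = B w v) (heven : ∀ v, ∃ n, B v v = 2*n)
    (k4 k5 : V →ₗ[ℤ] ℚ) (s1 s2 s3 s4 b4 b5 : V) (c4 c5 : ℚ) (hc4 : 0 < c4) (hc4' : c4 < 2)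
    (hc5 : c4 = 1 → c5 = 3/4)
    (h11 : B s1 s1 = 2) (h22 : B s2 s2 = 2) (h33 : B s3 s3 = 2) (h44 : B s4 s4 = 2)
    (h12 : B s1 s2 = -1) (h13 : B s1 s3 = 0) (h14 : B s1 s4 = 0)
    (h23 : B s2 s3 = -1) (h24 : B s2 s4 = -1)
    (h34 : B s3 s4 = 0)
    (k4s : k4 s1 = 0 ∧ k4 s2 = 0 ∧ k4 s3 = 0 ∧ k4 s4 = 0 ∧ k4 b4 ^ 2 = 1)
    (k5s : k5 s1 = 0 ∧ k5 s2 = 0 ∧ k5 s3 = 0 ∧ k5 s4 = 0 ∧ k5 b4 = 0 ∧ k5 b5 ^ 2 = 1)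
    (hB : ∀ v w, (B v w : ℚ) = (B s1 v * B s1 w + B s3 v * B s3 w + B s4 v * B s4 w + 2 * B s2 v * B s2 w
      + (B s1 v * B s2 w + B s2 v * B s1 w) + (B s3 v * B s2 w + B s2 v * B s3 w) + (B s4 v * B s2 w + B s2 v * B s4 w)
      + (B s1 v * B s3 w + B s3 v * B s1 w)/2 + (B s1 v * B s4 w + B s4 v * B s1 w)/2 + (B s3 v * B s4 w + B s4 v * B s3 w)/2)
      + c4 * (k4 v * k4 w) + c5 * (k5 v * k5 w)) :
    ∃ e : Fin 6 → V, ∀ i j, B (e i) (e j) = CartanMatrix.E₆ i j := by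
  have h21 := (hsym s2 s1).trans h12
  have h31 := (hsym s3 s1).trans h13
  have h41 := (hsym s4 s1).trans h14
  have h32 := (hsym s3 s2).trans h23
  have h42 := (hsym s4 s2).trans h24
  have h43 := (hsym s4 s3).trans h34
  obtain ⟨n1, n2, n3, n4, hn2, hn⟩ : ∃ n1 n2 n3 n4 : ℤ,
      B s2 b4 + 2*n2 - n1 - n3 - n4 = 0 ∧
      ((B s1 b4 + 2*n1 - n2 = 0 ∧ B s3 b4 + 2*n3 - n2 = 0 ∧ B s4 b4 + 2*n4 - n2 = 0) ∨
       (B s1 b4 + 2*n1 - n2 = -1 ∧ B s3 b4 + 2*n3 - n2 = 0 ∧ B s4 b4 + 2*n4 - n2 = 0) ∨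
       (B s1 b4 + 2*n1 - n2 = 0 ∧ B s3 b4 + 2*n3 - n2 = -1 ∧ B s4 b4 + 2*n4 - n2 = 0) ∨
       (B s1 b4 + 2*n1 - n2 = 0 ∧ B s3 b4 + 2*n3 - n2 = 0 ∧ B s4 b4 + 2*n4 - n2 = -1)) := by
    generalize B s1 b4 = p1
    generalize B s2 b4 = p2
    generalize B s3 b4 = p3
    generalize B s4 b4 = p4
    have key : ∀ t1 t3 t4 : ℤ, (p1 - t1 + p3 - t3) % 2 = 0 → (p1 - t1 + p4 - t4) % 2 = 0 →
       ∃ n1 n2 n3 n4 : ℤ, p2 + 2*n2 - n1 - n3 - n4 = 0 ∧ (p1 + 2*n1 - n2 = t1 ∧ p3 + 2*n3 - n2 = t3 ∧ p4 + 2*n4 - n2 = t4) := by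
      intro t1 t3 t4 h h'
      refine ⟨((t1 + t3 + t4 - p1 - p3 - p4 - 2*p2) - p1 + t1)/2, t1 + t3 + t4 - p1 - p3 - p4 - 2*p2,
        ((t1 + t3 + t4 - p1 - p3 - p4 - 2*p2) - p3 + t3)/2, ((t1 + t3 + t4 - p1 - p3 - p4 - 2*p2) - p4 + t4)/2, ?_, ?_, ?_, ?_⟩ <;> omega
    rcases Int.emod_two_eq_zero_or_one (p1 + p3) with h | h <;> rcases Int.emod_two_eq_zero_or_one (p1 + p4) with h' | h'
    · obtain ⟨n1, n2, n3, n4, hh, hh'⟩ := key 0 0 0 (by omega) (by omega)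
      exact ⟨n1, n2, n3, n4, hh, Or.inl hh'⟩
    · obtain ⟨n1, n2, n3, n4, hh, hh'⟩ := key 0 0 (-1) (by omega) (by omega)
      exact ⟨n1, n2, n3, n4, hh, Or.inr (Or.inr (Or.inr hh'))⟩
    · obtain ⟨n1, n2, n3, n4, hh, hh'⟩ := key 0 (-1) 0 (by omega) (by omega)
      exact ⟨n1, n2, n3, n4, hh, Or.inr (Or.inr (Or.inl hh'))⟩
    · obtain ⟨n1, n2, n3, n4, hh, hh'⟩ := key (-1) 0 0 (by omega) (by omega)
      exact ⟨n1, n2, n3, n4, hh, Or.inr (Or.inl hh')⟩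
  set b := b4 + n1 • s1 + n2 • s2 + n3 • s3 + n4 • s4 with hb
  have P1 : B s1 b = B s1 b4 + 2*n1 - n2 := by
    simp only [hb, map_add, map_smul, h11, h12, h13, h14, smul_eq_mul]; ring
  have P2 : B s2 b = B s2 b4 + 2*n2 - n1 - n3 - n4 := by
    simp only [hb, map_add, map_smul, h22, h21, h23, h24, smul_eq_mul]; ring
  have P3 : B s3 b = B s3 b4 + 2*n3 - n2 := by
    simp only [hb, map_add, map_smul, h33, h31, h32, h34, smul_eq_mul]; ring
  have P4 : B s4 b = B s4 b4 + 2*n4 - n2 := by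
    simp only [hb, map_add, map_smul, h44, h41, h42, h43, smul_eq_mul]; ring
  have K4 : k4 b ^ 2 = 1 := by
    simp only [hb, map_add, map_smul, k4s.1, k4s.2.1, k4s.2.2.1, k4s.2.2.2.1, smul_zero, add_zero, k4s.2.2.2.2]
  have K5 : k5 b = 0 := by
    simp only [hb, map_add, map_smul, k5s.1, k5s.2.1, k5s.2.2.1, k5s.2.2.2.1, smul_zero, add_zero, k5s.2.2.2.2.1]
  have hbb := hB b b
  obtain ⟨N, hN⟩ := heven b
  rw [← P2] at hn2
  rw [← P1, ← P3, ← P4] at hn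
  have K4' : k4 b * k4 b = 1 := by rw [← K4]; ring
  rw [K4', K5, hn2, hN] at hbb
  have odd : c4 = 2 * N - 1 → c4 = 1 := by
    intro h
    have h1 : (0:ℚ) < ((2*N - 1 : ℤ) : ℚ) := by push_cast; linarith
    have h2 : ((2*N - 1 : ℤ) : ℚ) < 2 := by push_cast; linarith
    have h1' : 0 < 2*N-1 := by exact_mod_cast h1
    have h2' : 2*N-1 < 2 := by exact_mod_cast h2
    have : N = 1 := by omega
    rw [h, this]; norm_num
  rcases hn with ⟨g1, g3, g4⟩ | ⟨g1, g3, g4⟩ | ⟨g1, g3, g4⟩ | ⟨g1, g3, g4⟩ <;> rw [g1, g3, g4] at hbb <;> push_cast at hbb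
  · exfalso
    have h1 : (0:ℚ) < ((2*N : ℤ) : ℚ) := by push_cast; linarith
    have h2 : ((2*N : ℤ) : ℚ) < 2 := by push_cast; linarith
    have h1' : 0 < 2*N := by exact_mod_cast h1
    have h2' : 2*N < 2 := by exact_mod_cast h2
    omega
  · have hc1 := odd (by linarith)
    have hbb2 : B b b = 2 := by
      rw [hN]
      have h : ((2 * N : ℤ) : ℚ) = 2 := by push_cast; linarith
      exact_mod_cast h
    refine stage6 B hsym heven k4 k5 s3 s2 s4 s1 b b5 c5 (hc5 hc1) h33 h22 h44 h11 hbb2 h32 h34 h31 g3 h24 h21 hn2 h41 g4 g1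
      ⟨k4s.2.2.1, k4s.2.1, k4s.2.2.2.1, k4s.1, K4⟩ ⟨k5s.2.2.1, k5s.2.1, k5s.2.2.2.1, k5s.1, K5, k5s.2.2.2.2.2⟩ ?_
    intro v w
    rw [hB v w, hc1]; ring
  · have hc1 := odd (by linarith)
    have hbb2 : B b b = 2 := by
      rw [hN]
      have h : ((2 * N : ℤ) : ℚ) = 2 := by push_cast; linarith
      exact_mod_cast h
    refine stage6 B hsym heven k4 k5 s1 s2 s4 s3 b b5 c5 (hc5 hc1) h11 h22 h44 h33 hbb2 h12 h14 h13 g1 h24 h23 hn2 h43 g4 g3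
      ⟨k4s.1, k4s.2.1, k4s.2.2.2.1, k4s.2.2.1, K4⟩ ⟨k5s.1, k5s.2.1, k5s.2.2.2.1, k5s.2.2.1, K5, k5s.2.2.2.2.2⟩ ?_
    intro v w
    rw [hB v w, hc1]; ring
  · have hc1 := odd (by linarith)
    have hbb2 : B b b = 2 := by
      rw [hN]
      have h : ((2 * N : ℤ) : ℚ) = 2 := by push_cast; linarith
      exact_mod_cast h
    refine stage6 B hsym heven k4 k5 s1 s2 s3 s4 b b5 c5 (hc5 hc1) h11 h22 h33 h44 hbb2 h12 h13 h14 g1 h23 h24 hn2 h34 g3 g4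
      ⟨k4s.1, k4s.2.1, k4s.2.2.1, k4s.2.2.2.1, K4⟩ ⟨k5s.1, k5s.2.1, k5s.2.2.1, k5s.2.2.2.1, K5, k5s.2.2.2.2.2⟩ ?_
    intro v w
    rw [hB v w, hc1]; ring

theorem stage4 (B : V →ₗ[ℤ] V →ₗ[ℤ] ℤ) (hsym : ∀ v w, B v w = B w v) (heven : ∀ v, ∃ n, B v v = 2*n)
    (k3 k4 k5 : V →ₗ[ℤ] ℚ) (s1 s2 s3 b3 b4 b5 : V) (c3 c4 c5 : ℚ) (hc3 : 0 < c3) (hc3' : c3 < 5/4)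
    (hc4 : 0 < c4) (hc : c3 = 1 → c4 < 2 ∧ (c4 = 1 → c5 = 3/4))
    (h11 : B s1 s1 = 2) (h22 : B s2 s2 = 2) (h33 : B s3 s3 = 2)
    (h12 : B s1 s2 = -1) (h13 : B s1 s3 = 0) (h23 : B s2 s3 = -1)
    (k3s : k3 s1 = 0 ∧ k3 s2 = 0 ∧ k3 s3 = 0 ∧ k3 b3 ^ 2 = 1)
    (k4s : k4 s1 = 0 ∧ k4 s2 = 0 ∧ k4 s3 = 0 ∧ k4 b3 = 0 ∧ k4 b4 ^ 2 = 1)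
    (k5s : k5 s1 = 0 ∧ k5 s2 = 0 ∧ k5 s3 = 0 ∧ k5 b3 = 0 ∧ k5 b4 = 0 ∧ k5 b5 ^ 2 = 1)
    (hB : ∀ v w, (B v w : ℚ) = (3 * B s1 v * B s1 w + 4 * B s2 v * B s2 w + 3 * B s3 v * B s3 w
      + 2 * (B s1 v * B s2 w + B s2 v * B s1 w) + 2 * (B s3 v * B s2 w + B s2 v * B s3 w)
      + (B s1 v * B s3 w + B s3 v * B s1 w)) / 4
      + c3 * (k3 v * k3 w) + c4 * (k4 v * k4 w) + c5 * (k5 v * k5 w)) :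
    ∃ e : Fin 6 → V, ∀ i j, B (e i) (e j) = CartanMatrix.E₆ i j := by
  have h21 := (hsym s2 s1).trans h12
  have h31 := (hsym s3 s1).trans h13
  have h32 := (hsym s3 s2).trans h23
  obtain ⟨n1, n2, n3, hn1, hn⟩ : ∃ n1 n2 n3 : ℤ,
      B s1 b3 + 2*n1 - n2 = 0 ∧
      ((B s2 b3 + 2*n2 - n1 - n3 = 0 ∧ B s3 b3 + 2*n3 - n2 = 0) ∨
       (B s2 b3 + 2*n2 - n1 - n3 = 0 ∧ B s3 b3 + 2*n3 - n2 = 1) ∨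
       (B s2 b3 + 2*n2 - n1 - n3 = 0 ∧ B s3 b3 + 2*n3 - n2 = -1) ∨
       (B s2 b3 + 2*n2 - n1 - n3 = -1 ∧ B s3 b3 + 2*n3 - n2 = 0)) := by
    generalize B s1 b3 = p1
    generalize B s2 b3 = p2
    generalize B s3 b3 = p3
    have key : ∀ t2 t3 : ℤ, (2*(t2-p2) + (t3-p3) - 3 * p1) % 4 = 0 →
       ∃ n1 n2 n3 : ℤ, p1 + 2*n1 - n2 = 0 ∧ (p2 + 2*n2 - n1 - n3 = t2 ∧ p3 + 2*n3 - n2 = t3) := by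
      intro t2 t3 h
      obtain ⟨n1, hn1⟩ : ∃ n1, (2*(t2-p2) + (t3-p3) - 3 * p1) = 4 * n1 := ⟨(2*(t2-p2) + (t3-p3) - 3 * p1)/4, by omega⟩
      refine ⟨n1, 2*n1+p1, 2*(2*n1+p1) - n1 - (t2-p2), ?_, ?_, ?_⟩ <;> omega
    have h4 : (2*p2+p3+3*p1) % 4 = 0 ∨ (2*p2+p3+3*p1) % 4 = 1 ∨ (2*p2+p3+3*p1) % 4 = 2 ∨ (2*p2+p3+3*p1) % 4 = 3 := by omega
    rcases h4 with h | h | h | h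
    · obtain ⟨n1, n2, n3, hh, hh'⟩ := key 0 0 (by omega)
      exact ⟨n1, n2, n3, hh, Or.inl hh'⟩
    · obtain ⟨n1, n2, n3, hh, hh'⟩ := key 0 1 (by omega)
      exact ⟨n1, n2, n3, hh, Or.inr (Or.inl hh')⟩
    · obtain ⟨n1, n2, n3, hh, hh'⟩ := key (-1) 0 (by omega)
      exact ⟨n1, n2, n3, hh, Or.inr (Or.inr (Or.inr hh'))⟩
    · obtain ⟨n1, n2, n3, hh, hh'⟩ := key 0 (-1) (by omega)
      exact ⟨n1, n2, n3, hh, Or.inr (Or.inr (Or.inl hh'))⟩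
  set b := b3 + n1 • s1 + n2 • s2 + n3 • s3 with hb
  have P1 : B s1 b = B s1 b3 + 2*n1 - n2 := by
    simp only [hb, map_add, map_smul, h11, h12, h13, smul_eq_mul]; ring
  have P2 : B s2 b = B s2 b3 + 2*n2 - n1 - n3 := by
    simp only [hb, map_add, map_smul, h22, h21, h23, smul_eq_mul]; ring
  have P3 : B s3 b = B s3 b3 + 2*n3 - n2 := by
    simp only [hb, map_add, map_smul, h33, h31, h32, smul_eq_mul]; ring
  have K3 : k3 b ^ 2 = 1 := by
    simp only [hb, map_add, map_smul, k3s.1, k3s.2.1, k3s.2.2.1, smul_zero, add_zero, k3s.2.2.2]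
  have K4 : k4 b = 0 := by
    simp only [hb, map_add, map_smul, k4s.1, k4s.2.1, k4s.2.2.1, k4s.2.2.2.1, smul_zero, add_zero]
  have K5 : k5 b = 0 := by
    simp only [hb, map_add, map_smul, k5s.1, k5s.2.1, k5s.2.2.1, k5s.2.2.2.1, smul_zero, add_zero]
  have hbb := hB b b
  obtain ⟨N, hN⟩ := heven b
  rw [← P1] at hn1
  rw [← P2, ← P3] at hn
  have K3' : k3 b * k3 b = 1 := by rw [← K3]; ring
  rw [K3', K4, K5, hn1, hN] at hbb
  rcases hn with ⟨g2, g3⟩ | ⟨g2, g3⟩ | ⟨g2, g3⟩ | ⟨g2, g3⟩ <;> rw [g2, g3] at hbb <;> push_cast at hbb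
  · exfalso
    have h1 : (0:ℚ) < ((2*N : ℤ) : ℚ) := by push_cast; linarith
    have h2 : ((2*N : ℤ) : ℚ) < 2 := by push_cast; linarith
    have h1' : 0 < 2*N := by exact_mod_cast h1
    have h2' : 2*N < 2 := by exact_mod_cast h2
    omega
  · exfalso
    have h1 : (0:ℚ) < ((8*N - 3: ℤ) : ℚ) := by push_cast; linarith
    have h2 : ((8*N - 3 : ℤ) : ℚ) < 5 := by push_cast; linarith
    have h1' : 0 < 8*N - 3 := by exact_mod_cast h1
    have h2' : 8*N-3 < 5 := by exact_mod_cast h2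
    omega
  · exfalso
    have h1 : (0:ℚ) < ((8*N - 3: ℤ) : ℚ) := by push_cast; linarith
    have h2 : ((8*N - 3 : ℤ) : ℚ) < 5 := by push_cast; linarith
    have h1' : 0 < 8*N - 3 := by exact_mod_cast h1
    have h2' : 8*N-3 < 5 := by exact_mod_cast h2
    omega
  · have h1 : (0:ℚ) < ((2*N - 1: ℤ) : ℚ) := by push_cast; linarith
    have h2 : ((2*N - 1 : ℤ) : ℚ) < 2 := by push_cast; linarith
    have h1' : 0 < 2*N - 1 := by exact_mod_cast h1
    have h2' : 2*N-1 < 2 := by exact_mod_cast h2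
    have hN1 : N = 1 := by omega
    rw [hN1] at hN hbb
    have hc1 : c3 = 1 := by push_cast at hbb; linarith
    refine stage5 B hsym heven k4 k5 s1 s2 s3 b b4 b5 c4 c5 hc4 (hc hc1).1 (hc hc1).2 h11 h22 h33 (by simpa using hN) h12 h13 hn1 h23 g2 g3
      ⟨k4s.1, k4s.2.1, k4s.2.2.1, K4, k4s.2.2.2.2⟩ ⟨k5s.1, k5s.2.1, k5s.2.2.1, K5, k5s.2.2.2.2.1, k5s.2.2.2.2.2⟩ ?_
    have hk : ∀ v, k3 b * k3 v = B b v + B s2 v + (B s1 v + B s3 v)/2 := by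
      intro v
      have := hB b v
      rw [hn1, g2, g3, K4, K5, hc1] at this
      push_cast at this
      linarith
    intro v w
    have : k3 v * k3 w = (k3 b * k3 v) * (k3 b * k3 w) := by
      rw [← one_mul (k3 v * k3 w), ← K3']; ring
    rw [hB v w, hc1, this, hk, hk]; ring

theorem stage3 (B : V →ₗ[ℤ] V →ₗ[ℤ] ℤ) (hsym : ∀ v w, B v w = B w v) (heven : ∀ v, ∃ n, B v v = 2*n)
    (k2 k3 k4 k5 : V →ₗ[ℤ] ℚ) (s1 s2 b2 b3 b4 b5 : V) (c2 c3 c4 c5 : ℚ) (hc2 : 0 < c2) (hc2' : c2 < 2) (hc3 : 0 < c3)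
    (hc4 : 0 < c4) (hc : c2 = 4/3 → c3 < 5/4 ∧ (c3 = 1 → c4 < 2 ∧ (c4 = 1 → c5 = 3/4)))
    (h11 : B s1 s1 = 2) (h22 : B s2 s2 = 2) (h12 : B s1 s2 = -1)
    (k2s : k2 s1 = 0 ∧ k2 s2 = 0 ∧ k2 b2 ^ 2 = 1)
    (k3s : k3 s1 = 0 ∧ k3 s2 = 0 ∧ k3 b2 = 0 ∧ k3 b3 ^ 2 = 1)
    (k4s : k4 s1 = 0 ∧ k4 s2 = 0 ∧ k4 b2 = 0 ∧ k4 b3 = 0 ∧ k4 b4 ^ 2 = 1)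
    (k5s : k5 s1 = 0 ∧ k5 s2 = 0 ∧ k5 b2 = 0 ∧ k5 b3 = 0 ∧ k5 b4 = 0 ∧ k5 b5 ^ 2 = 1)
    (hB : ∀ v w, (B v w : ℚ) = (2 * B s1 v * B s1 w + 2 * B s2 v * B s2 w
      + (B s1 v * B s2 w + B s2 v * B s1 w)) / 3 + c2 * (k2 v * k2 w)
      + c3 * (k3 v * k3 w) + c4 * (k4 v * k4 w) + c5 * (k5 v * k5 w)) :
    ∃ e : Fin 6 → V, ∀ i j, B (e i) (e j) = CartanMatrix.E₆ i j := by
  have h21 := (hsym s2 s1).trans h12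
  have fin : ∀ b, B s1 b = 0 → B s2 b = -1 → k2 b ^ 2 = 1 → k3 b = 0 → k4 b = 0 → k5 b = 0 →
      ∃ e : Fin 6 → V, ∀ i j, B (e i) (e j) = CartanMatrix.E₆ i j := by
    intro b g1 g2 K2 K3 K4 K5
    have hbb := hB b b
    obtain ⟨N, hN⟩ := heven b
    have K2' : k2 b * k2 b = 1 := by rw [← K2]; ring
    rw [K2', K3, K4, K5, g1, g2, hN] at hbb
    push_cast at hbb
    have h1 : (0:ℚ) < ((6*N - 2: ℤ) : ℚ) := by push_cast; linarith
    have h2 : ((6*N - 2 : ℤ) : ℚ) < 6 := by push_cast; linarith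
    have h1' : 0 < 6*N - 2 := by exact_mod_cast h1
    have h2' : 6*N-2 < 6 := by exact_mod_cast h2
    have hN1 : N = 1 := by omega
    rw [hN1] at hN hbb
    have hc1 : c2 = 4/3 := by push_cast at hbb; linarith
    refine stage4 B hsym heven k3 k4 k5 s1 s2 b b3 b4 b5 c3 c4 c5 hc3 (hc hc1).1 hc4 (hc hc1).2 h11 h22 (by simpa using hN) h12 g1 g2
      ⟨k3s.1, k3s.2.1, K3, k3s.2.2.2⟩ ⟨k4s.1, k4s.2.1, K4, k4s.2.2.2⟩ ⟨k5s.1, k5s.2.1, K5, k5s.2.2.2⟩ ?_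
    have hk : ∀ v, k2 b * k2 v = 3/4 * (B b v + (2 * B s2 v + B s1 v)/3) := by
      intro v
      have := hB b v
      rw [g1, g2, K3, K4, K5, hc1] at this
      push_cast at this
      linarith
    intro v w
    have : k2 v * k2 w = (k2 b * k2 v) * (k2 b * k2 w) := by
      rw [← one_mul (k2 v * k2 w), ← K2']; ring
    rw [hB v w, hc1, this, hk, hk]; ring
  obtain ⟨n1, n2, hn1, hn⟩ : ∃ n1 n2 : ℤ,
      B s1 b2 + 2*n1 - n2 = 0 ∧
      ((B s2 b2 + 2*n2 - n1 = 0) ∨ (B s2 b2 + 2*n2 - n1 = 1) ∨ (B s2 b2 + 2*n2 - n1 = -1)) := by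
    generalize B s1 b2 = p1
    generalize B s2 b2 = p2
    have key : ∀ t2 : ℤ, (t2-p2-2*p1) % 3 = 0 →
       ∃ n1 n2 : ℤ, p1 + 2*n1 - n2 = 0 ∧ (p2 + 2*n2 - n1 = t2) := by
      intro t2 h
      obtain ⟨n1, hn1⟩ : ∃ n1, (t2-p2-2*p1) = 3 * n1 := ⟨(t2-p2-2*p1)/3, by omega⟩
      refine ⟨n1, 2*n1+p1, ?_, ?_⟩ <;> omega
    have h4 : (p2+2*p1) % 3 = 0 ∨ (p2+2*p1) % 3 = 1 ∨ (p2+2*p1) % 3 = 2 := by omega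
    rcases h4 with h | h | h
    · obtain ⟨n1, n2, hh, hh'⟩ := key 0 (by omega)
      exact ⟨n1, n2, hh, Or.inl hh'⟩
    · obtain ⟨n1, n2, hh, hh'⟩ := key 1 (by omega)
      exact ⟨n1, n2, hh, Or.inr (Or.inl hh')⟩
    · obtain ⟨n1, n2, hh, hh'⟩ := key (-1) (by omega)
      exact ⟨n1, n2, hh, Or.inr (Or.inr hh')⟩
  set b := b2 + n1 • s1 + n2 • s2 with hb
  have P1 : B s1 b = B s1 b2 + 2*n1 - n2 := by
    simp only [hb, map_add, map_smul, h11, h12, smul_eq_mul]; ring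
  have P2 : B s2 b = B s2 b2 + 2*n2 - n1 := by
    simp only [hb, map_add, map_smul, h22, h21, smul_eq_mul]; ring
  have K2 : k2 b ^ 2 = 1 := by
    simp only [hb, map_add, map_smul, k2s.1, k2s.2.1, smul_zero, add_zero, k2s.2.2]
  have K3 : k3 b = 0 := by
    simp only [hb, map_add, map_smul, k3s.1, k3s.2.1, k3s.2.2.1, smul_zero, add_zero]
  have K4 : k4 b = 0 := by
    simp only [hb, map_add, map_smul, k4s.1, k4s.2.1, k4s.2.2.1, smul_zero, add_zero]
  have K5 : k5 b = 0 := by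
    simp only [hb, map_add, map_smul, k5s.1, k5s.2.1, k5s.2.2.1, smul_zero, add_zero]
  rw [← P1] at hn1
  rw [← P2] at hn
  rcases hn with g2 | g2 | g2
  · exfalso
    have hbb := hB b b
    obtain ⟨N, hN⟩ := heven b
    have K2' : k2 b * k2 b = 1 := by rw [← K2]; ring
    rw [K2', K3, K4, K5, hn1, g2, hN] at hbb
    push_cast at hbb
    have h1 : (0:ℚ) < ((2*N : ℤ) : ℚ) := by push_cast; linarith
    have h2 : ((2*N : ℤ) : ℚ) < 2 := by push_cast; linarith
    have h1' : 0 < 2*N := by exact_mod_cast h1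
    have h2' : 2*N < 2 := by exact_mod_cast h2
    omega
  · apply fin (-b) <;> simp [hn1, g2, K2, K3, K4, K5]
  · exact fin b hn1 g2 K2 K3 K4 K5

theorem stage1 (B : V →ₗ[ℤ] V →ₗ[ℤ] ℤ) (hsym : ∀ v w, B v w = B w v) (heven : ∀ v, ∃ n, B v v = 2*n)
    (k0 k1 k2 k3 k4 k5 : V →ₗ[ℤ] ℚ) (b0 b1 b2 b3 b4 b5 : V) (c0 c1 c2 c3 c4 c5 : ℚ)
    (hc0 : 0 < c0) (hc1 : 0 < c1) (hc2 : 0 < c2) (hc3 : 0 < c3) (hc4 : 0 < c4)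
    (hc : c0 < 4 ∧ (c0 = 2 → c1 < 2 ∧ (c1 = 3/2 → c2 < 2 ∧ (c2 = 4/3 → c3 < 5/4 ∧ (c3 = 1 → c4 < 2 ∧ (c4 = 1 → c5 = 3/4))))))
    (k0s : k0 b0 = 1)
    (k1s : k1 b0 = 0 ∧ k1 b1 = 1)
    (k2s : k2 b0 = 0 ∧ k2 b1 = 0 ∧ k2 b2 = 1)
    (k3s : k3 b0 = 0 ∧ k3 b1 = 0 ∧ k3 b2 = 0 ∧ k3 b3 = 1)
    (k4s : k4 b0 = 0 ∧ k4 b1 = 0 ∧ k4 b2 = 0 ∧ k4 b3 = 0 ∧ k4 b4 = 1)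
    (k5s : k5 b0 = 0 ∧ k5 b1 = 0 ∧ k5 b2 = 0 ∧ k5 b3 = 0 ∧ k5 b4 = 0 ∧ k5 b5 = 1)
    (hB : ∀ v w, (B v w : ℚ) = c0 * (k0 v * k0 w) + c1 * (k1 v * k1 w) + c2 * (k2 v * k2 w)
      + c3 * (k3 v * k3 w) + c4 * (k4 v * k4 w) + c5 * (k5 v * k5 w)) :
    ∃ e : Fin 6 → V, ∀ i j, B (e i) (e j) = CartanMatrix.E₆ i j := by
  obtain ⟨N0, hN0⟩ := heven b0
  have hbb0 := hB b0 b0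
  rw [hN0, k0s, k1s.1, k2s.1, k3s.1, k4s.1, k5s.1] at hbb0
  push_cast at hbb0
  have hN01 : N0 = 1 := by
    have h1 : (0:ℚ) < ((2*N0 : ℤ) : ℚ) := by push_cast; linarith
    have h2 : ((2*N0 : ℤ) : ℚ) < 4 := by push_cast; linarith [hc.1]
    have h1' : 0 < 2*N0 := by exact_mod_cast h1
    have h2' : 2*N0 < 4 := by exact_mod_cast h2
    omega
  rw [hN01] at hN0 hbb0
  have h00 : B b0 b0 = 2 := by simpa using hN0
  have hc0' : c0 = 2 := by push_cast at hbb0; linarith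
  obtain ⟨n, hn⟩ : ∃ n : ℤ, B b0 b1 + 2*n = 0 ∨ B b0 b1 + 2*n = -1 := by
    rcases Int.emod_two_eq_zero_or_one (B b0 b1) with h | h
    · exact ⟨-(B b0 b1)/2, by omega⟩
    · exact ⟨-(B b0 b1 + 1)/2, by omega⟩
  set b := b1 + n • b0 with hb
  have P : B b0 b = B b0 b1 + 2*n := by
    simp only [hb, map_add, map_smul, h00, smul_eq_mul]; ring
  rw [← P] at hn
  have K1 : k1 b = 1 := by simp only [hb, map_add, map_smul, k1s.1, k1s.2, smul_zero, add_zero]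
  have K2 : k2 b = 0 := by simp only [hb, map_add, map_smul, k2s.1, k2s.2.1, smul_zero, add_zero]
  have K3 : k3 b = 0 := by simp only [hb, map_add, map_smul, k3s.1, k3s.2.1, smul_zero, add_zero]
  have K4 : k4 b = 0 := by simp only [hb, map_add, map_smul, k4s.1, k4s.2.1, smul_zero, add_zero]
  have K5 : k5 b = 0 := by simp only [hb, map_add, map_smul, k5s.1, k5s.2.1, smul_zero, add_zero]
  have hk0 : ∀ v, k0 v = B b0 v / 2 := by
    intro v
    have := hB b0 v
    rw [k0s, k1s.1, k2s.1, k3s.1, k4s.1, k5s.1, hc0'] at this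
    linarith
  have hbb := hB b b
  obtain ⟨N, hN⟩ := heven b
  rw [hk0, K1, K2, K3, K4, K5, hc0', hN] at hbb
  obtain ⟨hc1', hc⟩ := hc.2 hc0'
  rcases hn with g | g <;> rw [g] at hbb <;> push_cast at hbb
  · exfalso
    have h1 : (0:ℚ) < ((2*N : ℤ) : ℚ) := by push_cast; linarith
    have h2 : ((2*N : ℤ) : ℚ) < 2 := by push_cast; linarith
    have h1' : 0 < 2*N := by exact_mod_cast h1
    have h2' : 2*N < 2 := by exact_mod_cast h2
    omega
  · have h1 : (0:ℚ) < ((4*N - 1: ℤ) : ℚ) := by push_cast; linarith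
    have h2 : ((4*N - 1 : ℤ) : ℚ) < 4 := by push_cast; linarith
    have h1' : 0 < 4*N - 1 := by exact_mod_cast h1
    have h2' : 4*N-1 < 4 := by exact_mod_cast h2
    have hN1 : N = 1 := by omega
    rw [hN1] at hN hbb
    have hc1 : c1 = 3/2 := by push_cast at hbb; linarith
    refine stage3 B hsym heven k2 k3 k4 k5 b0 b b2 b3 b4 b5 c2 c3 c4 c5 hc2 (hc hc1).1 hc3 hc4 (hc hc1).2 h00 (by simpa using hN) g
      ⟨k2s.1, K2, by simp [k2s]⟩ ⟨k3s.1, K3, by simp [k3s]⟩ ⟨k4s.1, K4, by simp [k4s]⟩ ⟨k5s.1, K5, by simp [k5s]⟩ ?_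
    have hk : ∀ v, k1 v = 2/3 * (B b v + B b0 v / 2) := by
      intro v
      have := hB b v
      rw [hk0, g, K1, K2, K3, K4, K5, hc1, hc0', hk0] at this
      push_cast at this
      linarith
    intro v w
    rw [hB v w, hc1, hc0', hk, hk, hk0, hk0]; ring
end chain
end

section
open Matrix

theorem clear_den {n : ℕ} (v : Fin n → ℚ) : ∃ N : ℤ, 0 < N ∧ ∃ w : Fin n → ℤ, ∀ i, (w i : ℚ) = N * v i := by
  refine ⟨∏ i, ((v i).den : ℤ), ?_, fun i => (v i).num * ∏ j ∈ Finset.univ.erase i, ((v j).den : ℤ), ?_⟩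
  · exact Finset.prod_pos fun i _ => by exact_mod_cast (v i).den_pos
  · intro i
    have h : (∏ j, ((v j).den : ℤ)) = (v i).den * ∏ j ∈ Finset.univ.erase i, ((v j).den : ℤ) :=
      (Finset.mul_prod_erase _ _ (Finset.mem_univ i)).symm
    rw [h]
    have h2 : ((v i).num : ℚ) = v i * (v i).den := (Rat.mul_den_eq_num (v i)).symm
    push_cast
    rw [h2]; ring

theorem cast_form {n : ℕ} (H : Matrix (Fin n) (Fin n) ℤ) (v w : Fin n → ℤ) :
    ((v ⬝ᵥ H *ᵥ w : ℤ) : ℚ) = (fun i => (v i : ℚ)) ⬝ᵥ (H.map (Int.cast : ℤ → ℚ)) *ᵥ (fun i => (w i : ℚ)) := by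
  simp [dotProduct, mulVec]

theorem posQ {n : ℕ} (H : Matrix (Fin n) (Fin n) ℤ) (hp : ∀ v : Fin n → ℤ, v ≠ 0 → 0 < v ⬝ᵥ H.mulVec v)
    (v : Fin n → ℚ) (hv : v ≠ 0) : 0 < v ⬝ᵥ (H.map (Int.cast : ℤ → ℚ)) *ᵥ v := by
  obtain ⟨N, hN, w, hw⟩ := clear_den v
  have hw' : (fun i => (w i : ℚ)) = (N:ℚ) • v := by funext i; simp [hw]
  have hN' : (0:ℚ) < N := by exact_mod_cast hN
  have h0 : w ≠ 0 := by
    rintro rfl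
    apply hv
    funext i
    have := hw i
    simp at this
    rcases this with h | h
    · exact absurd h hN.ne'
    · simpa using h
  have h1 := hp w h0
  have h2 : (0:ℚ) < ((w ⬝ᵥ H *ᵥ w : ℤ) : ℚ) := by exact_mod_cast h1
  rw [cast_form, hw'] at h2
  simp only [mulVec_smul, dotProduct_smul, smul_dotProduct, smul_eq_mul] at h2
  rw [← mul_assoc] at h2
  exact (pos_iff_pos_of_mul_pos h2).1 (by positivity)

def kfun (T : Matrix (Fin 6) (Fin 6) ℚ) (i : Fin 6) : (Fin 6 → ℤ) →ₗ[ℤ] ℚ where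
  toFun v := ∑ j, T i j * (v j : ℚ)
  map_add' v w := by simp [mul_add, Finset.sum_add_distrib]
  map_smul' c v := by
    simp only [Pi.smul_apply, smul_eq_mul, Int.cast_mul, RingHom.id_apply, zsmul_eq_mul, Finset.mul_sum]
    exact Finset.sum_congr rfl fun j _ => by ring

theorem kfun_single (T : Matrix (Fin 6) (Fin 6) ℚ) (i j : Fin 6) : kfun T i (Pi.single j 1) = T i j := by
  simp only [kfun, LinearMap.coe_mk, AddHom.coe_mk]
  rw [Finset.sum_eq_single j]
  · simp
  · intro b _ hb; simp [Pi.single_eq_of_ne hb]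
  · simp

theorem E6rec (H : Matrix (Fin 6) (Fin 6) ℤ) (hs : ∀ i j, H i j = H j i)
    (he : ∀ v : Fin 6 → ℤ, ∃ n, v ⬝ᵥ H.mulVec v = 2*n)
    (hp : ∀ v : Fin 6 → ℤ, v ≠ 0 → 0 < v ⬝ᵥ H.mulVec v) (hd : H.det = 3 ∨ H.det = -3) :
    ∃ e : Fin 6 → Fin 6 → ℤ, ∀ i j, e i ⬝ᵥ H.mulVec (e j) = CartanMatrix.E₆ i j := by
  obtain ⟨U, T, c, hU, hT1, hT0, hc, hcc, hG⟩ := HR 6 (H.map (Int.cast : ℤ → ℚ))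
    (fun i j => by simp [hs i j]) (posQ H hp) ⟨1, one_pos, fun i j => ⟨H i j, by simp⟩⟩
  have hBv : ∀ v w : Fin 6 → ℤ, v ⬝ᵥ (Uᵀ * H * U) *ᵥ w = (U *ᵥ v) ⬝ᵥ H *ᵥ (U *ᵥ w) := by
    intro v w
    rw [← mulVec_mulVec, ← mulVec_mulVec, dotProduct_mulVec, vecMul_transpose]
  have hM : (U.map (Int.cast : ℤ → ℚ))ᵀ * H.map (Int.cast : ℤ → ℚ) * U.map (Int.cast : ℤ → ℚ)
      = Tᵀ * diagonal c * T := by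
    ext i j
    have := hG i j
    simp only [map_apply] at this
    simp only [mul_apply, transpose_apply, map_apply, diagonal_apply, mul_ite, mul_zero,
      Finset.sum_ite_eq, Finset.sum_ite_eq', Finset.mem_univ, if_true, Finset.sum_mul]
    rw [Finset.sum_comm] at this
    exact this
  have hTd : T.det = 1 := by
    rw [det_of_isUpperTriangular (M := T) (fun i j hij => hT0 i j hij)]
    simp [hT1]
  have hdet := congrArg det hM
  have hcd : ∀ M : Matrix (Fin 6) (Fin 6) ℤ, (M.map (Int.cast : ℤ → ℚ)).det = (M.det : ℚ) := fun M => by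
    have := (Int.castRingHom ℚ).map_det M
    simpa [RingHom.mapMatrix_apply] using this.symm
  rw [det_mul, det_mul, det_mul, det_mul, det_transpose, det_transpose, hTd, det_diagonal, hcd, hcd] at hdet
  have hU2 : (U.det : ℚ) * U.det = 1 := by
    rcases Int.isUnit_iff.1 hU with h | h <;> simp [h]
  have hcp : ∏ i, c i = (H.det : ℚ) := by linear_combination -hdet + (H.det:ℚ) * hU2
  have hcpos : 0 < ∏ i, c i := Finset.prod_pos fun i _ => hc i
  have hc3 : ∏ i, c i = 3 := by
    rw [hcp] at hcpos ⊢
    rcases hd with h | h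
    · rw [h]; norm_num
    · rw [h] at hcpos; norm_num at hcpos
  rw [Fin.prod_univ_six] at hc3
  obtain ⟨e, he'⟩ := stage1 (Matrix.toLinearMap₂' ℤ (Uᵀ * H * U)) (by
      intro v w
      rw [toLinearMap₂'_apply', toLinearMap₂'_apply', hBv, hBv]
      rw [dotProduct_mulVec, dotProduct_comm, ← mulVec_transpose]
      congr 2
      ext i j; exact hs j i) (by
      intro v
      obtain ⟨n, hn⟩ := he (U *ᵥ v)
      exact ⟨n, by rw [toLinearMap₂'_apply', hBv]; exact hn⟩)
    (kfun T 0) (kfun T 1) (kfun T 2) (kfun T 3) (kfun T 4) (kfun T 5)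
    (Pi.single 0 1) (Pi.single 1 1) (Pi.single 2 1) (Pi.single 3 1) (Pi.single 4 1) (Pi.single 5 1)
    (c 0) (c 1) (c 2) (c 3) (c 4) (c 5) (hc 0) (hc 1) (hc 2) (hc 3) (hc 4)
    (bnd_c _ _ _ _ _ _ (hc 0) (hc 1) (hc 2) (hc 3) (hc 4) (hcc 0 1 rfl) (hcc 1 2 rfl) (hcc 2 3 rfl)
      (hcc 3 4 rfl) (hcc 4 5 rfl) hc3)
    (by simp only [kfun_single]; exact hT1 0)
    (by simp only [kfun_single]; exact ⟨hT0 _ _ (by decide), hT1 _⟩)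
    (by simp only [kfun_single]; exact ⟨hT0 _ _ (by decide), hT0 _ _ (by decide), hT1 _⟩)
    (by simp only [kfun_single]; exact ⟨hT0 _ _ (by decide), hT0 _ _ (by decide), hT0 _ _ (by decide), hT1 _⟩)
    (by simp only [kfun_single]; exact ⟨hT0 _ _ (by decide), hT0 _ _ (by decide), hT0 _ _ (by decide), hT0 _ _ (by decide), hT1 _⟩)
    (by simp only [kfun_single]; exact ⟨hT0 _ _ (by decide), hT0 _ _ (by decide), hT0 _ _ (by decide), hT0 _ _ (by decide), hT0 _ _ (by decide), hT1 _⟩)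
    (by
      intro v w
      rw [toLinearMap₂'_apply', cast_form]
      have h1 : (Uᵀ * H * U).map (Int.cast : ℤ → ℚ) = Tᵀ * diagonal c * T := by
        rw [← hM]; ext i j; simp [mul_apply]
      have hk : ∀ (v : Fin 6 → ℤ) i, kfun T i v = (T *ᵥ (fun i => (v i : ℚ))) i := fun v i => rfl
      simp only [hk]
      rw [h1, ← mulVec_mulVec, ← mulVec_mulVec, dotProduct_mulVec, vecMul_transpose]
      generalize T *ᵥ (fun i => (v i : ℚ)) = x
      generalize T *ᵥ (fun i => (w i : ℚ)) = y
      simp only [dotProduct, mulVec_diagonal, Fin.sum_univ_six]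
      ring)
  refine ⟨fun i => U *ᵥ e i, fun i j => ?_⟩
  have := he' i j
  rw [toLinearMap₂'_apply', hBv] at this
  exact this
end

section
open Matrix

def M6 : Matrix (Fin 6) (Fin 6) ℤ := !![4,3,5,6,4,2; 3,6,6,9,6,3; 5,6,10,12,8,4; 6,9,12,18,12,6; 4,6,8,12,10,5; 2,3,4,6,5,4]

theorem M6E : ∀ i j, ∑ k, M6 i k * CartanMatrix.E₆ k j = if i = j then 3 else 0 := by decide
theorem EM6 : ∀ i j, ∑ k, CartanMatrix.E₆ i k * M6 k j = if i = j then 3 else 0 := by decide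
theorem E6sym : ∀ i j, CartanMatrix.E₆ i j = CartanMatrix.E₆ j i := by
  intro i j; fin_cases i <;> fin_cases j <;> rfl
theorem M6sym : ∀ i j, M6 i j = M6 j i := by
  intro i j; fin_cases i <;> fin_cases j <;> rfl

def q6 (c : Fin 6 → ℤ) : ℤ := ∑ k, (∑ l, M6 k l * c l) * c k

def chi6 (c : Fin 6 → ℤ) : ℤ := c 0 - c 2 + c 4 - c 5

theorem q6_even (c : Fin 6 → ℤ) : ∃ n, q6 c = 2 * n := by
  refine ⟨2*c 0*c 0 + 3*c 1*c 1+5*c 2*c 2+9*c 3*c 3+5*c 4*c 4+2*c 5*c 5 + 3*c 0*c 1+5*c 0*c 2+6*c 0*c 3+4*c 0*c 4+2*c 0*c 5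
    + 6*c 1*c 2+9*c 1*c 3+6*c 1*c 4+3*c 1*c 5+12*c 2*c 3+8*c 2*c 4+4*c 2*c 5+12*c 3*c 4+6*c 3*c 5+5*c 4*c 5, ?_⟩
  simp only [q6, M6, Fin.sum_univ_six, of_apply, cons_val]
  ring

theorem M6_mod (c : Fin 6 → ℤ) (k : Fin 6) : ∃ n, ∑ l, M6 k l * c l = (![1,0,-1,0,1,-1] : Fin 6 → ℤ) k * chi6 c + 3 * n := by
  fin_cases k
  · exact ⟨c 0 + c 1 + 2 * c 2 + 2 * c 3 + c 4 + c 5, by simp [M6, chi6, Fin.sum_univ_six]; ring⟩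
  · exact ⟨c 0 + 2 * c 1 + 2 * c 2 + 3 * c 3 + 2 * c 4 + c 5, by simp [M6, chi6, Fin.sum_univ_six]; ring⟩
  · exact ⟨2 * c 0 + 2 * c 1 + 3 * c 2 + 4 * c 3 + 3 * c 4 + c 5, by simp [M6, chi6, Fin.sum_univ_six]; ring⟩
  · exact ⟨2 * c 0 + 3 * c 1 + 4 * c 2 + 6 * c 3 + 4 * c 4 + 2 * c 5, by simp [M6, chi6, Fin.sum_univ_six]; ring⟩
  · exact ⟨c 0 + 2 * c 1 + 3 * c 2 + 4 * c 3 + 3 * c 4 + 2 * c 5, by simp [M6, chi6, Fin.sum_univ_six]; ring⟩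
  · exact ⟨c 0 + c 1 + c 2 + 2 * c 3 + 2 * c 4 + c 5, by simp [M6, chi6, Fin.sum_univ_six]; ring⟩

theorem q6_mod (c : Fin 6 → ℤ) : ∃ n, q6 c = chi6 c ^ 2 + 3 * n := by
  choose n hn using M6_mod c
  refine ⟨∑ k, n k * c k, ?_⟩
  simp only [q6, hn]
  simp [Fin.sum_univ_six, chi6]
  ring

theorem sq_mod3 (x : ℤ) : ∃ m, (x ^ 2 = 3 * m ∧ ∃ l, x = 3 * l) ∨ x ^ 2 = 3 * m + 1 := by
  rcases (by omega : x % 3 = 0 ∨ x % 3 = 1 ∨ x % 3 = 2) with h | h | h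
  · exact ⟨3 * (x/3)^2, Or.inl ⟨by have : x = 3 * (x/3) := by omega
                                   conv_lhs => rw [this]
                                   ring, x/3, by omega⟩⟩
  · refine ⟨3 * (x/3)^2 + 2 * (x/3), Or.inr ?_⟩
    have : x = 3 * (x/3) + 1 := by omega
    conv_lhs => rw [this]
    ring
  · refine ⟨3 * (x/3)^2 + 4 * (x/3) + 1, Or.inr ?_⟩
    have : x = 3 * (x/3) + 2 := by omega
    conv_lhs => rw [this]
    ring

theorem q6_class (c : Fin 6 → ℤ) : (∃ n, q6 c = 6 * n ∧ ∃ l, chi6 c = 3 * l) ∨ ∃ n, q6 c = 6 * n + 4 := by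
  obtain ⟨n, hn⟩ := q6_even c
  obtain ⟨m, hm⟩ := q6_mod c
  obtain ⟨k, ⟨h1, h2⟩ | h1⟩ := sq_mod3 (chi6 c)
  · exact Or.inl ⟨n / 3, by omega, h2⟩
  · exact Or.inr ⟨n / 3, by omega⟩

theorem comb_ip {V : Type} [AddCommGroup V] (B : V →ₗ[ℤ] V →ₗ[ℤ] ℤ)
    {I : Type} [Fintype I] [DecidableEq I] (e : I × Fin 6 → V)
    (hG : ∀ p q : I × Fin 6, B (e p) (e q) = if p.1 = q.1 then CartanMatrix.E₆ p.2 q.2 else 0)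
    (g : I × Fin 6 → ℤ) (q : I × Fin 6) :
    B (∑ p, g p • e p) (e q) = ∑ k, g (q.1, k) * CartanMatrix.E₆ k q.2 := by
  simp only [map_sum, LinearMap.sum_apply, map_smul, LinearMap.smul_apply, hG, smul_eq_mul]
  rw [Fintype.sum_prod_type, Finset.sum_eq_single q.1]
  · simp
  · intro b _ hb
    simp [hb]
  · simp

theorem li_of_gram {V : Type} [AddCommGroup V] (B : V →ₗ[ℤ] V →ₗ[ℤ] ℤ)
    {I : Type} [Fintype I] [DecidableEq I] (e : I × Fin 6 → V)
    (hG : ∀ p q : I × Fin 6, B (e p) (e q) = if p.1 = q.1 then CartanMatrix.E₆ p.2 q.2 else 0) : LinearIndependent ℤ e := by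
  rw [Fintype.linearIndependent_iff]
  intro g hg p
  have h1 : ∀ l, ∑ k, g (p.1, k) * CartanMatrix.E₆ k l = 0 := fun l => by
    rw [← comb_ip B e hG g (p.1, l), hg]; simp
  have h2 : ∑ l, (∑ k, g (p.1, k) * CartanMatrix.E₆ k l) * M6 l p.2 = 0 := by simp [h1]
  simp only [Finset.sum_mul] at h2
  rw [Finset.sum_comm] at h2
  simp only [mul_assoc, ← Finset.mul_sum, EM6] at h2
  simp at h2
  exact h2

theorem finish_roots {V : Type} [AddCommGroup V] [Module.Finite ℤ V] [Module.Free ℤ V] (hfr : Module.finrank ℤ V = 24)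
    (B : V →ₗ[ℤ] V →ₗ[ℤ] ℤ)
    (hsym : ∀ v w, B v w = B w v) (hpos : ∀ v, v ≠ 0 → 0 < B v v) (e : Fin 4 × Fin 6 → V)
    (hG : ∀ p q : Fin 4 × Fin 6, B (e p) (e q) = if p.1 = q.1 then CartanMatrix.E₆ p.2 q.2 else 0) :
    Submodule.span ℤ {v : V | B v v = 2} = Submodule.span ℤ (Set.range e) := by
  have hli := li_of_gram B e hG
  have horth : ∀ w, (∀ q, B w (e q) = 0) → w = 0 := by
    intro w hw
    by_contra hw0
    have : LinearIndependent ℤ (fun o : Option (Fin 4 × Fin 6) => o.elim w e) := by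
      rw [Fintype.linearIndependent_iff]
      intro g hg
      rw [Fintype.sum_option] at hg
      simp only [Option.elim] at hg
      have h1 := congrArg (B w) hg
      simp only [map_add, map_sum, map_smul, hw, map_zero, smul_eq_mul] at h1
      have h1 : g none = 0 := by simpa [(hpos w hw0).ne'] using h1
      rw [h1, zero_smul, zero_add] at hg
      have h2 := Fintype.linearIndependent_iff.1 hli _ hg
      rintro (_ | p)
      · exact h1
      · exact h2 p
    have h3 := this.fintype_card_le_finrank
    rw [hfr] at h3
    simp at h3
  apply le_antisymm
  · rw [Submodule.span_le]
    intro v hv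
    have hv : B v v = 2 := hv
    set c : Fin 4 → Fin 6 → ℤ := fun i l => B v (e (i, l)) with hc
    set g : Fin 4 × Fin 6 → ℤ := fun p => ∑ l, M6 p.2 l * c p.1 l with hg
    have h3 : (3:ℤ) • v = ∑ p, g p • e p := by
      rw [← sub_eq_zero]
      apply horth
      intro q
      rw [map_sub, LinearMap.sub_apply, comb_ip B e hG]
      simp only [hg, Finset.sum_mul]
      rw [Finset.sum_comm]
      have : ∀ y, ∑ x, M6 x y * c q.1 y * CartanMatrix.E₆ x q.2 = c q.1 y * (if y = q.2 then 3 else 0) := by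
        intro y
        rw [← M6E, Finset.mul_sum]
        exact Finset.sum_congr rfl fun x _ => by rw [M6sym]; ring
      simp only [this]
      simp [hc]; ring
    have hq : ∑ i, q6 (c i) = 6 := by
      have := congrArg (B v) h3
      rw [map_smul, hv] at this
      simp only [map_sum, map_smul, smul_eq_mul] at this
      rw [Fintype.sum_prod_type] at this
      simp only [q6]
      simp only [hg] at this
      rw [show (6:ℤ) = 3 * 2 by norm_num, this]
    have hnn : ∀ i, 0 ≤ q6 (c i) := by
      intro i
      set y := ∑ p : Fin 4 × Fin 6, (if p.1 = i then g p else 0) • e p with hy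
      have h1 : ∀ l, B y (e (i, l)) = 3 * c i l := by
        intro l
        rw [comb_ip B e hG]
        simp only [if_true, hg, Finset.sum_mul]
        rw [Finset.sum_comm]
        have : ∀ y, ∑ x, M6 x y * c i y * CartanMatrix.E₆ x l = c i y * (if y = l then 3 else 0) := by
          intro y
          rw [← M6E, Finset.mul_sum]
          exact Finset.sum_congr rfl fun x _ => by rw [M6sym]; ring
        simp only [this]
        simp; ring
      have h2 : B y y = 3 * q6 (c i) := by
        clear_value y
        nth_rewrite 2 [hy]
        simp only [map_sum, map_smul]
        rw [Fintype.sum_prod_type, Finset.sum_eq_single i]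
        · simp only [if_true, h1, smul_eq_mul, q6, Finset.mul_sum, hg]
          refine Finset.sum_congr rfl fun k _ => ?_
          ring
        · intro b _ hb
          simp [hb]
        · simp
      have h4 : 0 ≤ B y y := by
        by_cases h : y = 0
        · rw [h]; simp
        · exact (hpos y h).le
      omega
    have hchi : ∀ i, ∃ l, chi6 (c i) = 3 * l := by
      rw [Fin.sum_univ_four] at hq
      have n0 := hnn 0
      have n1 := hnn 1
      have n2 := hnn 2
      have n3 := hnn 3
      rcases q6_class (c 0) with ⟨a, ha, ha'⟩ | ⟨a, ha⟩ <;> rcases q6_class (c 1) with ⟨b, hb, hb'⟩ | ⟨b, hb⟩ <;>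
      rcases q6_class (c 2) with ⟨d, hd, hd'⟩ | ⟨d, hd⟩ <;> rcases q6_class (c 3) with ⟨f, hf, hf'⟩ | ⟨f, hf⟩ <;>
      first
      | (exfalso; omega)
      | (intro i; fin_cases i <;> assumption)
    have hdiv : ∀ p, ∃ n, g p = 3 * n := by
      intro p
      obtain ⟨l, hl⟩ := hchi p.1
      obtain ⟨n, hn⟩ := M6_mod (c p.1) p.2
      exact ⟨(![1,0,-1,0,1,-1] : Fin 6 → ℤ) p.2 * l + n, by rw [hg]; simp only; rw [hn, hl]; ring⟩
    choose n hn using hdiv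
    have hvn : v = ∑ p, n p • e p := by
      simp only [hn, mul_smul, ← Finset.smul_sum] at h3
      have hinj := smul_right_injective V (three_ne_zero : (3:ℤ) ≠ 0)
      exact hinj h3
    rw [hvn]
    exact Submodule.sum_mem _ fun p _ => Submodule.smul_mem _ _ (Submodule.subset_span ⟨p, rfl⟩)
  · rw [Submodule.span_le]
    rintro _ ⟨p, rfl⟩
    apply Submodule.subset_span
    show B (e p) (e p) = 2
    rw [hG, if_pos rfl]
    generalize p.2 = k
    revert k; decide
end

section
open Matrix

theorem adapted {V : Type} [AddCommGroup V] (b0 : Module.Basis (Fin 24) ℤ V) (e0 : Fin 3 × Fin 6 → V)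
    (hli : LinearIndependent ℤ e0) :
    ∃ β : Module.Basis ((Fin 3 × Fin 6) ⊕ Fin 6) ℤ V, ∀ p i, β.repr (e0 p) (Sum.inr i) = 0 := by
  classical
  obtain ⟨n, snf⟩ := Submodule.smithNormalForm b0 (Submodule.span ℤ (Set.range e0))
  have hn : Fintype.card (Fin 3 × Fin 6) = Fintype.card (Fin n) := by
    have h1 := Module.finrank_eq_card_basis snf.bN
    have h2 := Module.finrank_eq_card_basis (Module.Basis.span hli)
    rw [← h1, ← h2]
  let ε := Fintype.equivOfCardEq hn
  have hc : Fintype.card (Fin 6) = Fintype.card ↥(Set.range snf.f)ᶜ := by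
    have h := Fintype.card_congr (Equiv.Set.sumCompl (Set.range snf.f))
    have h3 := Fintype.card_congr (Equiv.ofInjective snf.f snf.f.injective)
    rw [Fintype.card_sum, ← h3, ← hn] at h
    simp only [Fintype.card_prod, Fintype.card_fin] at h
    rw [Fintype.card_fin]
    omega
  let σ : (Fin 3 × Fin 6) ⊕ Fin 6 ≃ Fin 24 :=
    (Equiv.sumCongr (ε.trans (Equiv.ofInjective snf.f snf.f.injective)) (Fintype.equivOfCardEq hc)).trans
      (Equiv.Set.sumCompl (Set.range snf.f))
  refine ⟨snf.bM.reindex σ.symm, fun p i => ?_⟩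
  rw [Module.Basis.repr_reindex_apply, Equiv.symm_symm]
  have hi : σ (Sum.inr i) ∉ Set.range snf.f := by
    have : σ (Sum.inr i) = ((Fintype.equivOfCardEq hc i : ↥(Set.range snf.f)ᶜ) : Fin 24) := by
      simp [σ]
    rw [this]
    exact (Fintype.equivOfCardEq hc i).2
  exact snf.repr_eq_zero_of_notMem_range ⟨e0 p, Submodule.subset_span ⟨p, rfl⟩⟩ hi

theorem det_gram0 {V : Type} [AddCommGroup V] (B : V →ₗ[ℤ] V →ₗ[ℤ] ℤ) (e0 : Fin 3 × Fin 6 → V)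
    (hG : ∀ p q : Fin 3 × Fin 6, B (e0 p) (e0 q) = if p.1 = q.1 then CartanMatrix.E₆ p.2 q.2 else 0) :
    (Matrix.of fun p q => B (e0 p) (e0 q)).det = 27 := by
  have : (Matrix.of fun p q => B (e0 p) (e0 q)) = kroneckerMap (· * ·) (1 : Matrix (Fin 3) (Fin 3) ℤ) CartanMatrix.E₆ := by
    ext p q
    simp [hG, one_apply]
  rw [this, det_kronecker, CartanMatrix.E₆_det]
  simp

theorem glue34 {V : Type} [AddCommGroup V] (B : V →ₗ[ℤ] V →ₗ[ℤ] ℤ) (hsym : ∀ v w, B v w = B w v)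
    (e0 : Fin 3 × Fin 6 → V)
    (hG : ∀ p q : Fin 3 × Fin 6, B (e0 p) (e0 q) = if p.1 = q.1 then CartanMatrix.E₆ p.2 q.2 else 0)
    (e3 : Fin 6 → V) (h33 : ∀ i j, B (e3 i) (e3 j) = CartanMatrix.E₆ i j) (h30 : ∀ i p, B (e3 i) (e0 p) = 0) :
    ∃ e : Fin 4 × Fin 6 → V, ∀ p q : Fin 4 × Fin 6, B (e p) (e q) = if p.1 = q.1 then CartanMatrix.E₆ p.2 q.2 else 0 := by
  refine ⟨fun p => if h : p.1.val < 3 then e0 (⟨p.1.val, h⟩, p.2) else e3 p.2, ?_⟩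
  rintro ⟨i, a⟩ ⟨j, b⟩
  dsimp only
  split_ifs with h1 h2 h3 h3 h3
  · subst h3; rw [hG]; simp
  · rw [hG, if_neg]
    intro h
    simp only [Fin.mk.injEq] at h
    exact h3 (Fin.ext h)
  · subst h3; exact absurd h1 h2
  · rw [hsym]; exact h30 _ _
  · rename_i hij; rw [hij] at h1; exact absurd h3 h1
  · exact h30 _ _
  · exact h33 _ _
  · exfalso; apply ‹¬ i = j›; ext; omega

theorem complement {V : Type} [AddCommGroup V] (b0 : Module.Basis (Fin 24) ℤ V)
    (B : V →ₗ[ℤ] V →ₗ[ℤ] ℤ) (hsym : ∀ v w, B v w = B w v) (heven : ∀ v, ∃ n, B v v = 2 * n)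
    (hpos : ∀ v, v ≠ 0 → 0 < B v v) (hdual : ∀ l : V →ₗ[ℤ] ℤ, ∃ k, ∀ w, B k w = l w)
    (e0 : Fin 3 × Fin 6 → V)
    (hG : ∀ p q : Fin 3 × Fin 6, B (e0 p) (e0 q) = if p.1 = q.1 then CartanMatrix.E₆ p.2 q.2 else 0)
    (g : V) (hg3 : (3:ℤ) • g ∈ Submodule.span ℤ (Set.range e0)) (hg : g ∉ Submodule.span ℤ (Set.range e0)) :
    ∃ e : Fin 4 × Fin 6 → V, ∀ p q : Fin 4 × Fin 6, B (e p) (e q) = if p.1 = q.1 then CartanMatrix.E₆ p.2 q.2 else 0 := by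
  classical
  obtain ⟨β, hβ⟩ := adapted b0 e0 (li_of_gram B e0 hG)
  choose k hk using fun s => hdual (β.coord s)
  have hk' : ∀ s w, B (k s) w = β.repr w s := fun s w => hk s w
  let G : Matrix ((Fin 3 × Fin 6) ⊕ Fin 6) ((Fin 3 × Fin 6) ⊕ Fin 6) ℤ := Matrix.of fun s t => B (β s) (β t)
  let K : Matrix ((Fin 3 × Fin 6) ⊕ Fin 6) ((Fin 3 × Fin 6) ⊕ Fin 6) ℤ := Matrix.of fun s t => B (k s) (k t)
  have hGK : G * K = 1 := by
    ext s t
    have h1 : k t = ∑ u, β.repr (k t) u • β u := (β.sum_repr (k t)).symm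
    have h2 : B (β s) (k t) = ∑ u, β.repr (k t) u * B (β s) (β u) := by
      conv_lhs => rw [h1]
      simp only [map_sum, map_smul, smul_eq_mul]
    rw [hsym, hk'] at h2
    simp only [mul_apply, G, K, of_apply, hk']
    rw [← show ∑ u, β.repr (k t) u * B (β s) (β u) = ∑ u, B (β s) (β u) * β.repr (k t) u from
      Finset.sum_congr rfl fun _ _ => mul_comm _ _, ← h2, Module.Basis.repr_self, Finsupp.single_apply, one_apply]
  have hGK' := hGK
  rw [← fromBlocks_toBlocks G, ← fromBlocks_toBlocks K, fromBlocks_multiply, ← fromBlocks_one, fromBlocks_inj] at hGK'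
  obtain ⟨-, h12, -, h22⟩ := hGK'
  have hprod : G * fromBlocks 1 K.toBlocks₁₂ 0 K.toBlocks₂₂ = fromBlocks G.toBlocks₁₁ 0 G.toBlocks₂₁ 1 := by
    conv_lhs => rw [← fromBlocks_toBlocks G]
    rw [fromBlocks_multiply, h12, h22]
    simp
  have hdet := congrArg det hprod
  rw [det_mul, det_fromBlocks_zero₂₁, det_fromBlocks_zero₁₂, det_one, det_one, one_mul, mul_one] at hdet
  have hGu : G.det * K.det = 1 := by rw [← det_mul, hGK, det_one]
  have hGu' : G.det = 1 ∨ G.det = -1 := Int.isUnit_iff.1 (IsUnit.of_mul_eq_one _ hGu)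
  -- coefficient matrix
  let C : Matrix (Fin 3 × Fin 6) (Fin 3 × Fin 6) ℤ := Matrix.of fun p j => β.repr (e0 p) (Sum.inl j)
  have he0 : ∀ p, e0 p = ∑ j, C p j • β (Sum.inl j) := by
    intro p
    conv_lhs => rw [← β.sum_repr (e0 p)]
    rw [Fintype.sum_sum_type]
    simp [hβ, C]
  have hCG : (Matrix.of fun p q => B (e0 p) (e0 q)) = C * G.toBlocks₁₁ * Cᵀ := by
    ext p q
    simp only [of_apply]
    rw [he0 p, he0 q]
    simp only [map_sum, map_smul, LinearMap.sum_apply, LinearMap.smul_apply, smul_eq_mul, mul_apply, transpose_apply,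
      toBlocks₁₁, G, of_apply, Finset.sum_mul, Finset.mul_sum]
    refine Finset.sum_congr rfl fun _ _ => Finset.sum_congr rfl fun _ _ => by ring
  have hd27 := congrArg det hCG
  rw [det_gram0 B e0 hG, det_mul, det_mul, det_transpose] at hd27
  have hC1 : ¬ IsUnit C.det := by
    intro hu
    apply hg
    have hb : ∀ j, β (Sum.inl j) = ∑ p, C⁻¹ j p • e0 p := by
      intro j
      have hCC : C⁻¹ * C = 1 := nonsing_inv_mul C hu
      simp only [he0, Finset.smul_sum]
      rw [Finset.sum_comm]
      simp only [smul_smul, ← Finset.sum_smul]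
      have : ∀ y, ∑ i, C⁻¹ j i * C i y = (1 : Matrix (Fin 3 × Fin 6) (Fin 3 × Fin 6) ℤ) j y := fun y => by
        rw [← hCC, mul_apply]
      simp only [this, one_apply]
      simp
    have hz : ∀ i, β.repr g (Sum.inr i) = 0 := by
      intro i
      have h1 : Submodule.span ℤ (Set.range e0) ≤ LinearMap.ker (β.coord (Sum.inr i)) := by
        rw [Submodule.span_le]
        rintro _ ⟨p, rfl⟩
        exact hβ p i
      have h2 : β.coord (Sum.inr i) ((3:ℤ) • g) = 0 := h1 hg3
      rw [map_smul] at h2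
      simpa using h2
    rw [← β.sum_repr g, Fintype.sum_sum_type]
    simp only [hz, zero_smul, Finset.sum_const_zero, add_zero]
    refine Submodule.sum_mem _ fun j _ => Submodule.smul_mem _ _ ?_
    rw [hb]
    exact Submodule.sum_mem _ fun p _ => Submodule.smul_mem _ _ (Submodule.subset_span ⟨p, rfl⟩)
  have h11 : G.toBlocks₁₁.det = 3 := by
    have hsq : 27 = C.det ^ 2 * G.toBlocks₁₁.det := by rw [hd27]; ring
    have hle : C.det ^ 2 ∣ 27 := ⟨_, hsq⟩
    have hle' := Int.le_of_dvd (by norm_num) hle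
    have hlt : C.det ≤ 5 := by nlinarith
    have hgt : -5 ≤ C.det := by nlinarith
    generalize C.det = x at *
    generalize G.toBlocks₁₁.det = y at *
    interval_cases x <;> first | omega | (exfalso; apply hC1; decide)
  have hDdet : (K.toBlocks₂₂).det = 3 ∨ (K.toBlocks₂₂).det = -3 := by
    rw [h11] at hdet
    rcases hGu' with h | h <;> rw [h] at hdet <;> omega
  have hform : ∀ v w : Fin 6 → ℤ, v ⬝ᵥ K.toBlocks₂₂ *ᵥ w = B (∑ i, v i • k (Sum.inr i)) (∑ i, w i • k (Sum.inr i)) := by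
    intro v w
    simp only [map_sum, map_smul, LinearMap.sum_apply, LinearMap.smul_apply, smul_eq_mul, dotProduct, mulVec,
      toBlocks₂₂, K, of_apply, Finset.mul_sum]
    rw [Finset.sum_comm]
    refine Finset.sum_congr rfl fun _ _ => Finset.sum_congr rfl fun _ _ => by ring
  obtain ⟨c, hc⟩ := E6rec K.toBlocks₂₂ (fun i j => hsym _ _) (fun v => by rw [hform]; exact heven _) (fun v hv => by
    rw [hform]
    apply hpos
    intro h0
    apply hv
    funext i
    have := congrArg (fun x => B x (β (Sum.inr i))) h0
    simpa [hk', Finsupp.single_apply] using this) hDdet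
  let e3 : Fin 6 → V := fun i => ∑ j, c i j • k (Sum.inr j)
  have h33 : ∀ i j, B (e3 i) (e3 j) = CartanMatrix.E₆ i j := fun i j => by rw [← hc, hform]
  have h30 : ∀ i p, B (e3 i) (e0 p) = 0 := fun i p => by
    simp [e3, hk', hβ]
  exact glue34 B hsym e0 hG e3 h33 h30
end

section
def dir4 : Fin 4 → F3 := ![(1,0),(0,1),(1,1),(1,2)]
def ind4 (j : Fin 4) (t : F3) : ZMod 3 := 1 - (![t.2, t.1, t.1 - t.2, t.1 + t.2] j)^2

theorem ind4_eq : ∀ j t, ind4 j t = if t ∈ lineF 0 (dir4 j) then 1 else 0 := by decide +kernel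

set_option synthInstance.maxHeartbeats 400000 in
set_option synthInstance.maxSize 2000 in
theorem fin9 : ∀ a00 a01 a02 a10 a11 a12 : ZMod 3, a00 + a01 + a02 = a10 + a11 + a12 → ∀ a20 a21 a22 : ZMod 3,
    a00 + a01 + a02 = a20 + a21 + a22 →
    a00 + a10 + a20 = a01 + a11 + a21 →
    a00 + a10 + a20 = a02 + a12 + a22 →
    a00 + a11 + a22 = a10 + a21 + a02 →
    a00 + a11 + a22 = a20 + a01 + a12 →
    a00 + a12 + a21 = a10 + a22 + a01 →
    a00 + a12 + a21 = a20 + a02 + a11 →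
    a00*a00 + a01*a01 + a02*a02 + a10*a10 + a11*a11 + a12*a12 + a20*a20 + a21*a21 + a22*a22 = 0 →
    ∃ ε : ZMod 3, ∃ j : Fin 4,
      a00 = (a00 - ε) + (a20 - a10) * 0 + (a02 - a01) * 0 + ε * ind4 j (0,0) ∧
      a01 = (a00 - ε) + (a20 - a10) * 0 + (a02 - a01) * 1 + ε * ind4 j (0,1) ∧
      a02 = (a00 - ε) + (a20 - a10) * 0 + (a02 - a01) * 2 + ε * ind4 j (0,2) ∧
      a10 = (a00 - ε) + (a20 - a10) * 1 + (a02 - a01) * 0 + ε * ind4 j (1,0) ∧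
      a11 = (a00 - ε) + (a20 - a10) * 1 + (a02 - a01) * 1 + ε * ind4 j (1,1) ∧
      a12 = (a00 - ε) + (a20 - a10) * 1 + (a02 - a01) * 2 + ε * ind4 j (1,2) ∧
      a20 = (a00 - ε) + (a20 - a10) * 2 + (a02 - a01) * 0 + ε * ind4 j (2,0) ∧
      a21 = (a00 - ε) + (a20 - a10) * 2 + (a02 - a01) * 1 + ε * ind4 j (2,1) ∧
      a22 = (a00 - ε) + (a20 - a10) * 2 + (a02 - a01) * 2 + ε * ind4 j (2,2) := by
  decide +kernel
end

section
theorem BP_sparse (x y : VP) : BP x y = ∑ t : F3, (-2 * x (t,0) * y (t,0) - 2 * x (t,1) * y (t,1)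
    + x (t,0) * y (t,1) + x (t,1) * y (t,0)) := by
  unfold BP
  rw [Fintype.sum_prod_type]
  refine Finset.sum_congr rfl fun t _ => ?_
  have : ∀ k : Fin 2, ∑ j : IP, x (t,k) * GP (t,k) j * y j = ∑ l : Fin 2, x (t,k) * (if k = l then -2 else 1) * y (t,l) := by
    intro k
    rw [Fintype.sum_prod_type, Finset.sum_eq_single t]
    · simp [GP]
    · intro b _ hb
      simp [GP, Ne.symm hb]
    · simp
  simp only [this, Fin.sum_univ_two]
  simp
  ring

def Qv (c : F3 → ℤ) : VP := fun q => (c q.1 : ℚ) * ((q.2.val : ℚ) + 1) / 3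

theorem Qv_add (c d : F3 → ℤ) : Qv (c + d) = Qv c + Qv d := by
  funext q; simp [Qv]; ring
theorem Qv_sub (c d : F3 → ℤ) : Qv (c - d) = Qv c - Qv d := by
  funext q; simp [Qv]; ring
theorem Qv_smul (n : ℤ) (d : F3 → ℤ) : Qv (n • d) = n • Qv d := by
  funext q; simp [Qv]; ring

theorem BP_Qv (c d : F3 → ℤ) : BP (Qv c) (Qv d) = -(2/3) * ((∑ t, c t * d t : ℤ) : ℚ) := by
  rw [BP_sparse]
  push_cast
  rw [Finset.mul_sum]
  refine Finset.sum_congr rfl fun t _ => ?_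
  simp [Qv]; ring

theorem Ev_apply (t s : F3) (k l : Fin 2) : Ev t k (s, l) = if s = t ∧ l = k then 1 else 0 := by
  simp [Ev, Pi.single_apply, Prod.ext_iff]

theorem EV_apply (t s : F3) (l : Fin 2) : EV t (s, l) = if s = t then (l.val : ℚ) + 1 else 0 := by
  simp only [EV, Pi.add_apply, Pi.smul_apply, Ev_apply]
  fin_cases l <;> by_cases h : s = t <;> simp [h]
  norm_num

theorem eL_eq (L : Finset F3) : eL L = Qv (fun t => if t ∈ L then 1 else 0) := by
  funext ⟨s, l⟩
  simp only [eL, Pi.smul_apply, Finset.sum_apply, EV_apply, Qv]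
  by_cases h : s ∈ L <;> simp [h] ; ring

theorem Ev_mem (t : F3) (k : Fin 2) : Ev t k ∈ Plat := Submodule.subset_span (Or.inl ⟨t, k, rfl⟩)

theorem int_mem (x : VP) (h : ∀ q, ∃ n : ℤ, x q = n) : x ∈ Plat := by
  choose n hn using h
  have : x = ∑ q : IP, n q • Ev q.1 q.2 := by
    funext q
    simp only [Finset.sum_apply, Pi.smul_apply]
    rw [Finset.sum_eq_single q]
    · simp [Ev, hn]
    · intro b _ hb
      simp [Ev, Pi.single_apply, hb.symm]
    · simp
  rw [this]
  exact Submodule.sum_mem _ fun q _ => Submodule.smul_mem _ _ (Ev_mem _ _)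

theorem par_mem (p p' d : F3) (hd : d ≠ 0) : eL (lineF p d) - eL (lineF p' d) ∈ Plat :=
  Submodule.subset_span (Or.inr ⟨_, _, ⟨p, p', d, hd, rfl, rfl⟩, rfl⟩)

theorem Qv_mod (c : F3 → ℤ) (h : ∀ t, ((c t : ℤ) : ZMod 3) = 0) : Qv c ∈ Plat := by
  apply int_mem
  rintro ⟨t, k⟩
  have h1 : (3:ℤ) ∣ c t := (ZMod.intCast_zmod_eq_zero_iff_dvd (c t) 3).1 (h t)
  obtain ⟨m, hm⟩ := h1
  exact ⟨m * (k.val + 1), by simp [Qv, hm]; ring⟩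

def lind (p d : F3) : F3 → ℤ := fun t => if t ∈ lineF p d then 1 else 0

theorem Qv_lind (p p' d : F3) (hd : d ≠ 0) : Qv (lind p d - lind p' d) ∈ Plat := by
  have := par_mem p p' d hd
  rw [eL_eq, eL_eq, ← Qv_sub] at this
  exact this

/-- integer lifts of the affine functions -/
def f1 : F3 → ℤ := (lind (0,0) (0,1) - lind (1,0) (0,1)) - (lind (1,0) (0,1) - lind (2,0) (0,1))
def fx : F3 → ℤ := lind (1,0) (0,1) - lind (2,0) (0,1)
def fy : F3 → ℤ := lind (0,1) (1,0) - lind (0,2) (1,0)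

theorem f1_mod : ∀ t, ((f1 t : ℤ) : ZMod 3) = 1 := by decide +kernel
theorem fx_mod : ∀ t, ((fx t : ℤ) : ZMod 3) = t.1 := by decide +kernel
theorem fy_mod : ∀ t, ((fy t : ℤ) : ZMod 3) = t.2 := by decide +kernel
theorem lind_mod : ∀ j t, ((lind 0 (dir4 j) t : ℤ) : ZMod 3) = ind4 j t := by decide +kernel
theorem f1_mem : Qv f1 ∈ Plat := by
  rw [f1, Qv_sub]
  exact Submodule.sub_mem _ (Qv_lind _ _ _ (by decide)) (Qv_lind _ _ _ (by decide))
theorem fx_mem : Qv fx ∈ Plat := Qv_lind _ _ _ (by decide)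
theorem fy_mem : Qv fy ∈ Plat := Qv_lind _ _ _ (by decide)

theorem intCast_valq (z : ZMod 3) : (((z.val : ℕ) : ℤ) : ZMod 3) = z := by
  simp

theorem two_thirds (n m : ℤ) (h : -(2/3:ℚ) * n = m) : ((n : ℤ) : ZMod 3) = 0 := by
  rw [ZMod.intCast_zmod_eq_zero_iff_dvd]
  have : -2 * n = 3 * m := by
    have : (-2 * n : ℚ) = 3 * m := by linarith
    exact_mod_cast this
  omega

theorem lsum (b : F3 → ZMod 3) (p p' d : F3) (hd : d ≠ 0) : ∑ t, b t * (((lind p d - lind p' d) t : ℤ) : ZMod 3) =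
    (b (p + (0 : ZMod 3) • d) + b (p + (1 : ZMod 3) • d) + b (p + (2 : ZMod 3) • d))
     - (b (p' + (0 : ZMod 3) • d) + b (p' + (1 : ZMod 3) • d) + b (p' + (2 : ZMod 3) • d)) := by
  have h : ∀ q : F3, ∑ t, b t * ((lind q d t : ℤ) : ZMod 3) =
      b (q + (0 : ZMod 3) • d) + b (q + (1 : ZMod 3) • d) + b (q + (2 : ZMod 3) • d) := by
    intro q
    have hinj : Function.Injective (fun s : ZMod 3 => q + s • d) := by
      intro s s' h
      have h2 : s • d = s' • d := add_left_cancel h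
      have key : ∀ d : F3, d ≠ 0 → ∀ s s' : ZMod 3, s • d = s' • d → s = s' := by decide
      exact key d hd s s' h2
    have : ∑ t, b t * ((lind q d t : ℤ) : ZMod 3) = ∑ t ∈ lineF q d, b t := by
      simp [lind]
    rw [this, lineF, Finset.sum_image (fun x _ y _ h => hinj h)]
    exact Fin.sum_univ_three (fun s : ZMod 3 => b (q + s • d))
  simp only [Pi.sub_apply, Int.cast_sub, mul_sub, Finset.sum_sub_distrib, h]

theorem lemA (Pt : Submodule ℤ VP) (hP : Plat ≤ Pt) (hint : ∀ x ∈ Pt, ∀ y ∈ Pt, ∃ n : ℤ, BP x y = n)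
    (hne : ¬ Pt ≤ Plat) : ∃ j, eL (lineF 0 (dir4 j)) ∈ Pt := by
  obtain ⟨x0, hx0, hx0'⟩ := Set.not_subset.1 hne
  have hx0 : x0 ∈ Pt := hx0
  have hx0' : x0 ∉ Plat := hx0'
  -- coordinates
  have h0 : ∀ t, ∃ n : ℤ, -2 * x0 (t,0) + x0 (t,1) = n := by
    intro t
    obtain ⟨n, hn⟩ := hint x0 hx0 _ (hP (Ev_mem t 0))
    refine ⟨n, ?_⟩
    rw [← hn, BP_sparse, Finset.sum_eq_single t]
    · simp [Ev_apply]
    · intro b _ hb; simp [Ev_apply, hb]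
    · simp
  have h1 : ∀ t, ∃ n : ℤ, x0 (t,0) - 2 * x0 (t,1) = n := by
    intro t
    obtain ⟨n, hn⟩ := hint x0 hx0 _ (hP (Ev_mem t 1))
    refine ⟨n, ?_⟩
    rw [← hn, BP_sparse, Finset.sum_eq_single t]
    · simp [Ev_apply]; ring
    · intro b _ hb; simp [Ev_apply, hb]
    · simp
  choose m hm using h0
  choose m' hm' using h1
  set a : F3 → ℤ := fun t => -(2 * m t + m' t) with ha
  have hr : x0 - Qv a ∈ Plat := by
    apply int_mem
    rintro ⟨t, k⟩
    have e0 := hm t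
    have e1 := hm' t
    fin_cases k
    · refine ⟨0, ?_⟩
      simp [Qv, ha]; linarith
    · refine ⟨m t, ?_⟩
      simp [Qv, ha]; linarith
  have hQ : Qv a ∈ Pt := by
    have := Submodule.sub_mem _ hx0 (hP hr)
    simpa using this
  have hQ' : Qv a ∉ Plat := fun h => hx0' (by simpa using Submodule.add_mem _ hr h)
  have hline : ∀ p p' d, d ≠ 0 → (((∑ t, a t * (lind p d - lind p' d) t : ℤ)) : ZMod 3) = 0 := by
    intro p p' d hd
    obtain ⟨n, hn⟩ := hint _ hQ _ (hP (Qv_lind p p' d hd))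
    rw [BP_Qv] at hn
    exact two_thirds _ _ hn
  have hsq : (((∑ t, a t * a t : ℤ)) : ZMod 3) = 0 := by
    obtain ⟨n, hn⟩ := hint _ hQ _ hQ
    rw [BP_Qv] at hn
    exact two_thirds _ _ hn
  have hu3 : ∀ f : ZMod 3 → ZMod 3, ∑ i, f i = f 0 + f 1 + f 2 := fun f => Fin.sum_univ_three f
  push_cast at hsq
  simp only [Fintype.sum_prod_type, hu3] at hsq
  have hl' : ∀ p p' d, d ≠ 0 → ∑ t, (a t : ZMod 3) * (((lind p d - lind p' d) t : ℤ) : ZMod 3) = 0 := by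
    intro p p' d hd
    have := hline p p' d hd
    push_cast at this
    exact_mod_cast this
  have key : ∀ p p' d, d ≠ 0 → ∀ r : ZMod 3, ∑ t, (a t : ZMod 3) * (((lind p d - lind p' d) t : ℤ) : ZMod 3) = r → r = 0 :=
    fun p p' d hd r h => h ▸ hl' p p' d hd
  obtain ⟨ε, j, hj⟩ := fin9 (a (0,0)) (a (0,1)) (a (0,2)) (a (1,0)) (a (1,1)) (a (1,2))
    (sub_eq_zero.1 <| key (0,0) (1,0) (0,1) (by decide) _ (lsum (fun t => (a t : ZMod 3)) _ _ _ (by decide))) (a (2,0)) (a (2,1)) (a (2,2))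
    (sub_eq_zero.1 <| key (0,0) (2,0) (0,1) (by decide) _ (lsum (fun t => (a t : ZMod 3)) _ _ _ (by decide)))
    (sub_eq_zero.1 <| key (0,0) (0,1) (1,0) (by decide) _ (lsum (fun t => (a t : ZMod 3)) _ _ _ (by decide)))
    (sub_eq_zero.1 <| key (0,0) (0,2) (1,0) (by decide) _ (lsum (fun t => (a t : ZMod 3)) _ _ _ (by decide)))
    (sub_eq_zero.1 <| key (0,0) (1,0) (1,1) (by decide) _ (lsum (fun t => (a t : ZMod 3)) _ _ _ (by decide)))
    (sub_eq_zero.1 <| key (0,0) (2,0) (1,1) (by decide) _ (lsum (fun t => (a t : ZMod 3)) _ _ _ (by decide)))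
    (sub_eq_zero.1 <| key (0,0) (1,0) (1,2) (by decide) _ (lsum (fun t => (a t : ZMod 3)) _ _ _ (by decide)))
    (sub_eq_zero.1 <| key (0,0) (2,0) (1,2) (by decide) _ (lsum (fun t => (a t : ZMod 3)) _ _ _ (by decide)))
    (by linear_combination hsq)
  have hall : ∀ t : F3, (a t : ZMod 3) = ((a (0,0) : ZMod 3) - ε) + ((a (2,0) : ZMod 3) - a (1,0)) * t.1
      + ((a (0,2) : ZMod 3) - a (0,1)) * t.2 + ε * ind4 j t := by
    obtain ⟨h00, h01, h02, h10, h11, h12, h20, h21, h22⟩ := hj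
    have : ∀ t : F3, t = (0,0) ∨ t = (0,1) ∨ t = (0,2) ∨ t = (1,0) ∨ t = (1,1) ∨ t = (1,2) ∨ t = (2,0) ∨ t = (2,1) ∨ t = (2,2) := by
      decide
    intro t
    rcases this t with rfl|rfl|rfl|rfl|rfl|rfl|rfl|rfl|rfl <;> assumption
  refine ⟨j, ?_⟩
  obtain ⟨E, hE, hE'⟩ : ∃ E : ℤ, (E : ZMod 3) = ε ∧ (E = 0 ∨ E = 1 ∨ E = -1) := by
    clear * -
    revert ε; intro ε
    have : ∀ ε : ZMod 3, ε = 0 ∨ ε = 1 ∨ ε = -1 := by decide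
    rcases this ε with rfl | rfl | rfl
    · exact ⟨0, by simp, by simp⟩
    · exact ⟨1, by simp, by simp⟩
    · exact ⟨-1, by simp, by simp⟩
  have hmem : Qv (a - ((a (0,0) - E) • f1 + (a (2,0) - a (1,0)) • fx + (a (0,2) - a (0,1)) • fy + E • lind 0 (dir4 j))) ∈ Plat := by
    apply Qv_mod
    intro t
    simp only [Pi.sub_apply, Pi.add_apply, Pi.smul_apply, smul_eq_mul]
    push_cast
    rw [f1_mod, fx_mod, fy_mod, lind_mod, hE, hall t]
    ring
  rw [Qv_sub, Qv_add, Qv_add, Qv_add, Qv_smul, Qv_smul, Qv_smul, Qv_smul] at hmem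
  have hmem2 : Qv a - E • Qv (lind 0 (dir4 j)) ∈ Plat := by
    have h2 := Submodule.add_mem _ (Submodule.add_mem _ (Submodule.smul_mem _ (a (0,0) - E) f1_mem)
      (Submodule.smul_mem _ (a (2,0) - a (1,0)) fx_mem)) (Submodule.smul_mem _ (a (0,2) - a (0,1)) fy_mem)
    have := Submodule.add_mem _ hmem h2
    convert this using 1
    abel
  have hmem3 : E • Qv (lind 0 (dir4 j)) ∈ Pt := by
    have := Submodule.sub_mem _ hQ (hP hmem2)
    simpa using this
  rw [eL_eq]
  show Qv (lind 0 (dir4 j)) ∈ Pt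
  rcases hE' with rfl | rfl | rfl
  · simp at hmem2
    exact absurd hmem2 hQ'
  · simpa using hmem3
  · simpa using hmem3
end

section
def dir4b : Fin 4 → F3 := ![(0,1),(1,0),(0,1),(0,1)]
def sg (j : Fin 4) (u : F3) : F3 := u.1 • dir4b j + u.2 • dir4 j

theorem sg_inj : ∀ j u v, sg j u = sg j v → u = v := by decide +kernel
theorem sg_bij (j : Fin 4) : Function.Bijective (sg j) :=
  Finite.injective_iff_bijective.1 fun _ _ h => sg_inj j _ _ h

def gz (c c' : F3 → Fin 2 → ℤ) : ℤ := ∑ u, (2 * c u 0 * c' u 0 + 2 * c u 1 * c' u 1 - c u 0 * c' u 1 - c u 1 * c' u 0)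

theorem BP_sg (j : Fin 4) (x y : VP) (c c' : F3 → Fin 2 → ℤ) (hx : ∀ u k, x (sg j u, k) = c u k / 3)
    (hy : ∀ u k, y (sg j u, k) = c' u k / 3) : BP x y = -(gz c c' : ℚ) / 9 := by
  rw [BP_sparse, ← Equiv.sum_comp (Equiv.ofBijective _ (sg_bij j)), gz]
  push_cast
  rw [← Finset.sum_neg_distrib, Finset.sum_div]
  refine Finset.sum_congr rfl fun u _ => ?_
  simp only [Equiv.ofBijective_apply, hx, hy]
  ring

def z3 : Fin 3 → ZMod 3 := ![0,1,2]

def xs (j : Fin 4) (p : Fin 3 × Fin 6) : VP :=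
  ![Ev (sg j (z3 p.1, 0)) 0, Ev (sg j (z3 p.1, 2)) 1, Ev (sg j (z3 p.1, 0)) 1,
    -eL (lineF (sg j (z3 p.1, 0)) (dir4 j)), Ev (sg j (z3 p.1, 1)) 1, Ev (sg j (z3 p.1, 1)) 0] p.2

def cs (p : Fin 3 × Fin 6) (u : F3) (k : Fin 2) : ℤ :=
  ![if u = (z3 p.1, 0) ∧ k = 0 then 3 else 0, if u = (z3 p.1, 2) ∧ k = 1 then 3 else 0,
    if u = (z3 p.1, 0) ∧ k = 1 then 3 else 0, if u.1 = z3 p.1 then -((k.val : ℤ) + 1) else 0,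
    if u = (z3 p.1, 1) ∧ k = 1 then 3 else 0, if u = (z3 p.1, 1) ∧ k = 0 then 3 else 0] p.2

def gam (j : Fin 4) : VP := eL (lineF 0 (dir4b j)) - eL (lineF (dir4 j) (dir4b j))
def cg (u : F3) (k : Fin 2) : ℤ := (if u.2 = 0 then (k.val : ℤ) + 1 else 0) - (if u.2 = 1 then (k.val : ℤ) + 1 else 0)

theorem line_sg : ∀ j u i, sg j u ∈ lineF (sg j (i, 0)) (dir4 j) ↔ u.1 = i := by decide +kernel
theorem line_sg0 : ∀ j u, sg j u ∈ lineF 0 (dir4b j) ↔ u.2 = 0 := by decide +kernel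
theorem line_sg1 : ∀ j u, sg j u ∈ lineF (dir4 j) (dir4b j) ↔ u.2 = 1 := by decide +kernel

theorem xs_cs (j : Fin 4) (p : Fin 3 × Fin 6) (u : F3) (k : Fin 2) : xs j p (sg j u, k) = (cs p u k : ℚ) / 3 := by
  obtain ⟨i, m⟩ := p
  have hs : ∀ v, sg j u = sg j v ↔ u = v := fun v => ⟨sg_inj j _ _, fun h => h ▸ rfl⟩
  have hE : ∀ v l, Ev (sg j v) l (sg j u, k) = ((if u = v ∧ k = l then 3 else 0 : ℤ) : ℚ) / 3 := by
    intro v l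
    simp only [Ev_apply, hs]
    split_ifs <;> simp
  fin_cases m
  · exact hE _ _
  · exact hE _ _
  · exact hE _ _
  · show (-eL (lineF (sg j (z3 i, 0)) (dir4 j))) (sg j u, k) = ((if u.1 = z3 i then -((k.val : ℤ) + 1) else 0 : ℤ) : ℚ) / 3
    rw [eL_eq, Pi.neg_apply, Qv]
    simp only [line_sg]
    split_ifs <;> simp
    ring
  · exact hE _ _
  · exact hE _ _

theorem gam_cg (j : Fin 4) (u : F3) (k : Fin 2) : gam j (sg j u, k) = (cg u k : ℚ) / 3 := by
  rw [gam, eL_eq, eL_eq, Pi.sub_apply, Qv, Qv, cg]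
  simp only [line_sg0, line_sg1]
  split_ifs <;> push_cast <;> ring

theorem gz_cs : ∀ p q, gz (cs p) (cs q) = 9 * (if p.1 = q.1 then CartanMatrix.E₆ p.2 q.2 else 0) := by decide +kernel

theorem gz_cg : gz (cs (0,0)) cg + 2 * gz (cs (0,2)) cg - gz (cs (0,5)) cg - 2 * gz (cs (0,4)) cg = 36 := by decide +kernel

theorem h_mod : ∀ q : Fin 3 × Fin 6, ∃ n : Fin 7, 
    (if (0 : Fin 3) = q.1 then CartanMatrix.E₆ 0 q.2 else 0) + 2 * (if (0 : Fin 3) = q.1 then CartanMatrix.E₆ 2 q.2 else 0)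
    - (if (0 : Fin 3) = q.1 then CartanMatrix.E₆ 5 q.2 else 0) - 2 * (if (0 : Fin 3) = q.1 then CartanMatrix.E₆ 4 q.2 else 0)
    = 3 * ((n.val : ℤ) - 3) := by decide +kernel

def cf (p : Fin 3 × Fin 6) : ℤ := ![1, 0, 2, 0, -2, -1] p.2

theorem gam3 : ∀ u k, 3 * cg u k = ∑ p, cf p * cs p u k := by decide +kernel

theorem gam3' (j : Fin 4) : (3:ℤ) • gam j = ∑ p, cf p • xs j p := by
  funext ⟨t, k⟩
  obtain ⟨u, rfl⟩ := (sg_bij j).2 t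
  simp only [Pi.smul_apply, Finset.sum_apply, xs_cs, gam_cg]
  simp only [zsmul_eq_mul]
  have := gam3 u k
  have h2 : (3 * cg u k : ℚ) = ∑ p, (cf p : ℚ) * cs p u k := by exact_mod_cast this
  push_cast
  rw [← mul_div_assoc, h2, Finset.sum_div]
  exact Finset.sum_congr rfl fun _ _ => by ring

theorem dir4_ne : ∀ j, dir4 j ≠ 0 := by decide
theorem dir4b_ne : ∀ j, dir4b j ≠ 0 := by decide

theorem step1 {W : Type} [AddCommGroup W] (B : W →ₗ[ℤ] W →ₗ[ℤ] ℤ) (hpos : ∀ v, v ≠ 0 → 0 < B v v)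
    {L : Type} [AddCommGroup L] (ψ : L →ₗ[ℤ] VP) (Ψ : L →ₗ[ℤ] W)
    (hcompat : ∀ a b, (B (Ψ a) (Ψ b) : ℚ) = -BP (ψ a) (ψ b)) (hPlat : Plat ≤ LinearMap.range ψ)
    (hne : ¬ LinearMap.range ψ ≤ Plat) :
    ∃ (e0 : Fin 3 × Fin 6 → W) (g : W),
      (∀ p q : Fin 3 × Fin 6, B (e0 p) (e0 q) = if p.1 = q.1 then CartanMatrix.E₆ p.2 q.2 else 0) ∧
      (3:ℤ) • g ∈ Submodule.span ℤ (Set.range e0) ∧ g ∉ Submodule.span ℤ (Set.range e0) := by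
  obtain ⟨j, hj⟩ := lemA (LinearMap.range ψ) hPlat (by
    rintro _ ⟨a, rfl⟩ _ ⟨b, rfl⟩
    exact ⟨-B (Ψ a) (Ψ b), by push_cast; rw [hcompat]; ring⟩) hne
  have hxs : ∀ p, xs j p ∈ LinearMap.range ψ := by
    rintro ⟨i, m⟩
    fin_cases m
    · exact hPlat (Ev_mem _ _)
    · exact hPlat (Ev_mem _ _)
    · exact hPlat (Ev_mem _ _)
    · have h1 := hPlat (par_mem (sg j (z3 i, 0)) 0 _ (dir4_ne j))
      have h2 := Submodule.add_mem _ h1 hj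
      rw [sub_add_cancel] at h2
      exact Submodule.neg_mem _ h2
    · exact hPlat (Ev_mem _ _)
    · exact hPlat (Ev_mem _ _)
  choose a ha using hxs
  obtain ⟨ag, hag⟩ : gam j ∈ LinearMap.range ψ := hPlat (par_mem _ _ _ (dir4b_ne j))
  have hgram : ∀ p q : Fin 3 × Fin 6, B (Ψ (a p)) (Ψ (a q)) = if p.1 = q.1 then CartanMatrix.E₆ p.2 q.2 else 0 := by
    intro p q
    have h := hcompat (a p) (a q)
    rw [ha, ha, BP_sg j _ _ _ _ (xs_cs j p) (xs_cs j q), gz_cs] at h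
    have h' : (B (Ψ (a p)) (Ψ (a q)) : ℚ) = ((if p.1 = q.1 then CartanMatrix.E₆ p.2 q.2 else 0 : ℤ) : ℚ) := by
      rw [h]; push_cast; ring
    exact_mod_cast h'
  have hgg : ∀ p, (B (Ψ (a p)) (Ψ ag) : ℚ) = (gz (cs p) cg : ℚ) / 9 := by
    intro p
    rw [hcompat, ha, hag, BP_sg j _ _ _ _ (xs_cs j p) (gam_cg j)]
    ring
  refine ⟨fun p => Ψ (a p), Ψ ag, hgram, ?_, ?_⟩
  · have h0 : ψ ((3:ℤ) • ag - ∑ p, cf p • a p) = 0 := by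
      rw [map_sub, map_smul, map_sum, hag, gam3']
      simp only [map_smul, ha, sub_self]
    have h1 : Ψ ((3:ℤ) • ag - ∑ p, cf p • a p) = 0 := by
      by_contra hc
      have h2 := hpos _ hc
      have h3 := hcompat ((3:ℤ) • ag - ∑ p, cf p • a p) ((3:ℤ) • ag - ∑ p, cf p • a p)
      rw [h0, BP_zero_left, neg_zero] at h3
      have h4 : B (Ψ ((3:ℤ) • ag - ∑ p, cf p • a p)) (Ψ ((3:ℤ) • ag - ∑ p, cf p • a p)) = 0 := by exact_mod_cast h3
      omega
    rw [map_sub, map_smul, map_sum, sub_eq_zero] at h1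
    rw [h1]
    simp only [map_smul]
    exact Submodule.sum_mem _ fun p _ => Submodule.smul_mem _ _ (Submodule.subset_span ⟨p, rfl⟩)
  · intro hmem
    set h := Ψ (a (0,0)) + (2:ℤ) • Ψ (a (0,2)) - Ψ (a (0,5)) - (2:ℤ) • Ψ (a (0,4)) with hh
    have hsp : ∀ x ∈ Submodule.span ℤ (Set.range fun p => Ψ (a p)), ∃ n, B h x = 3 * n := by
      intro x hx
      induction hx using Submodule.span_induction with
      | mem x hx =>
        obtain ⟨q, rfl⟩ := hx
        obtain ⟨n, hn⟩ := h_mod q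
        refine ⟨(n.val : ℤ) - 3, ?_⟩
        rw [hh]
        simp only [map_add, map_sub, map_smul, LinearMap.add_apply, LinearMap.sub_apply, LinearMap.smul_apply, hgram, smul_eq_mul]
        exact hn
      | zero => exact ⟨0, by simp⟩
      | add x y _ _ hx hy =>
        obtain ⟨n, hn⟩ := hx
        obtain ⟨m, hm⟩ := hy
        exact ⟨n + m, by rw [map_add, hn, hm]; ring⟩
      | smul c x _ hx =>
        obtain ⟨n, hn⟩ := hx
        exact ⟨c * n, by rw [map_smul, hn, smul_eq_mul]; ring⟩
    obtain ⟨n, hn⟩ := hsp _ hmem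
    have h4 : (B h (Ψ ag) : ℚ) = 4 := by
      rw [hh]
      simp only [map_add, map_sub, map_smul, LinearMap.add_apply, LinearMap.sub_apply, LinearMap.smul_apply, smul_eq_mul]
      push_cast
      rw [hgg, hgg, hgg, hgg]
      have : (gz (cs (0,0)) cg + 2 * gz (cs (0,2)) cg - gz (cs (0,5)) cg - 2 * gz (cs (0,4)) cg : ℚ) = 36 := by
        exact_mod_cast gz_cg
      linarith
    have h5 : B h (Ψ ag) = 4 := by exact_mod_cast h4
    omega
end

section
open Matrix

theorem BP_comm' (x y : VP) : BP x y = BP y x := by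
  rw [BP_sparse, BP_sparse]
  exact Finset.sum_congr rfl fun _ _ => by ring

theorem BP_zsmul_right (c : ℤ) (a x : VP) : BP a (c • x) = c * BP a x := by
  rw [BP_comm', BP_zsmul_left, BP_comm']

theorem part1 (A : Matrix (Fin 24) (Fin 24) ℤ)
    (hs : ∀ i j, A i j = A j i)
    (hev : ∀ v : Fin 24 → ℤ, ∃ n : ℤ, v ⬝ᵥ A.mulVec v = 2 * n)
    (hdet : A.det = 1 ∨ A.det = -1)
    (hpos : ∀ v : Fin 24 → ℤ, v ≠ 0 → 0 < v ⬝ᵥ A.mulVec v)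
    (φ : Plat →ₗ[ℤ] (Fin 24 → ℤ))
    (hφ : ∀ x y : Plat, ((φ x ⬝ᵥ A.mulVec (φ y) : ℤ) : ℚ) = -BP (x : VP) (y : VP))
    (hnp : ∃ (v : Fin 24 → ℤ) (n : ℤ), n ≠ 0 ∧ n • v ∈ LinearMap.range φ ∧
          v ∉ LinearMap.range φ) :
    ∃ e : Fin 4 × Fin 6 → (Fin 24 → ℤ),
          LinearIndependent ℤ e ∧
          Submodule.span ℤ {v : Fin 24 → ℤ | v ⬝ᵥ A.mulVec v = 2} =
            Submodule.span ℤ (Set.range e) ∧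
          (∀ p q : Fin 4 × Fin 6,
            e p ⬝ᵥ A.mulVec (e q) = if p.1 = q.1 then CartanMatrix.E₆ p.2 q.2 else 0) := by
  obtain ⟨v, n, hn, ⟨y, hy⟩, hv⟩ := hnp
  set B : (Fin 24 → ℤ) →ₗ[ℤ] (Fin 24 → ℤ) →ₗ[ℤ] ℤ := Matrix.toLinearMap₂' ℤ A with hB
  have hBa : ∀ x z, B x z = x ⬝ᵥ A *ᵥ z := fun x z => Matrix.toLinearMap₂'_apply' A x z
  have hsym : ∀ x z, B x z = B z x := by
    intro x z
    have hT : Aᵀ = A := by ext i j; exact hs j i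
    rw [hBa, hBa, dotProduct_mulVec, dotProduct_comm, ← mulVec_transpose, hT]
  have hnq : (n:ℚ) ≠ 0 := by exact_mod_cast hn
  set x0 : VP := (n:ℚ)⁻¹ • (y : VP) with hx0
  have hnx0 : n • x0 = (y : VP) := by
    rw [hx0, ← Int.cast_smul_eq_zsmul ℚ, smul_smul, mul_inv_cancel₀ hnq, one_smul]
  let ψ : (Plat × ℤ) →ₗ[ℤ] VP := LinearMap.coprod Plat.subtype (LinearMap.toSpanSingleton ℤ VP x0)
  let Ψ : (Plat × ℤ) →ₗ[ℤ] (Fin 24 → ℤ) := LinearMap.coprod φ (LinearMap.toSpanSingleton ℤ _ v)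
  have hψ : ∀ a, ψ a = a.1 + a.2 • x0 := fun a => rfl
  have hΨ : ∀ a, Ψ a = φ a.1 + a.2 • v := fun a => rfl
  have h1 : ∀ a : Plat × ℤ, ((n • a.1 + a.2 • y : Plat) : VP) = n • ψ a := by
    intro a
    rw [hψ, smul_add, smul_comm, hnx0]; rfl
  have h2 : ∀ a : Plat × ℤ, φ (n • a.1 + a.2 • y : Plat) = n • Ψ a := by
    intro a
    rw [hΨ, smul_add, smul_comm, ← hy, map_add, map_smul, map_smul]
  have hcompat : ∀ a b, (B (Ψ a) (Ψ b) : ℚ) = -BP (ψ a) (ψ b) := by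
    intro a b
    have h := hφ (n • a.1 + a.2 • y) (n • b.1 + b.2 • y)
    rw [h1, h1, h2, h2, ← hBa, BP_zsmul_left, BP_zsmul_right, map_smul, map_smul, LinearMap.smul_apply] at h
    simp only [smul_eq_mul] at h
    push_cast at h
    have : (n:ℚ) * n * (B (Ψ a) (Ψ b) + BP (ψ a) (ψ b)) = 0 := by linear_combination h
    have := (mul_eq_zero.1 this).resolve_left (mul_ne_zero hnq hnq)
    linarith
  obtain ⟨e0, g, hG, hg3, hg⟩ := step1 B (fun w hw => by rw [hBa]; exact hpos w hw) ψ Ψ hcompat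
    (fun p hp => ⟨(⟨p, hp⟩, 0), by rw [hψ]; simp⟩) (by
      intro hle
      have hx : x0 ∈ Plat := hle ⟨(0, 1), by rw [hψ]; simp⟩
      apply hv
      refine ⟨⟨x0, hx⟩, ?_⟩
      have h3 : n • (⟨x0, hx⟩ : Plat) = y := Subtype.ext hnx0
      have h4 : n • φ ⟨x0, hx⟩ = n • v := by rw [← map_smul, h3, hy]
      exact smul_right_injective _ hn h4)
  have hu : IsUnit A.det := by rcases hdet with h | h <;> rw [h] <;> simp
  obtain ⟨e, he⟩ := complement (Pi.basisFun ℤ (Fin 24)) B hsym (fun w => by rw [hBa]; exact hev w)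
    (fun w hw => by rw [hBa]; exact hpos w hw) (fun l => by
      refine ⟨A⁻¹ *ᵥ (fun j => l (Pi.single j 1)), fun w => ?_⟩
      rw [hsym, hBa, mulVec_mulVec, Matrix.mul_nonsing_inv _ hu, one_mulVec]
      rw [LinearMap.pi_apply_eq_sum_univ l w]
      refine Finset.sum_congr rfl fun i _ => ?_
      rw [smul_eq_mul]
      refine congrArg (fun z => w i * l z) ?_
      ext j
      simp [Pi.single_apply, eq_comm]) e0 hG g hg3 hg
  refine ⟨e, li_of_gram B e he, ?_, fun p q => by rw [← hBa, he]⟩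
  have := finish_roots (by simp) B hsym (fun w hw => by rw [hBa]; exact hpos w hw) e he
  simpa only [hBa] using this
end

section
open Matrix

def tab (n k : ℕ) : ℤ := ((n / 100 ^ k % 100 : ℕ) : ℤ) - 50

def XA : Matrix (Fin 24) (Fin 24) ℤ := fun i j => tab 525050505050505050505050535050505050515049515149505250505050505050505050505350505050515051494951505052505050505050505050505050505050515050505050505050525050505050505050505053505050505151495149505050505250505050505050505050535050505149514951505050505052505050505050505050505050505150505050505050505050525050505050505050505350505049495050505050505050505250505050505050505050505051505050505050505050505052505050505050505050505050515050505050505050505050525050505050505053505050504949505050505050505050505250505050505050505050505150505050505050505050505052505050505050505050505051535050505050505050505050565050505050525048525248505350505050505050505050505650505050525052484852505050535050505050505050505056505050505252485248505050505350505050505050505050565050505248524852505050505050535050505050505050505650505048485050505050505050505050535050505050505056505050504848515151505050505050505050525250505050525050505050505050515151505050505050505052525050505250505050495150514950495150505050485252484850505054485050514950495150495051505050524848524850505048545050514950514950505050495150524852485048505050505448495150495150505050495051485248525048505050504854 (24 * i.val + j.val)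

def XI : Matrix (Fin 24) (Fin 24) ℤ := fun i j => tab 525050505050505050505050495050505050505050505050505250505050505050505050504950505050505050505050505052505050505050505050515150505050475050505050505050525050505050505050505049505050505050505050505050505250505050505050505050495050505050505050505050505052505050505050505051515050504750505050505050505050525050505050505050504950505050505050505050505050505250505050495151494950505047505050505050505050505052505050514949514950505050475050505050505050505050525050505050505049505050505050505050505050505050505250514951495049505050504750505050505050505050505052495149515049505050505047495051505050504951505149544850505050485052484852504951505050505149504951485450505050485048525248505050495051505149505149505054485050504848524852505050504951504951504951505048545050504852485248505050505050494949505050505050505250505052525050505050505050505050494949505050505052505050505252505047505050505050505050484850505050565050505050505050505047505050505050505048485050505650505050505050505050504750505050524848525250505056505050505050505050505047505050485252485250505050565050505050505050505050504750485248525052505050505650505050505050505050505047524852485052505050505056 (24 * i.val + j.val)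

def XN : Matrix (Fin 24) (Fin 24) ℤ := fun i j => tab 525050505050505050505050535050505050515049515149505250505050505050505050505350505050515051494951505052505050505050505050505050505050515050505050505050525050505050505050505053505050505151495149505050505250505050505050505050535050505149514951505050505052505050505050505050505050505150505050505050505050525050505050505050505350505049495050505050505050505250505050505050505050505051505050505050505050505052505050505050505050505050515050505050505050505050525050505050505053505050504949505050505050505050505250505050505050505050505150505050505050505050505052505050505050505050505051505050505050505050505050535050505050515049515149505050505050505050505050505350505050515051494951505050505050505050505050505050505050515050505050505050505050505050505050505053505050505151495149505050505050505050505050505050535050505149514951505050505050505050505050505050505050505150505050505050505050505050505050505050505350505049495050505050505050505050505050505050505050505051505050505050505050505050505050505050505050505050515050505050505050505050505050505050505053505050504949505050505050505050505050505050505050505050505150505050505050505050505050505050505050505050505051 (24 * i.val + j.val)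

def XD : Fin 24 → ℤ := fun i => tab 535353535353535353535353515151515151515151515151 i.val

def XM0 : Matrix (Fin 24) (Fin 9) ℤ := fun i j => tab 505050505050505050505050505050505050505050505050505050485050505050505050504850505050505050505048505050505050505050485050505050505050504850505050505050505048505050505050505050485050505050505050504850505050505050505048505050505149504951505050504951505149515049504951504951505149505149505149505050515151505050505050505050515151505050505050505050505053505050505050505050505350505050505050505053505050505050505050505350505050505050505053 (9 * i.val + j.val)

def XM1 : Matrix (Fin 24) (Fin 9) ℤ := fun i j => tab 505050505050505050505050505050505050505050505050505050515050505050505050505150505050505050505051505050505050505050515050505050505050505150505050505050505051505050505050505050515050505050505050505150505050505050505051505050505050505050505050505050505050505050505050505050505050505050505050505050505050505050505050505050505050505050505050505050505050505050505050505050505050505050505050505050505050505050505050505050505050505050505050 (9 * i.val + j.val)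

def Xv : Fin 24 → ℤ := fun i => tab 505050505050505050505050505050505051505050505151 i.val

def Xr : Fin 24 → ℤ := fun i => tab 505050505050505050505050505050505050505150515051 i.val

def ix (t : F3) : Fin 9 := ⟨(3 * t.1.val + t.2.val) % 9, Nat.mod_lt _ (by decide)⟩

def XM : Matrix (Fin 24) IP ℤ := fun i q => if q.2 = 0 then XM0 i (ix q.1) else XM1 i (ix q.1)

def GZ : Matrix IP IP ℤ := fun i j => if i.1 = j.1 then (if i.2 = j.2 then -2 else 1) else 0

set_option maxRecDepth 100000

theorem XA_symm0 : ∀ p : Fin 24 × Fin 24, XA p.1 p.2 - XA p.2 p.1 = 0 := by decide +kernel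
theorem XA_symm (i j) : XA i j = XA j i := sub_eq_zero.1 (XA_symm0 (i, j))
theorem XA_inv : ∀ i j, (XI * XA) i j = if i = j then 1 else 0 := by decide +kernel
theorem XA_N : ∀ i j, (XNᵀ * (Matrix.of fun i j => XD i * XN i j)) i j = 6 * XA i j := by decide +kernel
def jx (t : F3) : Fin 24 := ⟨(12 + (3 * t.1.val + t.2.val)) % 24, Nat.mod_lt _ (by decide)⟩
def XP : Matrix (Fin 24) IP ℤ := fun i q => if q.2 = 1 then XA i (jx q.1) else if i = jx q.1 then -1 else 0
theorem XA_P : ∀ i j, (XA * XM) i j - XP i j = 0 := by decide +kernel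
theorem XP_M : ∀ i j, (XMᵀ * XP) i j = - GZ i j := by decide +kernel
theorem XA_M : XMᵀ * (XA * XM) = - GZ := by
  have h : XA * XM = XP := by ext i j; exact sub_eq_zero.1 (XA_P i j)
  rw [h]; ext i j; exact XP_M i j
theorem XA_diag : ∀ i, XA i i = 2 * (XA i i / 2) := by decide +kernel
theorem XD_pos : ∀ i, 0 < XD i := by decide +kernel
theorem Xr_M : ∀ t : F3, ∀ k : Fin 2, (Xr ᵥ* XM) (t, k) = if t.2 = 0 ∧ k = 0 then 3 else 0 := by decide +kernel
theorem Xr_v : Xr ⬝ᵥ Xv = 1 := by decide +kernel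
def Xc : IP → ℤ := fun q => if q.1.1 = 0 then (q.2.val : ℤ) + 1 else 0
theorem XM_c : ∀ i, (XM *ᵥ Xc) i = 3 * Xv i := by decide +kernel
def Xm (i : Fin 24) (t : F3) : ℤ := XM i (t, 0) + 2 * XM i (t, 1)
theorem Xm_par : ∀ i p d, d ≠ 0 → ((∑ s : ZMod 3, Xm i (p + s • d)) - ∑ s : ZMod 3, Xm i (s • d)) % 3 = 0 := by decide +kernel
theorem Xl_par : ∀ p d : F3, d ≠ 0 → ((∑ s : ZMod 3, if (p + s • d).2 = 0 then (1:ℤ) else 0) - ∑ s : ZMod 3, if (s • d).2 = 0 then (1:ℤ) else 0) % 3 = 0 := by decide +kernel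
end

section
open Matrix

theorem XA_inv' : XI * XA = 1 := by
  ext i j
  rw [XA_inv, Matrix.one_apply]

theorem XA_det : XA.det = 1 ∨ XA.det = -1 := by
  have h : XI.det * XA.det = 1 := by rw [← Matrix.det_mul, XA_inv', Matrix.det_one]
  exact Int.isUnit_iff.1 (IsUnit.of_mul_eq_one_right _ h)

theorem XA_pos (v : Fin 24 → ℤ) (hv : v ≠ 0) : 0 < v ⬝ᵥ XA *ᵥ v := by
  have hN : XNᵀ * (Matrix.of fun i j => XD i * XN i j) = (6:ℤ) • XA := by
    ext i j; rw [XA_N]; rfl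
  have h6 : 6 * (v ⬝ᵥ XA *ᵥ v) = ∑ i, XD i * (XN *ᵥ v) i ^ 2 := by
    have : (6:ℤ) * (v ⬝ᵥ XA *ᵥ v) = v ⬝ᵥ ((6:ℤ) • XA) *ᵥ v := by
      rw [smul_mulVec, dotProduct_smul, smul_eq_mul]
    rw [this, ← hN, ← mulVec_mulVec, dotProduct_mulVec, vecMul_transpose]
    refine Finset.sum_congr rfl fun i _ => ?_
    have : ((Matrix.of fun i j => XD i * XN i j) *ᵥ v) i = XD i * (XN *ᵥ v) i := by
      simp only [mulVec, dotProduct, Matrix.of_apply, Finset.mul_sum, mul_assoc]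
    rw [this]; ring
  by_contra hc
  apply hv
  have h0 : ∀ i ∈ Finset.univ, 0 ≤ XD i * (XN *ᵥ v) i ^ 2 := fun i _ => mul_nonneg (XD_pos i).le (sq_nonneg _)
  have hz : ∑ i, XD i * (XN *ᵥ v) i ^ 2 = 0 := le_antisymm (by rw [← h6]; omega) (Finset.sum_nonneg h0)
  have hz' : ∀ i, (XN *ᵥ v) i = 0 := by
    intro i
    have := (Finset.sum_eq_zero_iff_of_nonneg h0).1 hz i (Finset.mem_univ i)
    exact pow_eq_zero_iff (two_ne_zero) |>.1 ((mul_eq_zero.1 this).resolve_left (XD_pos i).ne')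
  have h1 : ((6:ℤ) • XA) *ᵥ v = 0 := by
    rw [← hN, ← mulVec_mulVec]
    have : (Matrix.of fun i j => XD i * XN i j) *ᵥ v = 0 := by
      ext i
      have : ((Matrix.of fun i j => XD i * XN i j) *ᵥ v) i = XD i * (XN *ᵥ v) i := by
        simp only [mulVec, dotProduct, Matrix.of_apply, Finset.mul_sum, mul_assoc]
      rw [this, hz', mul_zero]; rfl
    rw [this, mulVec_zero]
  rw [smul_mulVec] at h1
  have h2 : XA *ᵥ v = 0 := (smul_eq_zero.1 h1).resolve_left (by norm_num)
  rw [← one_mulVec v, ← XA_inv', ← mulVec_mulVec, h2, mulVec_zero]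

theorem XA_even (v : Fin 24 → ℤ) : ∃ n : ℤ, v ⬝ᵥ XA *ᵥ v = 2 * n := by
  let U : Matrix (Fin 24) (Fin 24) ℤ := fun i j => if i < j then XA i j else if i = j then XA i i / 2 else 0
  have hU : XA = U + Uᵀ := by
    ext i j
    show XA i j = (if i < j then XA i j else if i = j then XA i i / 2 else 0) + (if j < i then XA j i else if j = i then XA j j / 2 else 0)
    rcases lt_trichotomy i j with h | h | h
    · rw [if_pos h, if_neg h.not_gt, if_neg h.ne', add_zero]
    · subst h
      have := XA_diag i
      simp only [lt_irrefl, if_false, if_true]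
      omega
    · rw [if_neg h.not_gt, if_neg h.ne', if_pos h, zero_add, XA_symm]
  refine ⟨v ⬝ᵥ U *ᵥ v, ?_⟩
  conv_lhs => rw [hU, add_mulVec, dotProduct_add]
  have : v ⬝ᵥ Uᵀ *ᵥ v = v ⬝ᵥ U *ᵥ v := by
    rw [mulVec_transpose, dotProduct_comm, ← dotProduct_mulVec]
  rw [this]; ring

def XMq : Matrix (Fin 24) IP ℚ := XM.map (fun z : ℤ => (z : ℚ))
def XAq : Matrix (Fin 24) (Fin 24) ℚ := XA.map (fun z : ℤ => (z : ℚ))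

theorem castMV {m n : Type} [Fintype m] [Fintype n] (M : Matrix m n ℤ) (v : n → ℤ) (i : m) :
    (((M *ᵥ v) i : ℤ) : ℚ) = ((M.map (fun z : ℤ => (z : ℚ))) *ᵥ (fun j => (v j : ℚ))) i := by
  simp [mulVec, dotProduct]

theorem XMq_form (x y : VP) : (XMq *ᵥ x) ⬝ᵥ XAq *ᵥ (XMq *ᵥ y) = - BP x y := by
  have h : XMqᵀ * (XAq * XMq) = - (GZ.map (fun z : ℤ => (z : ℚ))) := by
    have h1 := congrArg (fun M => M.map (Int.castRingHom ℚ)) XA_M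
    simp only [Matrix.map_mul] at h1
    ext i j
    have h2 := congrFun (congrFun h1 i) j
    rw [show XMqᵀ * (XAq * XMq) = XMᵀ.map (Int.castRingHom ℚ) * (XA.map (Int.castRingHom ℚ) * XM.map (Int.castRingHom ℚ)) from rfl, h2]
    simp
  rw [mulVec_mulVec, dotProduct_comm, dotProduct_mulVec, ← mulVec_transpose, mulVec_mulVec, h, neg_mulVec,
    neg_dotProduct, dotProduct_comm, BP]
  congr 1
  simp only [mulVec, dotProduct, Finset.mul_sum]
  refine Finset.sum_congr rfl fun i _ => Finset.sum_congr rfl fun j _ => ?_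
  rw [GP, Matrix.map_apply, GZ]
  push_cast
  ring

theorem eL_line (p d : F3) (hd : d ≠ 0) (f : VP →ₗ[ℚ] ℚ) :
    f (eL (lineF p d)) = (∑ s : ZMod 3, f (EV (p + s • d))) / 3 := by
  have hinj : ∀ d : F3, d ≠ 0 → ∀ s s' : ZMod 3, s • d = s' • d → s = s' := by decide +kernel
  rw [eL, lineF, Finset.sum_image (fun a _ b _ h => hinj d hd _ _ (add_left_cancel h)), map_smul, map_sum, smul_eq_mul]
  ring

theorem int_of_gen (f : VP →ₗ[ℚ] ℚ) (m : IP → ℤ) (hf : ∀ t k, f (Ev t k) = m (t, k))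
    (hm : ∀ p d : F3, d ≠ 0 → ((∑ s : ZMod 3, (m (p + s • d, 0) + 2 * m (p + s • d, 1)))
      - ∑ s : ZMod 3, (m (s • d, 0) + 2 * m (s • d, 1))) % 3 = 0) (x : VP) (hx : x ∈ Plat) :
    ∃ n : ℤ, f x = n := by
  induction hx using Submodule.span_induction with
  | mem x hx =>
    rcases hx with ⟨t, k, rfl⟩ | ⟨L, L', ⟨p, p', d, hd, rfl, rfl⟩, rfl⟩
    · exact ⟨_, hf t k⟩
    · have hE : ∀ t, f (EV t) = ((m (t, 0) + 2 * m (t, 1) : ℤ) : ℚ) := by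
        intro t
        rw [EV, map_add, map_nsmul, hf, hf]; simp
      have hL : ∀ p, f (eL (lineF p d)) = ((∑ s : ZMod 3, (m (p + s • d, 0) + 2 * m (p + s • d, 1)) : ℤ) : ℚ) / 3 := by
        intro p
        rw [eL_line _ _ hd]
        simp only [hE]
        rw [Int.cast_sum]
      rw [map_sub, hL, hL]
      have h1 := hm p d hd
      have h2 := hm p' d hd
      obtain ⟨n, hn⟩ : (3:ℤ) ∣ (∑ s : ZMod 3, (m (p + s • d, 0) + 2 * m (p + s • d, 1))) - ∑ s : ZMod 3, (m (p' + s • d, 0) + 2 * m (p' + s • d, 1)) := by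
        omega
      refine ⟨n, ?_⟩
      rw [← sub_div, ← Int.cast_sub, hn]
      push_cast; ring
  | zero => exact ⟨0, by simp⟩
  | add x y _ _ hx hy =>
    obtain ⟨a, ha⟩ := hx
    obtain ⟨b, hb⟩ := hy
    exact ⟨a + b, by rw [map_add, ha, hb]; push_cast; ring⟩
  | smul c x _ hx =>
    obtain ⟨a, ha⟩ := hx
    exact ⟨c * a, by rw [map_zsmul, ha]; simp⟩

theorem XMq_Ev (i : Fin 24) (t : F3) (k : Fin 2) : (XMq *ᵥ Ev t k) i = XM i (t, k) := by
  rw [Ev, mulVec_single_one]; rfl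

theorem XMq_int (x : Plat) : ∃ v : Fin 24 → ℤ, ∀ i, (XMq *ᵥ (x : VP)) i = v i := by
  choose v hv using fun i => int_of_gen (LinearMap.proj i ∘ₗ Matrix.mulVecLin XMq) (fun q => XM i q)
    (fun t k => XMq_Ev i t k) (fun p d hd => Xm_par i p d hd) x x.2
  exact ⟨v, hv⟩

theorem Xl_int (x : VP) (hx : x ∈ Plat) : ∃ n : ℤ, ∑ t : F3, (if t.2 = 0 then x (t, 0) else 0) = n := by
  obtain ⟨n, hn⟩ := int_of_gen (∑ t : F3, if t.2 = 0 then LinearMap.proj (t, 0) else 0) 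
    (fun q => if q.1.2 = 0 ∧ q.2 = 0 then 1 else 0) (by
      intro t k
      rw [LinearMap.sum_apply, Finset.sum_eq_single t]
      · by_cases h : t.2 = 0
        · rw [if_pos h, LinearMap.proj_apply, Ev_apply]
          simp [h, eq_comm]
        · rw [if_neg h]; simp [h]
      · intro b _ hb
        split_ifs
        · rw [LinearMap.proj_apply, Ev_apply]; simp [hb]
        · rfl
      · simp) (by
      intro p d hd
      have := Xl_par p d hd
      simpa using this) x hx
  refine ⟨n, ?_⟩
  rw [← hn, LinearMap.sum_apply]
  refine Finset.sum_congr rfl fun t _ => ?_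
  split_ifs <;> rfl

theorem existence : ∃ A : Matrix (Fin 24) (Fin 24) ℤ,
      (∀ i j, A i j = A j i) ∧
      (∀ v : Fin 24 → ℤ, ∃ n : ℤ, v ⬝ᵥ A.mulVec v = 2 * n) ∧
      (A.det = 1 ∨ A.det = -1) ∧
      (∀ v : Fin 24 → ℤ, v ≠ 0 → 0 < v ⬝ᵥ A.mulVec v) ∧
      ∃ φ : Plat →ₗ[ℤ] (Fin 24 → ℤ),
        Function.Injective φ ∧
        (∀ x y : Plat, ((φ x ⬝ᵥ A.mulVec (φ y) : ℤ) : ℚ) = -BP (x : VP) (y : VP)) ∧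
        (∃ (v : Fin 24 → ℤ) (n : ℤ), n ≠ 0 ∧ n • v ∈ LinearMap.range φ ∧
          v ∉ LinearMap.range φ) := by
  refine ⟨XA, XA_symm, XA_even, XA_det, XA_pos, ?_⟩
  choose f hf using XMq_int
  let φ : Plat →ₗ[ℤ] (Fin 24 → ℤ) :=
    { toFun := f
      map_add' := by
        intro x y
        ext i
        have : ((f (x + y) i : ℤ) : ℚ) = ((f x i + f y i : ℤ) : ℚ) := by
          push_cast
          rw [← hf, ← hf, ← hf, Submodule.coe_add, mulVec_add]; rfl
        exact_mod_cast this
      map_smul' := by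
        intro c x
        ext i
        have : ((f (c • x) i : ℤ) : ℚ) = ((c * f x i : ℤ) : ℚ) := by
          push_cast
          rw [← hf, ← hf, Submodule.coe_smul, mulVec_smul, Pi.smul_apply, zsmul_eq_mul]
        exact_mod_cast this }
  have hφ : ∀ (x : Plat) i, (XMq *ᵥ (x : VP)) i = φ x i := hf
  have hform : ∀ x y : Plat, ((φ x ⬝ᵥ XA.mulVec (φ y) : ℤ) : ℚ) = -BP (x : VP) (y : VP) := by
    intro x y
    rw [← XMq_form, dotProduct, dotProduct, Int.cast_sum]
    refine Finset.sum_congr rfl fun i _ => ?_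
    rw [hφ, Int.cast_mul, castMV]
    have : XMq *ᵥ (y : VP) = fun j => (φ y j : ℚ) := funext (hφ y)
    rw [this]; rfl
  refine ⟨φ, ?_, hform, Xv, 3, by norm_num, ?_, ?_⟩
  · rw [injective_iff_map_eq_zero]
    intro x hx
    have h := hform x x
    rw [hx, BP_sparse] at h
    simp only [zero_dotProduct, Int.cast_zero] at h
    have h2 : ∑ t : F3, ((x : VP) (t, 0) ^ 2 + (x : VP) (t, 1) ^ 2 + ((x : VP) (t, 0) - (x : VP) (t, 1)) ^ 2) = 0 := by
      rw [h, ← Finset.sum_neg_distrib]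
      exact Finset.sum_congr rfl fun _ _ => by ring
    have h3 := (Finset.sum_eq_zero_iff_of_nonneg (fun t _ => by positivity)).1 h2
    ext ⟨t, k⟩
    have h4 := h3 t (Finset.mem_univ t)
    have a0 : (x : VP) (t, 0) ^ 2 = 0 := by nlinarith [sq_nonneg ((x : VP) (t, 0)), sq_nonneg ((x : VP) (t, 1)), sq_nonneg ((x : VP) (t, 0) - (x : VP) (t, 1))]
    have a1 : (x : VP) (t, 1) ^ 2 = 0 := by nlinarith [sq_nonneg ((x : VP) (t, 0)), sq_nonneg ((x : VP) (t, 1)), sq_nonneg ((x : VP) (t, 0) - (x : VP) (t, 1))]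
    fin_cases k
    · exact pow_eq_zero_iff two_ne_zero |>.1 a0
    · exact pow_eq_zero_iff two_ne_zero |>.1 a1
  · have hc : (fun q => (Xc q : ℚ)) ∈ Plat := int_mem _ fun q => ⟨Xc q, rfl⟩
    refine ⟨⟨_, hc⟩, ?_⟩
    ext i
    have h1 := hφ ⟨_, hc⟩ i
    have h2 := castMV XM Xc i
    rw [XM_c] at h2
    have h3 : ((3 * Xv i : ℤ) : ℚ) = (φ ⟨_, hc⟩ i : ℤ) := by rw [h2]; exact h1
    have h4 : 3 * Xv i = φ ⟨_, hc⟩ i := by exact_mod_cast h3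
    rw [← h4]; rfl
  · rintro ⟨x, hx⟩
    obtain ⟨n, hn⟩ := Xl_int x x.2
    have h1 : ((Xr ⬝ᵥ φ x : ℤ) : ℚ) = 3 * n := by
      rw [← hn, Finset.mul_sum]
      have : ((Xr ⬝ᵥ φ x : ℤ) : ℚ) = (fun i => (Xr i : ℚ)) ⬝ᵥ XMq *ᵥ (x : VP) := by
        simp only [dotProduct, hφ]; push_cast; rfl
      rw [this, dotProduct_mulVec]
      have hv : ∀ q, ((fun i => (Xr i : ℚ)) ᵥ* XMq) q = (((Xr ᵥ* XM) q : ℤ) : ℚ) := by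
        intro q; simp [vecMul, dotProduct, XMq]
      simp only [dotProduct, hv]
      rw [Fintype.sum_prod_type]
      refine Finset.sum_congr rfl fun t _ => ?_
      rw [Fin.sum_univ_two, Xr_M, Xr_M]
      by_cases h : t.2 = 0 <;> simp [h]
    rw [hx, Xr_v] at h1
    have h5 : (1:ℤ) = 3 * n := by exact_mod_cast h1
    omega
end

open Matrix in
theorem statement12 :
    -- If Γ is an even unimodular positive definite lattice of rank 24 (presented as ℤ²⁴ with
    -- Gram matrix A) containing a non-primitive sublattice isometric to P(−1), then the
    -- sublattice of Γ generated by its roots is isometric to the orthogonal direct sum of four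
    -- copies of the E₆ root lattice.
    (∀ (A : Matrix (Fin 24) (Fin 24) ℤ),
      (∀ i j, A i j = A j i) →
      (∀ v : Fin 24 → ℤ, ∃ n : ℤ, v ⬝ᵥ A.mulVec v = 2 * n) →
      (A.det = 1 ∨ A.det = -1) →
      (∀ v : Fin 24 → ℤ, v ≠ 0 → 0 < v ⬝ᵥ A.mulVec v) →
      ∀ φ : Plat →ₗ[ℤ] (Fin 24 → ℤ),
        Function.Injective φ →
        (∀ x y : Plat, ((φ x ⬝ᵥ A.mulVec (φ y) : ℤ) : ℚ) = -BP (x : VP) (y : VP)) →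
        -- the image of φ is NOT primitive
        (∃ (v : Fin 24 → ℤ) (n : ℤ), n ≠ 0 ∧ n • v ∈ LinearMap.range φ ∧
          v ∉ LinearMap.range φ) →
        ∃ e : Fin 4 × Fin 6 → (Fin 24 → ℤ),
          LinearIndependent ℤ e ∧
          Submodule.span ℤ {v : Fin 24 → ℤ | v ⬝ᵥ A.mulVec v = 2} =
            Submodule.span ℤ (Set.range e) ∧
          (∀ p q : Fin 4 × Fin 6,
            e p ⬝ᵥ A.mulVec (e q) = if p.1 = q.1 then CartanMatrix.E₆ p.2 q.2 else 0)) ∧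
    -- Moreover, such a configuration exists.
    (∃ A : Matrix (Fin 24) (Fin 24) ℤ,
      (∀ i j, A i j = A j i) ∧
      (∀ v : Fin 24 → ℤ, ∃ n : ℤ, v ⬝ᵥ A.mulVec v = 2 * n) ∧
      (A.det = 1 ∨ A.det = -1) ∧
      (∀ v : Fin 24 → ℤ, v ≠ 0 → 0 < v ⬝ᵥ A.mulVec v) ∧
      ∃ φ : Plat →ₗ[ℤ] (Fin 24 → ℤ),
        Function.Injective φ ∧
        (∀ x y : Plat, ((φ x ⬝ᵥ A.mulVec (φ y) : ℤ) : ℚ) = -BP (x : VP) (y : VP)) ∧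
        (∃ (v : Fin 24 → ℤ) (n : ℤ), n ≠ 0 ∧ n • v ∈ LinearMap.range φ ∧
          v ∉ LinearMap.range φ)) := by
  exact ⟨fun A h1 h2 h3 h4 φ _ h6 h7 => part1 A h1 h2 h3 h4 φ h6 h7, existence⟩
end
end

section
/- The permutations ϑ₁ = (1,3,8)(2,23,16)(5,22,14)(10,20,21)(11,17,24)(12,13,18), ϑ₂ = (1,23,12)(2,18,8)(3,16,13)(5,14,22)(7,15,19)(10,20,21), and ϑ₃ = (1,8,18,12)(2,13,23,3)(5,10)(7,11,15,24)(14,21,22,20)(17,19) of {1,…,24} all lie in the Mathieu group M₂₄ (i.e. each permutes the coordinates in a way that maps the extended binary Golay code 𝒞₂₄ onto itself), and the subgroup of S₂₄ they generate has order 36 and is isomorphic to (ℤ/3 × ℤ/3) ⋊ ℤ/4, where the generator of ℤ/4 acts on ℤ/3 × ℤ/3 by (a,b) ↦ (−b,a). -/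
/-- Coordinates are labelled `1,…,24`, realized inside `Fin 25` (the coordinate `0` is unused:
all codewords vanish there and every code automorphism fixes it). -/
abbrev X24 : Type := Fin 25

/-- The indicator vector of a set of coordinates. -/
def indvec (S : Finset X24) : X24 → ZMod 2 := fun i => if i ∈ S then 1 else 0

/-- Supports of the twelve generators of the extended binary Golay code. -/
def golayGen : Fin 12 → Finset X24 :=
  ![{1, 2, 3, 5, 12, 16, 18, 22},
    {3, 4, 6, 9, 15, 17, 21, 22},
    {4, 7, 8, 10, 12, 15, 16, 19},
    {7, 8, 11, 15, 16, 17, 18, 23},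
    {1, 2, 4, 7, 8, 16, 18, 21},
    {1, 5, 8, 13, 14, 16, 18, 23},
    {10, 11, 12, 13, 14, 17, 20, 22},
    {3, 8, 9, 11, 13, 18, 19, 23},
    {2, 5, 9, 10, 14, 19, 21, 24},
    {1, 4, 7, 8, 9, 13, 15, 16, 18, 19, 22, 23},
    {1, 2, 3, 7, 8, 10, 11, 13, 16, 18, 22, 23},
    {1, 2, 5, 7, 8, 9, 10, 12, 15, 16, 18, 23}]

/-- The extended binary Golay code `𝒞₂₄`. -/
def Golay : Submodule (ZMod 2) (X24 → ZMod 2) :=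
  Submodule.span (ZMod 2) (Set.range fun i => indvec (golayGen i))

/-- The Mathieu group `M₂₄`: the group of coordinate permutations mapping `𝒞₂₄` onto itself. -/
def M24 : Subgroup (Equiv.Perm X24) where
  carrier := {σ | ∀ c : X24 → ZMod 2, c ∈ Golay ↔ c ∘ σ ∈ Golay}
  one_mem' := fun c => Iff.rfl
  mul_mem' := fun {a b} ha hb c => (ha c).trans (hb (c ∘ a))
  inv_mem' := by
    intro a ha c
    have h2 := ha (c ∘ ⇑a⁻¹)
    rw [show (c ∘ ⇑a⁻¹) ∘ ⇑a = c from by funext x; simp] at h2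
    exact h2.symm

/-- `ϑ₁ = (1,3,8)(2,23,16)(5,22,14)(10,20,21)(11,17,24)(12,13,18)`. -/
def th1 : Equiv.Perm X24 :=
  List.formPerm [1, 3, 8] * List.formPerm [2, 23, 16] * List.formPerm [5, 22, 14] *
    List.formPerm [10, 20, 21] * List.formPerm [11, 17, 24] * List.formPerm [12, 13, 18]

/-- `ϑ₂ = (1,23,12)(2,18,8)(3,16,13)(5,14,22)(7,15,19)(10,20,21)`. -/
def th2 : Equiv.Perm X24 :=
  List.formPerm [1, 23, 12] * List.formPerm [2, 18, 8] * List.formPerm [3, 16, 13] *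
    List.formPerm [5, 14, 22] * List.formPerm [7, 15, 19] * List.formPerm [10, 20, 21]

/-- `ϑ₃ = (1,8,18,12)(2,13,23,3)(5,10)(7,11,15,24)(14,21,22,20)(17,19)`. -/
def th3 : Equiv.Perm X24 :=
  List.formPerm [1, 8, 18, 12] * List.formPerm [2, 13, 23, 3] * List.formPerm [5, 10] *
    List.formPerm [7, 11, 15, 24] * List.formPerm [14, 21, 22, 20] * List.formPerm [17, 19]

/-- Translation by `(1,0)` on `𝔽₃²`. -/
def T1 : Equiv.Perm F3 := Equiv.addLeft ((1, 0) : F3)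

/-- Translation by `(0,1)` on `𝔽₃²`. -/
def T2 : Equiv.Perm F3 := Equiv.addLeft ((0, 1) : F3)

/-- The order-4 map `(a,b) ↦ (−b,a)` on `𝔽₃²`. -/
def JPerm : Equiv.Perm F3 :=
  ⟨fun p => (-p.2, p.1), fun p => (p.2, -p.1), fun p => by simp, fun p => by simp⟩

/-- A concrete model of the semidirect product `(ℤ/3 × ℤ/3) ⋊ ℤ/4`, where the generator of
`ℤ/4` acts on `ℤ/3 × ℤ/3` by `(a,b) ↦ (−b,a)`: the permutation group of `𝔽₃²` generated by the
translations `T1`, `T2` (generating `ℤ/3 × ℤ/3`) and the order-4 map `JPerm`, whose conjugation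
action on the translation subgroup is exactly `(a,b) ↦ (−b,a)`. -/
def ModelGroup : Subgroup (Equiv.Perm F3) := Subgroup.closure {T1, T2, JPerm}

theorem golay_comp_mem (s : Equiv.Perm X24) (A : Fin 12 → Finset (Fin 12))
    (h : ∀ i x, indvec (golayGen i) (s x) = ∑ j ∈ A i, indvec (golayGen j) x)
    (c : X24 → ZMod 2) (hc : c ∈ Golay) : c ∘ s ∈ Golay := by
  unfold Golay at hc
  induction hc using Submodule.span_induction with
  | mem x hx =>
    obtain ⟨i, rfl⟩ := hx
    have e : (indvec (golayGen i)) ∘ s = ∑ j ∈ A i, indvec (golayGen j) := by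
      funext x
      rw [Finset.sum_apply]
      exact h i x
    show (indvec (golayGen i)) ∘ s ∈ Golay
    rw [e]
    exact Submodule.sum_mem _ fun j _ => Submodule.subset_span ⟨j, rfl⟩
  | zero => exact Submodule.zero_mem _
  | add x y _ _ hx hy => exact Submodule.add_mem _ hx hy
  | smul a x _ hx => exact Submodule.smul_mem _ a hx

theorem mem_M24_of (s : Equiv.Perm X24) (A : Fin 12 → Finset (Fin 12))
    (h : ∀ i x, indvec (golayGen i) (s x) = ∑ j ∈ A i, indvec (golayGen j) x)
    (n : ℕ) (hn : s ^ (n + 1) = 1) : s ∈ M24 := by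
  intro c
  refine ⟨golay_comp_mem s A h c, fun hc => ?_⟩
  have key : ∀ k : ℕ, (c ∘ s) ∘ ⇑(s ^ k) ∈ Golay := by
    intro k
    induction k with
    | zero => exact hc
    | succ k ih =>
      rw [pow_succ]
      exact golay_comp_mem s A h _ ih
  have h2 := key n
  have e : (c ∘ s) ∘ ⇑(s ^ n) = c := by
    have : s * s ^ n = 1 := by rw [← pow_succ', hn]
    funext x
    have := congrArg (fun t : Equiv.Perm X24 => c (t x)) this
    exact this
  rwa [e] at h2

/-- The relations of the semidirect product. -/
structure Rels {G : Type*} [Group G] (p q r : G) : Prop where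
  hp : p ^ 3 = 1
  hq : q ^ 3 = 1
  hr : r ^ 4 = 1
  hpq : q * p = p * q
  hrp : r * p = q * r
  hrq : r * q = p ^ 2 * r

/-- Normal form. -/
def nf {G : Type*} [Group G] (p q r : G) (t : Fin 3 × Fin 3 × Fin 4) : G :=
  p ^ (t.1 : ℕ) * q ^ (t.2.1 : ℕ) * r ^ (t.2.2 : ℕ)

theorem Rels.closure_nf {G : Type*} [Group G] {p q r : G} (h : Rels p q r) (x : G)
    (hx : x ∈ Subgroup.closure ({p, q, r} : Set G)) : ∃ t, x = nf p q r t := by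
  have main : ∃ a b k : ℕ, x = p ^ a * q ^ b * r ^ k := by
    have cpq : ∀ a b : ℕ, q ^ b * p ^ a = p ^ a * q ^ b := fun a b =>
      ((show Commute q p from h.hpq).pow_pow b a)
    have Lp : ∀ y : G, (∃ a b k : ℕ, y = p ^ a * q ^ b * r ^ k) →
        ∃ a b k : ℕ, p * y = p ^ a * q ^ b * r ^ k := by
      rintro y ⟨a, b, k, rfl⟩
      exact ⟨a + 1, b, k, by rw [pow_succ']; simp only [mul_assoc]⟩
    have Lq : ∀ y : G, (∃ a b k : ℕ, y = p ^ a * q ^ b * r ^ k) →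
        ∃ a b k : ℕ, q * y = p ^ a * q ^ b * r ^ k := by
      rintro y ⟨a, b, k, rfl⟩
      refine ⟨a, b + 1, k, ?_⟩
      have := cpq a 1
      rw [pow_one] at this
      rw [pow_succ', ← mul_assoc, ← mul_assoc, this]
      simp only [mul_assoc]
    have Lr : ∀ y : G, (∃ a b k : ℕ, y = p ^ a * q ^ b * r ^ k) →
        ∃ a b k : ℕ, r * y = p ^ a * q ^ b * r ^ k := by
      rintro y ⟨a, b, k, rfl⟩
      refine ⟨2 * b, a, k + 1, ?_⟩
      have e1 : r * p ^ a = q ^ a * r :=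
        ((show SemiconjBy r p q from h.hrp).pow_right a)
      have e2 : r * q ^ b = p ^ (2 * b) * r := by
        rw [pow_mul]
        exact ((show SemiconjBy r q (p ^ 2) from h.hrq).pow_right b)
      calc r * (p ^ a * q ^ b * r ^ k) = (r * p ^ a) * q ^ b * r ^ k := by
            simp only [mul_assoc]
        _ = q ^ a * (r * q ^ b) * r ^ k := by rw [e1]; simp only [mul_assoc]
        _ = (q ^ a * p ^ (2 * b)) * (r * r ^ k) := by rw [e2]; simp only [mul_assoc]
        _ = _ := by rw [cpq, pow_succ']
    have ip : p⁻¹ = p * p := by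
      rw [inv_eq_iff_mul_eq_one, ← h.hp]; simp only [pow_succ, pow_zero, one_mul, mul_assoc]
    have iq : q⁻¹ = q * q := by
      rw [inv_eq_iff_mul_eq_one, ← h.hq]; simp only [pow_succ, pow_zero, one_mul, mul_assoc]
    have ir : r⁻¹ = r * (r * r) := by
      rw [inv_eq_iff_mul_eq_one, ← h.hr]; simp only [pow_succ, pow_zero, one_mul, mul_assoc]
    induction hx using Subgroup.closure_induction_left with
    | one => exact ⟨0, 0, 0, by simp⟩
    | mul_left g hg y _ ih =>
      rcases hg with rfl | rfl | rfl
      · exact Lp _ ih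
      · exact Lq _ ih
      · exact Lr _ ih
    | inv_mul_cancel g hg y _ ih =>
      rcases hg with rfl | rfl | rfl
      · rw [ip, mul_assoc]; exact Lp _ (Lp _ ih)
      · rw [iq, mul_assoc]; exact Lq _ (Lq _ ih)
      · rw [ir, mul_assoc, mul_assoc]; exact Lr _ (Lr _ (Lr _ ih))
  obtain ⟨a, b, k, rfl⟩ := main
  refine ⟨(⟨a % 3, Nat.mod_lt _ (by norm_num)⟩, ⟨b % 3, Nat.mod_lt _ (by norm_num)⟩,
    ⟨k % 4, Nat.mod_lt _ (by norm_num)⟩), ?_⟩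
  show _ = p ^ (a % 3) * q ^ (b % 3) * r ^ (k % 4)
  rw [← pow_eq_pow_mod a h.hp, ← pow_eq_pow_mod b h.hq, ← pow_eq_pow_mod k h.hr]

theorem nf_mem {G : Type*} [Group G] (p q r : G) (t) :
    nf p q r t ∈ Subgroup.closure ({p, q, r} : Set G) := by
  have m : ∀ g ∈ ({p, q, r} : Set G), g ∈ Subgroup.closure ({p, q, r} : Set G) :=
    fun g hg => Subgroup.subset_closure hg
  exact mul_mem (mul_mem (pow_mem (m p (by simp)) _) (pow_mem (m q (by simp)) _))
    (pow_mem (m r (by simp)) _)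

theorem Rels.card {G : Type*} [Group G] {p q r : G} (h : Rels p q r)
    (inj : Function.Injective (nf p q r)) :
    Nat.card (Subgroup.closure ({p, q, r} : Set G)) = 36 := by
  have hb : Function.Bijective (fun t => (⟨nf p q r t, nf_mem p q r t⟩ :
      Subgroup.closure ({p, q, r} : Set G))) := by
    constructor
    · intro s t hst
      exact inj (congrArg Subtype.val hst)
    · rintro ⟨x, hx⟩
      obtain ⟨t, rfl⟩ := h.closure_nf x hx
      exact ⟨t, rfl⟩
  rw [← Nat.card_eq_of_bijective _ hb]
  simp

theorem map_nf {G H : Type*} [Group G] [Group H] (f : G →* H) (p q r : G) (t) :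
    f (nf p q r t) = nf (f p) (f q) (f r) t := by
  simp [nf]

theorem Rels.equiv_of_hom {D G : Type*} [Group D] [Group G] {p q r : D} (h : Rels p q r)
    (f : D →* G) (inj : Function.Injective (nf (f p) (f q) (f r))) :
    Nonempty (Subgroup.closure ({p, q, r} : Set D) ≃*
      Subgroup.closure ({f p, f q, f r} : Set G)) := by
  have e : (Subgroup.closure ({p, q, r} : Set D)).map f =
      Subgroup.closure ({f p, f q, f r} : Set G) := by
    rw [MonoidHom.map_closure]
    congr 1
    simp [Set.image_insert_eq]
  rw [← e]
  let g := f.subgroupMap (Subgroup.closure ({p, q, r} : Set D))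
  refine ⟨MulEquiv.ofBijective g ⟨?_, f.subgroupMap_surjective _⟩⟩
  rintro ⟨x, hx⟩ ⟨y, hy⟩ hxy
  have h1 : f x = f y := congrArg Subtype.val hxy
  obtain ⟨s, rfl⟩ := h.closure_nf x hx
  obtain ⟨t, rfl⟩ := h.closure_nf y hy
  rw [map_nf, map_nf] at h1
  rw [Subtype.mk.injEq, inj h1]

theorem Rels.prod {G H : Type*} [Group G] [Group H] {p q r : G} {p' q' r' : H}
    (h : Rels p q r) (h' : Rels p' q' r') : Rels (p, p') (q, q') (r, r') :=
  ⟨Prod.ext h.hp h'.hp, Prod.ext h.hq h'.hq, Prod.ext h.hr h'.hr,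
    Prod.ext h.hpq h'.hpq, Prod.ext h.hrp h'.hrp, Prod.ext h.hrq h'.hrq⟩

theorem rels_th : Rels th1 th2 th3 := by
  constructor <;> decide +kernel

theorem rels_T : Rels T1 T2 JPerm := by
  constructor <;> decide +kernel

theorem inj_th : Function.Injective (nf th1 th2 th3) := by
  have h : ∀ s t, (nf th1 th2 th3 s 1 = nf th1 th2 th3 t 1 ∧
      nf th1 th2 th3 s 3 = nf th1 th2 th3 t 3) → s = t := by decide +kernel
  intro s t hst
  exact h s t ⟨by rw [hst], by rw [hst]⟩

theorem inj_T : Function.Injective (nf T1 T2 JPerm) := by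
  have h : ∀ s t, (nf T1 T2 JPerm s (0, 0) = nf T1 T2 JPerm t (0, 0) ∧
      nf T1 T2 JPerm s (1, 0) = nf T1 T2 JPerm t (1, 0)) → s = t := by decide +kernel
  intro s t hst
  exact h s t ⟨by rw [hst], by rw [hst]⟩

theorem th1_mem : th1 ∈ M24 :=
  mem_M24_of th1
    ![{5},
      {0, 1, 2, 4, 5, 6, 7, 10, 11},
      {0, 4, 7, 10, 11},
      {4, 5, 8, 9, 10},
      {0, 3, 5, 6, 7, 9, 10},
      {0, 5},
      {0, 5, 7, 8},
      {0, 2, 4, 5, 7, 8, 10, 11},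
      {0, 2, 4, 6, 10, 11},
      {0, 9},
      {0, 5, 7, 8, 10},
      {0, 2, 4, 5, 7, 10}]
    (by decide +kernel) 2 rels_th.hp

theorem th2_mem : th2 ∈ M24 :=
  mem_M24_of th2
    ![{0, 5},
      {0, 1, 2, 3, 4, 6, 7, 10, 11},
      {0, 4, 7, 10, 11},
      {0, 3, 7, 10, 11},
      {0, 2, 3, 5, 6},
      {0},
      {3, 4, 5, 7, 9, 10},
      {0, 10, 11},
      {2, 3, 6, 7, 8, 9, 10},
      {0, 5, 9},
      {4, 5, 9, 10, 11},
      {0, 2, 4, 11}]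
    (by decide +kernel) 2 rels_th.hq

theorem th3_mem : th3 ∈ M24 :=
  mem_M24_of th3
    ![{0, 2, 4, 7, 10, 11},
      {0, 1, 2, 3, 5, 7, 9, 10},
      {2, 3, 4, 5, 7, 8, 9, 10, 11},
      {0, 4, 5, 7, 8, 9, 11},
      {0, 4, 7, 8, 10},
      {2, 3, 5, 6, 9, 11},
      {2, 3, 4, 5, 6},
      {0, 3, 10, 11},
      {6, 10, 11},
      {2, 3, 5, 8},
      {0, 5, 7, 8, 10},
      {4, 5, 8, 9, 10, 11}]
    (by decide +kernel) 3 rels_th.hr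

theorem statement17 :
    th1 ∈ M24 ∧ th2 ∈ M24 ∧ th3 ∈ M24 ∧
    Nat.card (Subgroup.closure {th1, th2, th3} : Subgroup (Equiv.Perm X24)) = 36 ∧
    Nonempty ((Subgroup.closure {th1, th2, th3} : Subgroup (Equiv.Perm X24)) ≃* ModelGroup) := by
  refine ⟨th1_mem, th2_mem, th3_mem, rels_th.card inj_th, ?_⟩
  obtain ⟨e1⟩ := (rels_th.prod rels_T).equiv_of_hom
    (MonoidHom.fst (Equiv.Perm X24) (Equiv.Perm F3)) inj_th
  obtain ⟨e2⟩ := (rels_th.prod rels_T).equiv_of_hom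
    (MonoidHom.snd (Equiv.Perm X24) (Equiv.Perm F3)) inj_T
  exact ⟨e1.symm.trans e2⟩
end

section
/- Let O := {3,5,6,9,15,19,23,24}; the indicator vector of O belongs to 𝒞₂₄ (O is an octad). Then the Mathieu group M₂₄ is generated by its subgroup {σ ∈ M₂₄ : σ(O) = O} (the setwise stabilizer of O, which is isomorphic to (ℤ/2)⁴ ⋊ A₈) together with the three permutations ϑ₁ = (1,3,8)(2,23,16)(5,22,14)(10,20,21)(11,17,24)(12,13,18), ϑ₂ = (1,23,12)(2,18,8)(3,16,13)(5,14,22)(7,15,19)(10,20,21), ϑ₃ = (1,8,18,12)(2,13,23,3)(5,10)(7,11,15,24)(14,21,22,20)(17,19). -/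
/-- The octad `O = {3,5,6,9,15,19,23,24}`. -/
def Oset : Finset X24 := {3, 5, 6, 9, 15, 19, 23, 24}

open Pointwise in
/-- The setwise stabilizer of `O` in `M₂₄` (it is isomorphic to `(ℤ/2)⁴ ⋊ A₈`). -/
def StabO : Subgroup (Equiv.Perm X24) :=
  M24 ⊓ MulAction.stabilizer (Equiv.Perm X24) (↑Oset : Set X24)

namespace GolayAux

def toVec (n : Nat) : X24 → ZMod 2 := fun i => if n.testBit i.val then 1 else 0

theorem toVec_xor (m n : Nat) : toVec (m ^^^ n) = toVec m + toVec n := by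
  funext i
  simp only [toVec, Pi.add_apply, Nat.testBit_xor]
  cases m.testBit i.val <;> cases n.testBit i.val <;> decide

theorem toVec_zero : toVec 0 = 0 := by
  funext i
  simp [toVec]

theorem toVec_self (c : X24 → ZMod 2) : c + c = 0 := by
  funext i
  exact CharTwo.add_self_eq_zero (c i)

/-- masks of the generators -/
def masks : List Nat := [4526126, 6455896, 628112, 8882560, 2425238, 8741154, 5405696, 9186056, 19416612, 13476754, 12922254, 8755110]

theorem masks_get : ∀ i : Fin 12, ∃ n ∈ masks, ∀ j : X24, (decide (j ∈ golayGen i)) = n.testBit j.val := by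
  decide +kernel

theorem masks_get' : ∀ n ∈ masks, ∃ i : Fin 12, ∀ j : X24, (decide (j ∈ golayGen i)) = n.testBit j.val := by
  decide +kernel

theorem indvec_eq {S : Finset X24} {n : Nat} (h : ∀ j : X24, (decide (j ∈ S)) = n.testBit j.val) :
    indvec S = toVec n := by
  funext j
  simp only [indvec, toVec, ← h j, decide_eq_true_eq]

def sp (gs : List Nat) : Submodule (ZMod 2) (X24 → ZMod 2) :=
  Submodule.span (ZMod 2) (toVec '' {n | n ∈ gs})

theorem golay_eq : Golay = sp masks := by
  unfold Golay sp
  congr 1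
  ext c
  constructor
  · rintro ⟨i, rfl⟩
    obtain ⟨n, hn, h⟩ := masks_get i
    exact ⟨n, hn, (indvec_eq h).symm⟩
  · rintro ⟨n, hn, rfl⟩
    obtain ⟨i, h⟩ := masks_get' n hn
    exact ⟨i, indvec_eq h⟩

theorem mask_mem {n : Nat} (h : n ∈ masks) : toVec n ∈ Golay := by
  rw [golay_eq]
  exact Submodule.subset_span ⟨n, h, rfl⟩

def force (n : Nat) (f : Nat → Bool) : Bool := Nat.rec (f 0) (fun m _ => f (m + 1)) n

theorem force_eq (n : Nat) (f : Nat → Bool) : force n f = f n := by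
  cases n <;> rfl

def chk (leaf : Nat → Bool) : List Nat → Nat → Bool
  | [], n => leaf n
  | g :: gs, n => chk leaf gs n && force (n ^^^ g) (chk leaf gs)

theorem chk_sound (leaf : Nat → Bool) : ∀ (gs : List Nat) (n : Nat), chk leaf gs n = true →
    ∀ c ∈ sp gs, ∃ m, toVec n + c = toVec m ∧ leaf m = true := by
  intro gs
  induction gs with
  | nil =>
    intro n h c hc
    have : c = 0 := by simpa [sp] using hc
    exact ⟨n, by simp [this], h⟩
  | cons g gs ih =>
    intro n h c hc
    simp only [chk, force_eq, Bool.and_eq_true] at h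
    have hset : toVec '' {n | n ∈ g :: gs} = insert (toVec g) (toVec '' {n | n ∈ gs}) := by
      rw [← Set.image_insert_eq]
      congr 1
      ext x
      simp
    rw [sp, hset, Submodule.mem_span_insert] at hc
    obtain ⟨a, z, hz, rfl⟩ := hc
    have ha : a = 0 ∨ a = 1 := by revert a; decide
    rcases ha with rfl | rfl
    · obtain ⟨m, hm, hl⟩ := ih n h.1 z hz
      exact ⟨m, by simpa using hm, hl⟩
    · obtain ⟨m, hm, hl⟩ := ih _ h.2 z hz
      refine ⟨m, ?_, hl⟩
      rw [← hm, toVec_xor, one_smul, add_assoc]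

/-- reduction modulo a list of words -/
def red : List Nat → Nat → Nat
  | [], n => n
  | b :: bs, n => red bs (if Nat.ble n (n ^^^ b) then n else n ^^^ b)

theorem red_sound : ∀ (bs : List Nat), (∀ b ∈ bs, toVec b ∈ Golay) → ∀ n,
    toVec (red bs n) ∈ Golay → toVec n ∈ Golay := by
  intro bs
  induction bs with
  | nil => intro _ n h; exact h
  | cons b bs ih =>
    intro hb n h
    have h1 := ih (fun x hx => hb x (List.mem_cons_of_mem _ hx)) _ h
    split at h1
    · exact h1
    · rw [toVec_xor] at h1
      exact (Submodule.add_mem_iff_left _ (hb b List.mem_cons_self)).1 h1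

theorem red_sound' : ∀ (bs : List Nat), (∀ b ∈ bs, toVec b ∈ Golay) → ∀ n,
    toVec n ∈ Golay → toVec (red bs n) ∈ Golay := by
  intro bs
  induction bs with
  | nil => intro _ n h; exact h
  | cons b bs ih =>
    intro hb n h
    apply ih (fun x hx => hb x (List.mem_cons_of_mem _ hx))
    split
    · exact h
    · rw [toVec_xor]
      exact Submodule.add_mem _ h (hb b List.mem_cons_self)

def ech : List Nat → List Nat → List Nat
  | [], acc => acc
  | g :: gs, acc => ech gs (acc ++ [red acc g])

theorem ech_sound : ∀ (gs acc : List Nat), (∀ b ∈ gs, toVec b ∈ Golay) →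
    (∀ b ∈ acc, toVec b ∈ Golay) → ∀ b ∈ ech gs acc, toVec b ∈ Golay := by
  intro gs
  induction gs with
  | nil => intro acc _ h; exact h
  | cons g gs ih =>
    intro acc h1 h2
    apply ih _ (fun x hx => h1 x (List.mem_cons_of_mem _ hx))
    intro b hb
    rcases List.mem_append.1 hb with hb | hb
    · exact h2 b hb
    · rw [List.mem_singleton.1 hb]
      exact red_sound' _ h2 _ (h1 g List.mem_cons_self)

def basis : List Nat := ech masks []

theorem mem_of_red {n : Nat} (h : red basis n = 0) : toVec n ∈ Golay := by
  apply red_sound basis (ech_sound _ _ (fun b hb => mask_mem hb) (by simp))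
  rw [h, toVec_zero]
  exact zero_mem _

/-- action on masks -/
def ap : List Nat → Nat → Nat
  | [], _ => 0
  | a :: l, n => 2 * ap l n + (n >>> a) % 2

theorem ap_testBit (n : Nat) : ∀ (l : List Nat) (i a : Nat), l[i]? = some a →
    (ap l n).testBit i = n.testBit a := by
  intro l
  induction l with
  | nil => intro i a h; simp at h
  | cons b l ih =>
    intro i a h
    cases i with
    | zero =>
      have hb : b = a := by simpa using h
      subst hb
      simp only [ap, Nat.testBit_zero]
      rw [Nat.testBit_eq_decide_div_mod_eq, Nat.shiftRight_eq_div_pow]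
      congr 1
      apply propext
      omega
    | succ i =>
      have h' : l[i]? = some a := by simpa using h
      rw [← ih i a h', Nat.testBit_succ]
      congr 1
      simp only [ap]
      omega

def Rep (σ : Equiv.Perm X24) (l : List Nat) : Prop := ∀ i : X24, l[i.val]? = some (σ i).val

instance (σ : Equiv.Perm X24) (l : List Nat) : Decidable (Rep σ l) := by
  unfold Rep
  infer_instance

theorem ap_toVec {σ : Equiv.Perm X24} {l : List Nat} (h : Rep σ l) (n : Nat) :
    toVec n ∘ σ = toVec (ap l n) := by
  funext i
  simp only [toVec, Function.comp, ap_testBit n l _ _ (h i)]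

theorem closed_of {σ : Equiv.Perm X24} {l : List Nat} (h : Rep σ l)
    (hl : ∀ n ∈ masks, red basis (ap l n) = 0) (c : X24 → ZMod 2) (hc : c ∈ Golay) :
    c ∘ σ ∈ Golay := by
  have key : Golay ≤ Golay.comap (LinearMap.funLeft (ZMod 2) (ZMod 2) σ) := by
    conv_lhs => rw [golay_eq]
    unfold sp
    rw [Submodule.span_le]
    rintro _ ⟨n, hn, rfl⟩
    change toVec n ∘ σ ∈ Golay
    rw [ap_toVec h]
    exact mem_of_red (hl n hn)
  exact key hc

theorem mem_M24 {σ : Equiv.Perm X24} {l l' : List Nat} (h : Rep σ l) (h' : Rep σ⁻¹ l')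
    (hl : ∀ n ∈ masks, red basis (ap l n) = 0) (hl' : ∀ n ∈ masks, red basis (ap l' n) = 0) :
    σ ∈ M24 := by
  intro c
  constructor
  · exact closed_of h hl c
  · intro hc
    have := closed_of h' hl' _ hc
    rwa [show (c ∘ ⇑σ) ∘ ⇑σ⁻¹ = c from by funext x; simp] at this

def mk (l l' : List X24) (h : ∀ i : X24, l'.getD (l.getD i.val 0).val 0 = i)
    (h' : ∀ i : X24, l.getD (l'.getD i.val 0).val 0 = i) : Equiv.Perm X24 :=
  ⟨fun i => l.getD i.val 0, fun i => l'.getD i.val 0, h, h'⟩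

def l1 : List Nat := [0, 3, 23, 8, 4, 22, 6, 7, 1, 9, 20, 17, 13, 18, 5, 15, 2, 24, 12, 19, 21, 10, 14, 16, 11]
def m1 : List Nat := [0, 8, 16, 1, 4, 14, 6, 7, 3, 9, 21, 24, 18, 12, 22, 15, 23, 11, 13, 19, 10, 20, 5, 2, 17]
def l2 : List Nat := [0, 23, 18, 16, 4, 14, 6, 15, 2, 9, 20, 11, 1, 3, 22, 19, 13, 17, 8, 7, 21, 10, 5, 12, 24]
def m2 : List Nat := [0, 12, 8, 13, 4, 22, 6, 19, 18, 9, 21, 11, 23, 16, 5, 7, 3, 17, 2, 15, 10, 20, 14, 1, 24]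
def l3 : List Nat := [0, 8, 13, 2, 4, 10, 6, 11, 18, 9, 5, 15, 1, 23, 21, 24, 16, 19, 12, 17, 14, 22, 20, 3, 7]
def m3 : List Nat := [0, 12, 3, 23, 4, 10, 6, 24, 1, 9, 5, 7, 18, 2, 20, 11, 16, 19, 8, 17, 22, 14, 21, 13, 15]
def l4 : List Nat := [0, 14, 20, 9, 4, 6, 5, 22, 7, 15, 8, 17, 11, 13, 1, 23, 2, 21, 16, 19, 18, 12, 10, 3, 24]
def m4 : List Nat := [0, 14, 16, 23, 4, 6, 5, 8, 10, 3, 22, 12, 21, 13, 1, 9, 18, 11, 20, 19, 2, 17, 7, 15, 24]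
def l5 : List Nat := [0, 7, 18, 19, 20, 23, 24, 17, 1, 9, 14, 8, 12, 10, 21, 6, 16, 4, 13, 5, 11, 22, 2, 15, 3]
def m5 : List Nat := [0, 8, 22, 24, 17, 19, 15, 1, 11, 9, 13, 20, 12, 18, 10, 23, 16, 7, 2, 3, 4, 14, 21, 5, 6]
def s4 : Equiv.Perm X24 :=
  mk [0, 14, 20, 9, 4, 6, 5, 22, 7, 15, 8, 17, 11, 13, 1, 23, 2, 21, 16, 19, 18, 12, 10, 3, 24]
    [0, 14, 16, 23, 4, 6, 5, 8, 10, 3, 22, 12, 21, 13, 1, 9, 18, 11, 20, 19, 2, 17, 7, 15, 24]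
    (by decide +kernel) (by decide +kernel)
def s5 : Equiv.Perm X24 :=
  mk [0, 7, 18, 19, 20, 23, 24, 17, 1, 9, 14, 8, 12, 10, 21, 6, 16, 4, 13, 5, 11, 22, 2, 15, 3]
    [0, 8, 22, 24, 17, 19, 15, 1, 11, 9, 13, 20, 12, 18, 10, 23, 16, 7, 2, 3, 4, 14, 21, 5, 6]
    (by decide +kernel) (by decide +kernel)

theorem rep1 : Rep th1 l1 := by decide +kernel
theorem mem1 : th1 ∈ M24 :=
  mem_M24 (l := l1) (l' := m1) rep1 (by decide +kernel) (by decide +kernel) (by decide +kernel)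

theorem rep2 : Rep th2 l2 := by decide +kernel
theorem mem2 : th2 ∈ M24 :=
  mem_M24 (l := l2) (l' := m2) rep2 (by decide +kernel) (by decide +kernel) (by decide +kernel)

theorem rep3 : Rep th3 l3 := by decide +kernel
theorem mem3 : th3 ∈ M24 :=
  mem_M24 (l := l3) (l' := m3) rep3 (by decide +kernel) (by decide +kernel) (by decide +kernel)

theorem rep4 : Rep s4 l4 := by decide +kernel
theorem mem4 : s4 ∈ M24 :=
  mem_M24 (l := l4) (l' := m4) rep4 (by decide +kernel) (by decide +kernel) (by decide +kernel)

theorem rep5 : Rep s5 l5 := by decide +kernel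
theorem mem5 : s5 ∈ M24 :=
  mem_M24 (l := l5) (l' := m5) rep5 (by decide +kernel) (by decide +kernel) (by decide +kernel)

def oct : Nat := 25723496

theorem oct_eq : indvec Oset = toVec oct := indvec_eq (by decide +kernel)

theorem oct_iff (i : X24) : i ∈ Oset ↔ toVec oct i = 1 := by
  revert i
  decide +kernel

open Pointwise in
theorem mem_stab {σ : Equiv.Perm X24} (h : σ ∈ M24) (h2 : toVec oct ∘ σ = toVec oct) :
    σ ∈ StabO := by
  refine ⟨h, ?_⟩
  change σ ∈ MulAction.stabilizer (Equiv.Perm X24) (↑Oset : Set X24)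
  rw [← inv_mem_iff]
  rw [MulAction.mem_stabilizer_iff]
  ext x
  rw [Set.mem_inv_smul_set_iff]
  simp only [Equiv.Perm.smul_def, Finset.mem_coe, oct_iff]
  rw [← congrFun h2 x]
  rfl

abbrev GG : Subgroup (Equiv.Perm X24) :=
  Subgroup.closure ((StabO : Set (Equiv.Perm X24)) ∪ {th1, th2, th3})

theorem stab_le {σ : Equiv.Perm X24} (h : σ ∈ StabO) : σ ∈ GG :=
  Subgroup.subset_closure (Or.inl h)

theorem s4_stab : s4 ∈ StabO :=
  mem_stab mem4 (by rw [ap_toVec rep4]; congr 1)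

theorem s5_stab : s5 ∈ StabO :=
  mem_stab mem5 (by rw [ap_toVec rep5]; congr 1)

/-- descent table: a base 8 digit for each value of the top twelve coordinates -/
def table : Nat := 0x40000000000000000000000000000000000180000000000000000030030000000000000000000000000000000000000000000000000000000000000000000000000030000000000080000000000030000000000000000000000030000000000000000000000d80000c00000000000000000000000000000030000036000830000000000000000000000030000000000000000000000000000000000000000000000000000000000000000000200020000000000000000000000000000000000000006000000030000000000040030000000c00000000c001800000100000a0000000000000000000000000000000000c000000000000b0000000000020000101000000000000030000000430036000000000200000000000000400000010000040000030c000800000000000400000400321c0030080001040880c001b09c0000000000000000000000000000000000000000000000100000000000000000020000000000000000010000000030000000000000000000000000000000000000000000030000020000000000010000000000030000000000800000400030200000000000000000000000000000000000000000000000410000000000000000000200800000020c000000000000401100000000000000000800000100000300120000004001b0000000000030100030020003040000010000dc0c001000810400000000000000000000000000000000200000000000010000000000040000000000000300000000000208000800012400000200000000000000002300000000008800300001804200000000300000004802008400010400101000301b70140300000000000000004000400800002000000400000420300200100000000400000200006000004001004301c0020c040800000000010300400000220104000000301402005c0800200000230c00906000c20c201200420481c08200032411b8420000000000000000000000000000000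000000000000000030000000040000000000000000000000000000000180000000000000000000000030000000000000000000000000200400000000000000000000001040000000006040c00000040120000000000000000000006000000000000010000000000010000000000000000010000020000000000400000400c300000000000000000000000300000001800000000010400402200000000001b0200000000080030000200840002000028e40000000000000000000000000000000000000000030c000000000000000000000000001800000000010300400000000300000000010000000000301800300000000300000200012400000800000200000440000200008001b0040100431048d00000010000000000000030030000000020000000200180030000000000000030000080c400000100201b0000220009240000000000030800080000e00000800032230040040005030040031044000007010200a40000240d000110201c91400b0000000000000000000000010000400000000000000030000000000000000000000000d00000000000020030002001020000000000180000000000000000000010020030000003030000010000000006000180040000020c40100000020181040000000000000000000030000000000180020000000c008000000800008400000000300300200000300200804400381400300000004000000000004c0000010000426000020c380800000120300200004404120804080002004401801069b0c00000000000020080000000000000000000020000020044200000010000040000040c40100030000d808000010001b00c0000000030000000410024020000146000420000100c40190c000000002200301404091400280200286421804111382300000004001000000200010c00200200040100420001a08000008001b0000022212000800000540c081204000381006200020400300c00201391804202010400301000310a0100d401810100232004401009c51108c0145009220025084100e0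

def sel : Nat → List Nat
  | 0 => l1
  | 1 => l2
  | 2 => l3
  | 3 => l4
  | _ => l5

theorem sel_rep (k : Nat) : ∃ g ∈ GG, Rep g (sel k) := by
  have h1 : th1 ∈ GG := Subgroup.subset_closure (Or.inr (by simp))
  have h2 : th2 ∈ GG := Subgroup.subset_closure (Or.inr (by simp))
  have h3 : th3 ∈ GG := Subgroup.subset_closure (Or.inr (by simp))
  match k with
  | 0 => exact ⟨_, h1, rep1⟩
  | 1 => exact ⟨_, h2, rep2⟩
  | 2 => exact ⟨_, h3, rep3⟩
  | 3 => exact ⟨_, stab_le s4_stab, rep4⟩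
  | _ + 4 => exact ⟨_, stab_le s5_stab, rep5⟩

def desc : Nat → Nat → Bool
  | 0, n => Nat.beq n oct
  | k + 1, n => Nat.beq n oct ||
      force (ap (sel ((table >>> (3 * (n >>> 13))) % 8)) n) (desc k)

theorem desc_sound : ∀ (k n : Nat), desc k n = true → ∃ g ∈ GG, toVec n ∘ g = toVec oct := by
  intro k
  induction k with
  | zero =>
    intro n h
    have : n = oct := Nat.eq_of_beq_eq_true h
    exact ⟨1, one_mem _, by rw [this]; rfl⟩
  | succ k ih =>
    intro n h
    simp only [desc, force_eq, Bool.or_eq_true] at h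
    rcases h with h | h
    · have : n = oct := Nat.eq_of_beq_eq_true h
      exact ⟨1, one_mem _, by rw [this]; rfl⟩
    · obtain ⟨g, hg, hr⟩ := sel_rep ((table >>> (3 * (n >>> 13))) % 8)
      obtain ⟨g', hg', h'⟩ := ih _ h
      refine ⟨g * g', mul_mem hg hg', ?_⟩
      rw [← h', ← ap_toVec hr]
      rfl

def wt : Nat → Nat → Nat
  | 0, _ => 0
  | k + 1, n => wt k n + (n >>> k) % 2

theorem wt_eq (n : Nat) : ∀ k, wt k n = ∑ i ∈ Finset.range k, (if n.testBit i then 1 else 0) := by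
  intro k
  induction k with
  | zero => rfl
  | succ k ih =>
    rw [Finset.sum_range_succ, ← ih, wt, Nat.testBit_eq_decide_div_mod_eq,
      Nat.shiftRight_eq_div_pow]
    congr 1
    simp only [decide_eq_true_eq]
    split <;> omega

def vwt (c : X24 → ZMod 2) : Nat := ∑ i, if c i = 1 then 1 else 0

theorem vwt_toVec (n : Nat) : vwt (toVec n) = wt 25 n := by
  rw [wt_eq, vwt, ← Fin.sum_univ_eq_sum_range (fun i => if n.testBit i then 1 else 0)]
  apply Finset.sum_congr rfl
  intro i _
  simp only [toVec]
  by_cases h : n.testBit i.val = true <;> simp [h]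

theorem vwt_comp (c : X24 → ZMod 2) (σ : Equiv.Perm X24) : vwt (c ∘ σ) = vwt c :=
  Equiv.sum_comp σ (fun i => if c i = 1 then 1 else 0)

def leaf (n : Nat) : Bool := !(Nat.beq (wt 25 n) 8) || desc 7 n

theorem chk_all : chk leaf masks 0 = true := by decide +kernel

theorem main : GG = M24 := by
  apply le_antisymm
  · rw [Subgroup.closure_le]
    rintro σ (h | h)
    · exact h.1
    · rcases h with rfl | rfl | rfl
      · exact mem1
      · exact mem2
      · exact mem3
  · intro σ hσ
    have hle : GG ≤ M24 := by
      rw [Subgroup.closure_le]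
      rintro σ (h | h)
      · exact h.1
      · rcases h with rfl | rfl | rfl
        · exact mem1
        · exact mem2
        · exact mem3
    have hO : toVec oct ∈ Golay := mem_of_red (by decide +kernel)
    have h1 := (hσ _).1 hO
    have h1' := h1
    rw [golay_eq] at h1'
    obtain ⟨m, hm, hl⟩ := chk_sound leaf masks 0 chk_all _ h1'
    rw [toVec_zero, zero_add] at hm
    have hw : wt 25 m = 8 := by
      rw [← vwt_toVec, ← hm, vwt_comp, vwt_toVec]
      decide +kernel
    have hd : desc 7 m = true := by
      simpa [leaf, hw] using hl
    obtain ⟨g, hg, hgm⟩ := desc_sound _ _ hd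
    have hs : σ * g ∈ StabO := by
      apply mem_stab (mul_mem hσ (hle hg))
      rw [hm.symm] at hgm
      exact hgm
    have := mul_mem (stab_le hs) (inv_mem hg)
    simpa using this

end GolayAux

theorem statement18 :
    -- O is an octad
    indvec Oset ∈ Golay ∧ Oset.card = 8 ∧
    -- M₂₄ is generated by the setwise stabilizer of O together with ϑ₁, ϑ₂, ϑ₃
    Subgroup.closure ((StabO : Set (Equiv.Perm X24)) ∪ {th1, th2, th3}) = M24 := by
  refine ⟨?_, rfl, GolayAux.main⟩
  rw [GolayAux.oct_eq]
  exact GolayAux.mem_of_red (by decide +kernel)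
end
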